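/- Let d ≥ 4 be an even integer. Then the set Σ_ℝ = {(α, λ) ∈ ℂ^{d−1} × ℂ : there exists a nonzero entire function y : ℂ → ℂ with y''(z) = (P_α(z) − λ) y(z) for all z ∈ ℂ, such that y(x) → 0 as x → +∞ along the real axis and y(x) → 0 as x → −∞ along the real axis} is nonempty and path-connected. Consequently, for every potential P_α of even degree d ≥ 4 with boundary conditions y → 0 as z → ±∞ on ℝ, there is an analytic continuation from any eigenvalue λ_m to any other eigenvalue λ_n in the α-plane. -/

import Mathlib

open Complex Filter Topology

/-- The polynomial potential `P_α(z) = z^d + α_{d-1} z^{d-1} + ⋯ + α₁ z`. -/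
noncomputable def Pol (d : ℕ) (α : Fin (d - 1) → ℂ) (z : ℂ) : ℂ :=
  z ^ d + ∑ i : Fin (d - 1), α i * z ^ ((i : ℕ) + 1)

/-- `y` is an (entire) solution of the Schrödinger equation `y'' = (P_α - λ) y`. -/
def IsSol (d : ℕ) (α : Fin (d - 1) → ℂ) (lam : ℂ) (y : ℂ → ℂ) : Prop :=
  Differentiable ℂ y ∧ ∀ z : ℂ, deriv (deriv y) z = (Pol d α z - lam) * y z

/-- `θ` is a ray direction of the Stokes sector `S_j`. -/
def DirIn (n j : ℕ) (θ : ℝ) : Prop :=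
  |θ - 2 * Real.pi * j / n| < Real.pi / n

/-- `y` is subdominant in the Stokes sector `S_j`: it tends to `0` along every ray in `S_j`. -/
def Subdominant (n j : ℕ) (y : ℂ → ℂ) : Prop :=
  ∀ θ : ℝ, DirIn n j θ →
    Tendsto (fun r : ℝ => y ((r : ℂ) * Complex.exp (θ * Complex.I))) atTop (𝓝 0)

section PowerSeries

/-- The sum of the power series with coefficients `c`. -/
noncomputable def ps (c : ℕ → ℂ) (z : ℂ) : ℂ := ∑' n, c n * z ^ n

/-- The coefficients of the derived power series. -/
noncomputable def dsh (c : ℕ → ℂ) (n : ℕ) : ℂ := ((n : ℂ) + 1) * c (n + 1)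

/-- Coefficients decaying faster than any geometric sequence. -/
def Ent (c : ℕ → ℂ) : Prop := ∀ R : ℝ, 1 ≤ R → ∃ C : ℝ, ∀ n, ‖c n‖ * R ^ n ≤ C

theorem dsh_bound {c : ℕ → ℂ} {R C : ℝ} (hR : 1 ≤ R)
    (h : ∀ n, ‖c n‖ * (2 * R) ^ n ≤ C) (n : ℕ) : ‖dsh c n‖ * R ^ n ≤ C := by
  have h1 := h (n + 1)
  have h2 : ‖dsh c n‖ = ((n : ℝ) + 1) * ‖c (n + 1)‖ := by
    rw [dsh, norm_mul]
    congr 1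
    have : ((n : ℂ) + 1) = ((n + 1 : ℝ) : ℂ) := by push_cast; rfl
    rw [this, Complex.norm_real, Real.norm_of_nonneg (by positivity)]
  have h3 : (n : ℝ) + 1 ≤ 2 ^ (n + 1) := by
    have := (Nat.lt_two_pow_self (n := n + 1)).le
    exact_mod_cast this
  have h4 : R ^ n ≤ R ^ (n + 1) := pow_le_pow_right₀ hR (by omega)
  calc ‖dsh c n‖ * R ^ n = ((n : ℝ) + 1) * R ^ n * ‖c (n + 1)‖ := by rw [h2]; ring
    _ ≤ 2 ^ (n + 1) * R ^ (n + 1) * ‖c (n + 1)‖ := by gcongr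
    _ = ‖c (n + 1)‖ * (2 * R) ^ (n + 1) := by rw [mul_pow]; ring
    _ ≤ C := h1

theorem Ent.dsh {c : ℕ → ℂ} (h : Ent c) : Ent (dsh c) := by
  intro R hR
  obtain ⟨C, hC⟩ := h (2 * R) (by linarith)
  exact ⟨C, dsh_bound hR hC⟩

theorem ps_term_bound {c : ℕ → ℂ} {R C : ℝ} (hR : 1 ≤ R)
    (h : ∀ n, ‖c n‖ * (2 * R) ^ n ≤ C) {z : ℂ} (hz : ‖z‖ ≤ R) (n : ℕ) :
    ‖c n * z ^ n‖ ≤ C * (1 / 2) ^ n := by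
  rw [norm_mul, norm_pow]
  have : ‖c n‖ * ‖z‖ ^ n ≤ ‖c n‖ * R ^ n := by gcongr
  refine this.trans ?_
  have h1 := h n
  rw [mul_pow] at h1
  have h2 : ‖c n‖ * R ^ n = (‖c n‖ * (2 ^ n * R ^ n)) * (1 / 2) ^ n := by
    rw [one_div, inv_pow]; field_simp
  rw [h2]
  gcongr

theorem summable_geom_half (C : ℝ) : Summable (fun n : ℕ => C * (1 / 2 : ℝ) ^ n) :=
  summable_geometric_two.mul_left C

theorem Ent.summable {c : ℕ → ℂ} (h : Ent c) (z : ℂ) : Summable (fun n => ‖c n * z ^ n‖) := by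
  obtain ⟨C, hC⟩ := h (2 * (1 + ‖z‖)) (by linarith [norm_nonneg z])
  exact (summable_geom_half C).of_nonneg_of_le (fun _ => norm_nonneg _)
    (fun n => ps_term_bound (by linarith [norm_nonneg z]) hC (by linarith) n)

theorem Ent.hasDerivAt {c : ℕ → ℂ} (h : Ent c) (z : ℂ) :
    HasDerivAt (ps c) (ps (_root_.dsh c) z) z := by
  set R := 1 + ‖z‖ with hRdef
  have hR : 1 ≤ R := by linarith [norm_nonneg z]
  obtain ⟨C, hC⟩ := h.dsh (2 * R) (by linarith)
  have key := hasDerivAt_tsum_of_isPreconnected (𝕜 := ℂ) (F := ℂ)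
    (u := fun n : ℕ => if n = 0 then 0 else C * (1 / 2) ^ (n - 1))
    (t := Metric.ball (0 : ℂ) R)
    (g := fun n z => c n * z ^ n) (g' := fun n z => c n * (n * z ^ (n - 1))) (y₀ := 0) (y := z)
    ?_ Metric.isOpen_ball (convex_ball _ _).isPreconnected ?_ ?_ (by simp; linarith) ?_
    (by simp; linarith)
  · have e : ps (_root_.dsh c) z = ∑' n, c n * (n * z ^ (n - 1)) := ?_
    · rw [e]; exact key
    rw [(summable_nat_add_iff 1 (f := fun n => c n * (n * z ^ (n - 1)))).1 ?_ |>.tsum_eq_zero_add]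
    · simp only [ps, _root_.dsh, CharP.cast_eq_zero, zero_mul, mul_zero, zero_add,
        Nat.add_sub_cancel]
      congr 1; ext n; push_cast; ring
    · have := (h.dsh.summable z).of_norm
      refine this.congr fun n => ?_
      simp [_root_.dsh]; ring
  · rw [← summable_nat_add_iff 1]
    simpa using (summable_geom_half C)
  · intro n y _
    exact (hasDerivAt_pow n y).const_mul (c n)
  · intro n y hy
    rcases n with _ | n
    · simp
    · have := ps_term_bound hR hC (z := y) (by simpa using (mem_ball_zero_iff.1 hy).le) n
      simp only [Nat.add_eq_zero_iff, one_ne_zero, and_false, if_false, Nat.add_sub_cancel]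
      refine le_trans (le_of_eq ?_) this
      congr 1
      rw [_root_.dsh]; push_cast; ring
  · exact (h.summable 0).of_norm

theorem ps_tendsto {ι : Type*} {l : Filter ι} {c : ι → ℕ → ℂ} {c0 : ℕ → ℂ} {z : ι → ℂ} {z0 : ℂ}
    (hc : ∀ n, Tendsto (fun t => c t n) l (𝓝 (c0 n))) (hz : Tendsto z l (𝓝 z0))
    (hb : ∀ R : ℝ, 1 ≤ R → ∃ C : ℝ, ∀ᶠ t in l, ∀ n, ‖c t n‖ * R ^ n ≤ C) :
    Tendsto (fun t => ps (c t) (z t)) l (𝓝 (ps c0 z0)) := by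
  have hR : 1 ≤ 1 + ‖z0‖ := by linarith [norm_nonneg z0]
  obtain ⟨C, hC⟩ := hb (2 * (1 + ‖z0‖)) (by linarith)
  refine tendsto_tsum_of_dominated_convergence (bound := fun n => C * (1 / 2) ^ n)
    (summable_geom_half C) (fun n => (hc n).mul (hz.pow n)) ?_
  filter_upwards [hC, hz.norm.eventually_lt_const (u := 1 + ‖z0‖) (by linarith)] with t ht hzt n
  exact ps_term_bound hR ht hzt.le n

end PowerSeries

section SeriesSolution

open Polynomial

/-- Taylor coefficients at `0` of the solution of `y'' = q y`, `y(0) = a`, `y'(0) = b`. -/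
noncomputable def cf (q : ℂ[X]) (a b : ℂ) : ℕ → ℂ
  | 0 => a
  | 1 => b
  | n + 2 => (∑ j : Fin (n + 1), q.coeff j * cf q a b (n - j)) / (((n : ℂ) + 1) * (n + 2))
decreasing_by omega

theorem cf_zero (q : ℂ[X]) (a b : ℂ) : cf q a b 0 = a := by rw [cf]

theorem cf_one (q : ℂ[X]) (a b : ℂ) : cf q a b 1 = b := by rw [cf]

theorem cf_add_two (q : ℂ[X]) (a b : ℂ) (n : ℕ) : cf q a b (n + 2) =
    (∑ j ∈ Finset.range (n + 1), q.coeff j * cf q a b (n - j)) / (((n : ℂ) + 1) * (n + 2)) := by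
  rw [cf, Finset.sum_range (fun j => q.coeff j * cf q a b (n - j))]

theorem norm_succ_mul (n : ℕ) : ‖((n : ℂ) + 1) * (n + 2)‖ = ((n : ℝ) + 1) * (n + 2) := by
  have : ((n : ℂ) + 1) * (n + 2) = ((((n : ℝ) + 1) * (n + 2) : ℝ) : ℂ) := by push_cast; rfl
  rw [this, Complex.norm_real, Real.norm_of_nonneg (by positivity)]

theorem cf_bound (d : ℕ) (K R : ℝ) (hR : 1 ≤ R) : ∃ C : ℝ, ∀ (q : ℂ[X]) (a b : ℂ),
    q.natDegree ≤ d → (∀ j, ‖q.coeff j‖ ≤ K) → ‖a‖ ≤ K → ‖b‖ ≤ K →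
    ∀ n, ‖cf q a b n‖ * R ^ n ≤ C := by
  by_cases hK : K < 0
  · exact ⟨0, fun q a b _ _ ha => absurd (norm_nonneg a) (by linarith)⟩
  push Not at hK
  set B : ℝ := (d + 1) * (K * R ^ (d + 2)) with hB
  have hB0 : 0 ≤ B := by positivity
  set k : ℕ := ⌈B⌉₊ with hk
  have hkB : B ≤ k := Nat.le_ceil B
  refine ⟨K * R * (1 + B) ^ k, fun q a b hd hq ha hb => ?_⟩
  have main : ∀ n, ‖cf q a b n‖ * R ^ n ≤ K * R * (1 + B) ^ (min n k) := by
    intro n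
    induction n using Nat.strong_induction_on with
    | _ n ih =>
    have hone : ∀ m, 1 ≤ (1 + B) ^ m := fun m => one_le_pow₀ (by linarith)
    rcases n with _ | _ | n
    · rw [cf_zero]
      simp only [pow_zero, mul_one, zero_le, inf_of_le_left]
      nlinarith
    · rw [zero_add, cf_one, pow_one]
      have := hone (min 1 k)
      have h1 : ‖b‖ * R ≤ K * R := by gcongr
      nlinarith [mul_nonneg hK (by linarith : 0 ≤ R)]
    · rw [cf_add_two, norm_div, norm_succ_mul]
      have hsum : ‖∑ j ∈ Finset.range (n + 1), q.coeff j * cf q a b (n - j)‖ * R ^ (n + 2)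
          ≤ B * (K * R * (1 + B) ^ (min n k)) := by
        calc ‖∑ j ∈ Finset.range (n + 1), q.coeff j * cf q a b (n - j)‖ * R ^ (n + 2)
            ≤ (∑ j ∈ Finset.range (n + 1), ‖q.coeff j * cf q a b (n - j)‖) * R ^ (n + 2) := by
              gcongr; exact norm_sum_le _ _
          _ = ∑ j ∈ Finset.range (n + 1), ‖q.coeff j * cf q a b (n - j)‖ * R ^ (n + 2) := by
              rw [Finset.sum_mul]
          _ ≤ ∑ j ∈ Finset.range (n + 1), (if j ∈ Finset.range (d + 1) then
                K * R ^ (d + 2) * (K * R * (1 + B) ^ (min n k)) else 0) := by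
              refine Finset.sum_le_sum fun j hj => ?_
              split_ifs with hjd
              · have hj' : j ≤ n := by simpa [Nat.lt_succ_iff] using hj
                have hjd' : j ≤ d := by simpa [Nat.lt_succ_iff] using hjd
                have e1 : R ^ (n + 2) = R ^ (j + 2) * R ^ (n - j) := by
                  rw [← pow_add]; congr 1; omega
                have e2 := ih (n - j) (by omega)
                have e3 : (1 + B) ^ (min (n - j) k) ≤ (1 + B) ^ (min n k) :=
                  pow_le_pow_right₀ (by linarith) (by omega)
                have e4 : R ^ (j + 2) ≤ R ^ (d + 2) := pow_le_pow_right₀ hR (by omega)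
                rw [norm_mul, e1]
                calc ‖q.coeff j‖ * ‖cf q a b (n - j)‖ * (R ^ (j + 2) * R ^ (n - j))
                    = (‖q.coeff j‖ * R ^ (j + 2)) * (‖cf q a b (n - j)‖ * R ^ (n - j)) := by ring
                  _ ≤ (K * R ^ (d + 2)) * (K * R * (1 + B) ^ (min (n - j) k)) := by
                      gcongr
                      exact hq j
                  _ ≤ _ := by gcongr
              · have : q.coeff j = 0 := by
                  apply Polynomial.coeff_eq_zero_of_natDegree_lt
                  simp at hjd; omega
                simp [this]
          _ ≤ ∑ j ∈ Finset.range (d + 1), K * R ^ (d + 2) * (K * R * (1 + B) ^ (min n k)) := by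
              rw [← Finset.sum_filter]
              refine Finset.sum_le_sum_of_subset_of_nonneg ?_ ?_
              · intro j; simp
              · intros; positivity
          _ = B * (K * R * (1 + B) ^ (min n k)) := by
              rw [Finset.sum_const, Finset.card_range, nsmul_eq_mul, hB]; push_cast; ring
      have hden : (0 : ℝ) < ((n : ℝ) + 1) * (n + 2) := by positivity
      rw [div_mul_eq_mul_div, div_le_iff₀ hden]
      refine hsum.trans ?_
      by_cases hn : n < k
      · have : min (n + 1 + 1) k = min n k + 1 ∨ min (n + 1 + 1) k = min n k + 2 := by omega
        have h5 : (1 + B) ^ (min n k + 1) ≤ (1 + B) ^ (min (n + 1 + 1) k) :=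
          pow_le_pow_right₀ (by linarith) (by omega)
        have h6 : (1:ℝ) ≤ ((n : ℝ) + 1) * (n + 2) := by
          have : (0:ℝ) ≤ n := Nat.cast_nonneg n
          nlinarith
        calc B * (K * R * (1 + B) ^ (min n k)) ≤ (1 + B) * (K * R * (1 + B) ^ (min n k)) := by
              gcongr; linarith
          _ = K * R * (1 + B) ^ (min n k + 1) := by ring
          _ ≤ K * R * (1 + B) ^ (min (n + 1 + 1) k) := by gcongr
          _ = K * R * (1 + B) ^ (min (n + 1 + 1) k) * 1 := by ring
          _ ≤ _ := by gcongr
      · have h1 : min n k = k := by omega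
        have h2 : min (n + 1 + 1) k = k := by omega
        rw [h1, h2, mul_comm]
        gcongr
        have : (k : ℝ) ≤ n := by exact_mod_cast (not_lt.1 hn)
        have h0 : (0:ℝ) ≤ n := Nat.cast_nonneg n
        nlinarith
  intro n
  refine (main n).trans ?_
  gcongr
  · linarith
  · omega

theorem cf_ent (q : ℂ[X]) (a b : ℂ) : Ent (cf q a b) := by
  intro R hR
  have hs : ∀ j, ‖q.coeff j‖ ≤ ∑ i ∈ Finset.range (q.natDegree + 1), ‖q.coeff i‖ := by
    intro j
    by_cases hj : j < q.natDegree + 1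
    · exact Finset.single_le_sum (f := fun i => ‖q.coeff i‖) (fun _ _ => norm_nonneg _)
        (Finset.mem_range.2 hj)
    · rw [Polynomial.coeff_eq_zero_of_natDegree_lt (by omega)]
      simp only [norm_zero]
      exact Finset.sum_nonneg fun _ _ => norm_nonneg _
  have hs0 := (norm_nonneg _).trans (hs 0)
  obtain ⟨C, hC⟩ := cf_bound q.natDegree
    (‖a‖ + ‖b‖ + ∑ i ∈ Finset.range (q.natDegree + 1), ‖q.coeff i‖) R hR
  refine ⟨C, hC q a b le_rfl (fun j => ?_) ?_ ?_⟩
  · linarith [hs j, norm_nonneg a, norm_nonneg b]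
  · linarith [norm_nonneg b]
  · linarith [norm_nonneg a]

/-- The solution of `y'' = q y` with `y(0) = a`, `y'(0) = b`. -/
noncomputable def sol (q : ℂ[X]) (a b z : ℂ) : ℂ := ps (cf q a b) z

/-- The derivative of `sol q a b`. -/
noncomputable def sol' (q : ℂ[X]) (a b z : ℂ) : ℂ := ps (dsh (cf q a b)) z

theorem sol_hasDerivAt (q : ℂ[X]) (a b z : ℂ) : HasDerivAt (sol q a b) (sol' q a b z) z :=
  (cf_ent q a b).hasDerivAt z

theorem sol'_hasDerivAt (q : ℂ[X]) (a b z : ℂ) :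
    HasDerivAt (sol' q a b) (q.eval z * sol q a b z) z := by
  have e : q.eval z * sol q a b z = ps (dsh (dsh (cf q a b))) z := ?_
  · rw [e]; exact (cf_ent q a b).dsh.hasDerivAt z
  have h1 : q.eval z = ∑' n, q.coeff n * z ^ n := by
    rw [tsum_eq_sum (s := Finset.range (q.natDegree + 1)), Polynomial.eval_eq_sum_range]
    intro j hj
    rw [Polynomial.coeff_eq_zero_of_natDegree_lt (by simpa using hj)]; simp
  have h2 : Summable (fun n => ‖q.coeff n * z ^ n‖) := by
    refine summable_of_ne_finset_zero (s := Finset.range (q.natDegree + 1)) fun j hj => ?_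
    rw [Polynomial.coeff_eq_zero_of_natDegree_lt (by simpa using hj)]; simp
  rw [h1, sol, ps, tsum_mul_tsum_eq_tsum_sum_range_of_summable_norm h2 ((cf_ent q a b).summable z),
    ps]
  congr 1; ext n
  rw [dsh, dsh, cf_add_two, Finset.sum_congr rfl (g := fun j => q.coeff j * cf q a b (n - j) * z ^
      n),
    ← Finset.sum_mul]
  · have e1 : ((n : ℂ) + 1) ≠ 0 := by exact_mod_cast Nat.succ_ne_zero n
    have e2 : ((n : ℂ) + 2) ≠ 0 := by exact_mod_cast Nat.succ_ne_zero (n + 1)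
    push_cast
    field_simp
    ring
  · intro j hj
    have : j ≤ n := by simpa [Nat.lt_succ_iff] using hj
    calc q.coeff j * z ^ j * (cf q a b (n - j) * z ^ (n - j))
        = q.coeff j * cf q a b (n - j) * (z ^ j * z ^ (n - j)) := by ring
      _ = _ := by rw [← pow_add, Nat.add_sub_cancel' this]

theorem ps_zero (c : ℕ → ℂ) : ps c 0 = c 0 := by
  rw [ps, tsum_eq_single 0]
  · simp
  · intro n hn; simp [hn]

theorem sol_zero (q : ℂ[X]) (a b : ℂ) : sol q a b 0 = a := by
  rw [sol, ps_zero, cf_zero]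

theorem sol'_zero (q : ℂ[X]) (a b : ℂ) : sol' q a b 0 = b := by
  rw [sol', ps_zero, dsh, zero_add, cf_one]; simp

/-- Coefficientwise convergence of polynomials of bounded degree. -/
def PTend {ι : Type*} (l : Filter ι) (p : ι → ℂ[X]) (q : ℂ[X]) : Prop :=
  (∃ d : ℕ, ∀ᶠ t in l, (p t).natDegree ≤ d) ∧ ∀ j, Tendsto (fun t => (p t).coeff j) l (𝓝 (q.coeff
      j))

theorem PTend.bound {ι : Type*} {l : Filter ι} {p : ι → ℂ[X]} {q : ℂ[X]} (h : PTend l p q) :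
    ∃ K : ℝ, ∀ᶠ t in l, ∀ j, ‖(p t).coeff j‖ ≤ K := by
  obtain ⟨⟨d, hd⟩, hc⟩ := h
  refine ⟨∑ i ∈ Finset.range (d + 1), (‖q.coeff i‖ + 1), ?_⟩
  have h1 : ∀ᶠ t in l, ∀ j ∈ Finset.range (d + 1), ‖(p t).coeff j‖ < ‖q.coeff j‖ + 1 := by
    rw [Filter.eventually_all_finset]
    intro j _
    exact (hc j).norm.eventually_lt_const (by linarith)
  filter_upwards [hd, h1] with t ht1 ht2 j
  by_cases hj : j < d + 1
  · refine (ht2 j (Finset.mem_range.2 hj)).le.trans ?_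
    exact Finset.single_le_sum (f := fun i => ‖q.coeff i‖ + 1) (fun _ _ => by positivity)
        (Finset.mem_range.2 hj)
  · rw [Polynomial.coeff_eq_zero_of_natDegree_lt (by omega)]
    simp only [norm_zero]
    positivity

theorem cf_tendsto {ι : Type*} {l : Filter ι} {p : ι → ℂ[X]} {q : ℂ[X]} (h : PTend l p q)
    {a b : ι → ℂ} {a0 b0 : ℂ} (ha : Tendsto a l (𝓝 a0)) (hb : Tendsto b l (𝓝 b0)) (n : ℕ) :
    Tendsto (fun t => cf (p t) (a t) (b t) n) l (𝓝 (cf q a0 b0 n)) := by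
  induction n using Nat.strong_induction_on with
  | _ n ih =>
  rcases n with _ | _ | n
  · simpa [cf_zero] using ha
  · simpa [cf_one] using hb
  · simp only [cf_add_two]
    refine Tendsto.div_const (tendsto_finsetSum _ fun j hj => (h.2 j).mul (ih _ (by omega))) _

theorem cf_ev_bound {ι : Type*} {l : Filter ι} {p : ι → ℂ[X]} {q : ℂ[X]} (h : PTend l p q)
    {a b : ι → ℂ} {a0 b0 : ℂ} (ha : Tendsto a l (𝓝 a0)) (hb : Tendsto b l (𝓝 b0)) (R : ℝ)
    (hR : 1 ≤ R) : ∃ C : ℝ, ∀ᶠ t in l, ∀ n, ‖cf (p t) (a t) (b t) n‖ * R ^ n ≤ C := by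
  obtain ⟨K, hK⟩ := h.bound
  obtain ⟨d, hd⟩ := h.1
  obtain ⟨C, hC⟩ := cf_bound d (max K (max (‖a0‖ + 1) (‖b0‖ + 1))) R hR
  refine ⟨C, ?_⟩
  filter_upwards [hK, hd, ha.norm.eventually_lt_const (u := ‖a0‖ + 1) (by linarith),
    hb.norm.eventually_lt_const (u := ‖b0‖ + 1) (by linarith)] with t h1 h2 h3 h4
  exact hC _ _ _ h2 (fun j => (h1 j).trans (le_max_left _ _))
    (h3.le.trans (by simp)) (h4.le.trans (by simp))

theorem sol_tendsto {ι : Type*} {l : Filter ι} {p : ι → ℂ[X]} {q : ℂ[X]} (h : PTend l p q)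
    {a b z : ι → ℂ} {a0 b0 z0 : ℂ} (ha : Tendsto a l (𝓝 a0)) (hb : Tendsto b l (𝓝 b0))
    (hz : Tendsto z l (𝓝 z0)) :
    Tendsto (fun t => sol (p t) (a t) (b t) (z t)) l (𝓝 (sol q a0 b0 z0)) :=
  ps_tendsto (cf_tendsto h ha hb) hz (cf_ev_bound h ha hb)

theorem sol'_tendsto {ι : Type*} {l : Filter ι} {p : ι → ℂ[X]} {q : ℂ[X]} (h : PTend l p q)
    {a b z : ι → ℂ} {a0 b0 z0 : ℂ} (ha : Tendsto a l (𝓝 a0)) (hb : Tendsto b l (𝓝 b0))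
    (hz : Tendsto z l (𝓝 z0)) :
    Tendsto (fun t => sol' (p t) (a t) (b t) (z t)) l (𝓝 (sol' q a0 b0 z0)) := by
  refine ps_tendsto (fun n => (cf_tendsto h ha hb (n + 1)).const_mul _) hz fun R hR => ?_
  obtain ⟨C, hC⟩ := cf_ev_bound h ha hb (2 * R) (by linarith)
  exact ⟨C, hC.mono fun t ht => dsh_bound hR ht⟩

/-- A family of polynomials of bounded degree with coefficients holomorphic on `Ω`. -/
def PHol (Ω : Set ℂ) (p : ℂ → ℂ[X]) : Prop :=
  (∃ d : ℕ, ∀ w ∈ Ω, (p w).natDegree ≤ d) ∧ ∀ j, DifferentiableOn ℂ (fun w => (p w).coeff j) Ω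

theorem PHol.tend {Ω : Set ℂ} {p : ℂ → ℂ[X]} (h : PHol Ω p) {w : ℂ} (hw : w ∈ Ω) :
    PTend (𝓝[Ω] w) p (p w) :=
  ⟨⟨h.1.choose, eventually_mem_nhdsWithin.mono h.1.choose_spec⟩,
    fun j => (h.2 j).continuousOn w hw⟩

theorem cf_hol {Ω : Set ℂ} {p : ℂ → ℂ[X]} (h : PHol Ω p) {a b : ℂ → ℂ}
    (ha : DifferentiableOn ℂ a Ω) (hb : DifferentiableOn ℂ b Ω) (n : ℕ) :
    DifferentiableOn ℂ (fun w => cf (p w) (a w) (b w) n) Ω := by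
  induction n using Nat.strong_induction_on with
  | _ n ih =>
  rcases n with _ | _ | n
  · simpa [cf_zero] using ha
  · simpa [cf_one] using hb
  · simp only [cf_add_two]
    refine DifferentiableOn.div_const (DifferentiableOn.fun_sum fun j hj => (h.2 j).mul (ih _ (by
        omega))) _

theorem ps_hol {Ω : Set ℂ} (hΩ : IsOpen Ω) {c : ℂ → ℕ → ℂ} (z : ℂ)
    (hc : ∀ n, DifferentiableOn ℂ (fun w => c w n) Ω)
    (hb : ∀ w ∈ Ω, ∀ R : ℝ, 1 ≤ R → ∃ C : ℝ, ∀ᶠ t in 𝓝[Ω] w, ∀ n, ‖c t n‖ * R ^ n ≤ C) :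
    DifferentiableOn ℂ (fun w => ps (c w) z) Ω := by
  intro w hw
  have hR : 1 ≤ 1 + ‖z‖ := by linarith [norm_nonneg z]
  obtain ⟨C, hC⟩ := hb w hw (2 * (1 + ‖z‖)) (by linarith)
  rw [hΩ.nhdsWithin_eq hw] at hC
  obtain ⟨U, hU, hUo, hwU⟩ := eventually_nhds_iff.1 (hC.and (hΩ.mem_nhds hw))
  have := differentiableOn_tsum_of_summable_norm (F := fun n w => c w n * z ^ n)
    (summable_geom_half C)
    (fun n => ((hc n).mono fun t ht => (hU t ht).2).mul_const _) hUo
    (fun n t ht => ps_term_bound hR (hU t ht).1 (by linarith) n)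
  exact (this.differentiableAt (hUo.mem_nhds hwU)).differentiableWithinAt

theorem sol_hol {Ω : Set ℂ} (hΩ : IsOpen Ω) {p : ℂ → ℂ[X]} (h : PHol Ω p) {a b : ℂ → ℂ}
    (ha : DifferentiableOn ℂ a Ω) (hb : DifferentiableOn ℂ b Ω) (z : ℂ) :
    DifferentiableOn ℂ (fun w => sol (p w) (a w) (b w) z) Ω :=
  ps_hol hΩ z (cf_hol h ha hb) fun w hw =>
    cf_ev_bound (h.tend hw) (ha.continuousOn w hw) (hb.continuousOn w hw)

theorem sol'_hol {Ω : Set ℂ} (hΩ : IsOpen Ω) {p : ℂ → ℂ[X]} (h : PHol Ω p) {a b : ℂ → ℂ}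
    (ha : DifferentiableOn ℂ a Ω) (hb : DifferentiableOn ℂ b Ω) (z : ℂ) :
    DifferentiableOn ℂ (fun w => sol' (p w) (a w) (b w) z) Ω := by
  refine ps_hol hΩ z (fun n => (cf_hol h ha hb (n + 1)).const_mul _) fun w hw R hR => ?_
  obtain ⟨C, hC⟩ := cf_ev_bound (h.tend hw) (ha.continuousOn w hw) (hb.continuousOn w hw)
    (2 * R) (by linarith)
  exact ⟨C, hC.mono fun t ht => dsh_bound hR ht⟩

end SeriesSolution

section Solutions

open Polynomial

/-- `y` solves `y'' = q y`, with derivative `v`. -/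
def IsS (q : ℂ[X]) (y v : ℂ → ℂ) : Prop :=
  ∀ z, HasDerivAt y (v z) z ∧ HasDerivAt v (q.eval z * y z) z

theorem sol_isS (q : ℂ[X]) (a b : ℂ) : IsS q (sol q a b) (sol' q a b) :=
  fun z => ⟨sol_hasDerivAt q a b z, sol'_hasDerivAt q a b z⟩

theorem IsS.wronskian {q : ℂ[X]} {y v w u : ℂ → ℂ} (h1 : IsS q y v) (h2 : IsS q w u) (z z' : ℂ) :
    y z * u z - v z * w z = y z' * u z' - v z' * w z' := by
  have key : ∀ x, HasDerivAt (fun z => y z * u z - v z * w z) 0 x := by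
    intro x
    exact (((h1 x).1.mul (h2 x).2).sub ((h1 x).2.mul (h2 x).1)).congr_deriv (by ring)
  exact is_const_of_deriv_eq_zero (fun x => (key x).differentiableAt) (fun x => (key x).deriv) z z'

theorem IsS.comb {q : ℂ[X]} {y v w u : ℂ → ℂ} (h1 : IsS q y v) (h2 : IsS q w u) (c e : ℂ) :
    IsS q (fun z => c * y z + e * w z) (fun z => c * v z + e * u z) := by
  intro z
  refine ⟨((h1 z).1.const_mul c).add ((h2 z).1.const_mul e), ?_⟩
  exact (((h1 z).2.const_mul c).add ((h2 z).2.const_mul e)).congr_deriv (by ring)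

theorem IsS.eq_zero {q : ℂ[X]} {y v : ℂ → ℂ} (h : IsS q y v) {x : ℂ} (h0 : y x = 0) (h1 : v x = 0)
    (z : ℂ) : y z = 0 ∧ v z = 0 := by
  have e1 := h.wronskian (sol_isS q 1 0) z x
  have e2 := h.wronskian (sol_isS q 0 1) z x
  have e3 := (sol_isS q 1 0).wronskian (sol_isS q 0 1) z 0
  rw [h0, h1] at e1 e2
  simp only [sol_zero, sol'_zero] at e3
  constructor
  · linear_combination (-y z) * e3 - sol q 0 1 z * e1 + sol q 1 0 z * e2
  · linear_combination (-v z) * e3 - sol' q 0 1 z * e1 + sol' q 1 0 z * e2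

theorem IsS.eq_of {q : ℂ[X]} {y v w u : ℂ → ℂ} (h1 : IsS q y v) (h2 : IsS q w u) {x : ℂ}
    (h3 : y x = w x) (h4 : v x = u x) (z : ℂ) : y z = w z ∧ v z = u z := by
  have := (h1.comb h2 1 (-1)).eq_zero (x := x) (by simp [h3]) (by simp [h4]) z
  constructor
  · linear_combination this.1
  · linear_combination this.2

theorem IsS.eq_sol {q : ℂ[X]} {y v : ℂ → ℂ} (h : IsS q y v) (z : ℂ) :
    y z = sol q (y 0) (v 0) z ∧ v z = sol' q (y 0) (v 0) z :=
  h.eq_of (sol_isS q _ _) (x := 0) (sol_zero _ _ _).symm (sol'_zero _ _ _).symm z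

/-- Solutions form a linear space, in terms of initial data. -/
theorem sol_comb (q : ℂ[X]) (a b a' b' c e z : ℂ) :
    sol q (c * a + e * a') (c * b + e * b') z = c * sol q a b z + e * sol q a' b' z ∧
    sol' q (c * a + e * a') (c * b + e * b') z = c * sol' q a b z + e * sol' q a' b' z := by
  have := ((sol_isS q a b).comb (sol_isS q a' b') c e).eq_sol z
  simp only [sol_zero, sol'_zero] at this
  exact ⟨this.1.symm, this.2.symm⟩

/-- Composition of a polynomial with the affine map `z ↦ s z + r`. -/
noncomputable def aff (s r : ℂ) (q : ℂ[X]) : ℂ[X] := q.comp (C s * X + C r)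

theorem aff_eval (s r : ℂ) (q : ℂ[X]) (z : ℂ) : (aff s r q).eval z = q.eval (s * z + r) := by
  simp [aff]

theorem IsS.aff {q : ℂ[X]} {y v : ℂ → ℂ} (h : IsS q y v) (s r : ℂ) :
    IsS (C (s ^ 2) * aff s r q) (fun z => y (s * z + r)) (fun z => s * v (s * z + r)) := by
  intro z
  have h0 : HasDerivAt (fun z => s * z + r) s z := by
    simpa using ((hasDerivAt_id z).const_mul s).add_const r
  refine ⟨?_, ?_⟩
  · have := HasDerivAt.comp z (h (s * z + r)).1 h0
    exact this.congr_deriv (by ring)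
  · have := (HasDerivAt.comp z (h (s * z + r)).2 h0).const_mul s
    exact this.congr_deriv (by simp [aff_eval]; ring)

theorem IsS.aff_one {q : ℂ[X]} {y v : ℂ → ℂ} (h : IsS q y v) (r : ℂ) :
    IsS (_root_.aff 1 r q) (fun z => y (z + r)) (fun z => v (z + r)) := by
  simpa using h.aff 1 r

theorem IsS.aff_neg {q : ℂ[X]} {y v : ℂ → ℂ} (h : IsS q y v) (r : ℂ) :
    IsS (_root_.aff (-1) r q) (fun z => y (-z + r)) (fun z => -v (-z + r)) := by
  simpa using h.aff (-1) r

theorem aff_natDegree_le (s r : ℂ) (q : ℂ[X]) : (aff s r q).natDegree ≤ q.natDegree := by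
  rw [aff]
  refine natDegree_comp_le.trans ?_
  have : (C s * X + C r : ℂ[X]).natDegree ≤ 1 := natDegree_linear_le
  calc _ ≤ q.natDegree * 1 := by gcongr
    _ = _ := by ring

theorem aff_coeff {d : ℕ} {q : ℂ[X]} (h : q.natDegree ≤ d) (s r : ℂ) (j : ℕ) :
    (aff s r q).coeff j = ∑ i ∈ Finset.range (d + 1),
      q.coeff i * ((C s * X + C r : ℂ[X]) ^ i).coeff j := by
  rw [aff, comp, eval₂_eq_sum_range' _ (Nat.lt_succ_of_le h), finsetSum_coeff]
  simp only [coeff_C_mul]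

theorem PTend.aff {ι : Type*} {l : Filter ι} {p : ι → ℂ[X]} {q : ℂ[X]} (h : PTend l p q)
    (s r : ℂ) : PTend l (fun t => aff s r (p t)) (aff s r q) := by
  obtain ⟨⟨d, hd⟩, hc⟩ := h
  refine ⟨⟨d, hd.mono fun t ht => (aff_natDegree_le _ _ _).trans ht⟩, fun j => ?_⟩
  rw [aff_coeff (le_max_right d q.natDegree)]
  refine Tendsto.congr' (hd.mono fun t ht => (aff_coeff (ht.trans (le_max_left d q.natDegree)) s r
      j).symm) ?_
  exact tendsto_finsetSum _ fun i _ => (hc i).mul_const _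

theorem PHol.aff {Ω : Set ℂ} {p : ℂ → ℂ[X]} (h : PHol Ω p) (s r : ℂ) :
    PHol Ω (fun w => aff s r (p w)) := by
  obtain ⟨⟨d, hd⟩, hc⟩ := h
  refine ⟨⟨d, fun w hw => (aff_natDegree_le _ _ _).trans (hd w hw)⟩, fun j => ?_⟩
  refine DifferentiableOn.congr (f := fun w => ∑ i ∈ Finset.range (d + 1),
      (p w).coeff i * ((C s * X + C r : ℂ[X]) ^ i).coeff j) ?_ fun w hw => aff_coeff (hd w hw) s r j
  exact DifferentiableOn.fun_sum fun i _ => (hc i).mul_const _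

end Solutions

section HalfLine

open Polynomial

/-- Half of the derivative of `|y|²` along the real axis. -/
noncomputable def En (y v : ℂ → ℂ) (x : ℝ) : ℝ := ((starRingEnd ℂ) (y x) * v x).re

theorem IsS.hasDerivAt_real {q : ℂ[X]} {y v : ℂ → ℂ} (h : IsS q y v) (x : ℝ) :
    HasDerivAt (fun x : ℝ => y x) (v x) x ∧ HasDerivAt (fun x : ℝ => v x) (q.eval (x : ℂ) * y x) x
        :=
  ⟨(h x).1.comp_ofReal, (h x).2.comp_ofReal⟩

theorem IsS.hasDerivAt_normSq {q : ℂ[X]} {y v : ℂ → ℂ} (h : IsS q y v) (x : ℝ) :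
    HasDerivAt (fun x : ℝ => normSq (y x)) (2 * En y v x) x := by
  have h1 := (h.hasDerivAt_real x).1
  have h2 : HasDerivAt (fun x : ℝ => (y x).re) (v x).re x := by
    exact (Complex.reCLM.hasFDerivAt.comp_hasDerivAt x h1)
  have h3 : HasDerivAt (fun x : ℝ => (y x).im) (v x).im x := by
    exact (Complex.imCLM.hasFDerivAt.comp_hasDerivAt x h1)
  simp only [normSq_apply]
  exact ((h2.mul h2).add (h3.mul h3)).congr_deriv (by simp [En]; ring)

theorem IsS.hasDerivAt_En {q : ℂ[X]} {y v : ℂ → ℂ} (h : IsS q y v) (x : ℝ) :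
    HasDerivAt (En y v) (normSq (v x) + (q.eval (x : ℂ)).re * normSq (y x)) x := by
  have h1 := (h.hasDerivAt_real x).1
  have h1' := (h.hasDerivAt_real x).2
  have h2 : HasDerivAt (fun x : ℝ => (y x).re) (v x).re x := by
    exact (Complex.reCLM.hasFDerivAt.comp_hasDerivAt x h1)
  have h3 : HasDerivAt (fun x : ℝ => (y x).im) (v x).im x := by
    exact (Complex.imCLM.hasFDerivAt.comp_hasDerivAt x h1)
  have h4 : HasDerivAt (fun x : ℝ => (v x).re) (q.eval (x : ℂ) * y x).re x := by
    exact (Complex.reCLM.hasFDerivAt.comp_hasDerivAt x h1')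
  have h5 : HasDerivAt (fun x : ℝ => (v x).im) (q.eval (x : ℂ) * y x).im x := by
    exact (Complex.imCLM.hasFDerivAt.comp_hasDerivAt x h1')
  have : En y v = fun x : ℝ => (y x).re * (v x).re + (y x).im * (v x).im := by
    ext x; simp [En]
  rw [this]
  exact ((h2.mul h4).add (h3.mul h5)).congr_deriv (by simp [normSq_apply]; ring)

theorem monoOn_of_hasDerivAt {f f' : ℝ → ℝ} {a b : ℝ} (h : ∀ x, HasDerivAt f (f' x) x)
    (h' : ∀ x ∈ Set.Icc a b, 0 ≤ f' x) {s t : ℝ} (hs : a ≤ s) (hst : s ≤ t) (ht : t ≤ b) :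
    f s ≤ f t := by
  refine monotoneOn_of_deriv_nonneg (convex_Icc a b)
    (fun x _ => (h x).continuousAt.continuousWithinAt)
    (fun x _ => (h x).differentiableAt.differentiableWithinAt) (fun x hx => ?_)
    ⟨hs, hst.trans ht⟩ ⟨hs.trans hst, ht⟩ hst
  rw [(h x).deriv]
  exact h' x (interior_subset hx)

theorem IsS.En_mono {q : ℂ[X]} {y v : ℂ → ℂ} (h : IsS q y v) {a b : ℝ}
    (hq : ∀ x ∈ Set.Icc a b, 0 ≤ (q.eval (x : ℂ)).re) {s t : ℝ} (hs : a ≤ s) (hst : s ≤ t)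
    (ht : t ≤ b) : En y v s ≤ En y v t :=
  monoOn_of_hasDerivAt h.hasDerivAt_En
    (fun x hx => add_nonneg (normSq_nonneg _) (mul_nonneg (hq x hx) (normSq_nonneg _))) hs hst ht

theorem IsS.normSq_anti {q : ℂ[X]} {y v : ℂ → ℂ} (h : IsS q y v) {a b : ℝ}
    (hq : ∀ x ∈ Set.Icc a b, 0 ≤ (q.eval (x : ℂ)).re) (hb : En y v b ≤ 0) {s t : ℝ} (hs : a ≤ s)
    (hst : s ≤ t) (ht : t ≤ b) : normSq (y t) ≤ normSq (y s) := by
  have := monoOn_of_hasDerivAt (f := fun x : ℝ => -normSq (y x)) (a := a) (b := b)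
    (fun x => (h.hasDerivAt_normSq x).neg)
    (fun x hx => by have := h.En_mono hq hx.1 hx.2 le_rfl; linarith) hs hst ht
  linarith

/-- A solution with `Re (conj y · y') ≤ 0` at `b` decays quantitatively on `[a, b]`. -/
theorem IsS.normSq_le {q : ℂ[X]} {y v : ℂ → ℂ} (h : IsS q y v) {a b : ℝ} (hab : a ≤ b)
    (hq : ∀ x ∈ Set.Icc a b, 1 ≤ (q.eval (x : ℂ)).re) (hb : En y v b ≤ 0) :
    (b - a) * normSq (y b) ≤ -En y v a := by
  have hq' : ∀ x ∈ Set.Icc a b, 0 ≤ (q.eval (x : ℂ)).re := fun x hx => by linarith [hq x hx]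
  have := monoOn_of_hasDerivAt (f := fun x : ℝ => En y v x - normSq (y b) * x) (a := a) (b := b)
    (fun x => (h.hasDerivAt_En x).sub ((hasDerivAt_id x).const_mul _))
    (fun x hx => by
      have h1 := h.normSq_anti hq' hb hx.1 hx.2 le_rfl
      have h2 := mul_le_mul_of_nonneg_right (hq x hx) (normSq_nonneg (y x))
      have h3 := normSq_nonneg (v x)
      simp only [mul_one, sub_nonneg]
      linarith) le_rfl hab le_rfl
  nlinarith

/-- The growing solution used for comparison. -/
theorem sol_one_one_bound {q : ℂ[X]} {N : ℝ} (hN : 0 ≤ N)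
    (hq : ∀ x ∈ Set.Icc 0 N, 0 ≤ (q.eval (x : ℂ)).re) :
    1 ≤ En (sol q 1 1) (sol' q 1 1) N ∧ 1 + 2 * N ≤ normSq (sol q 1 1 N) := by
  have h := sol_isS q 1 1
  have h0 : En (sol q 1 1) (sol' q 1 1) 0 = 1 := by simp [En, sol_zero, sol'_zero]
  have hE : ∀ x ∈ Set.Icc 0 N, 1 ≤ En (sol q 1 1) (sol' q 1 1) x := fun x hx => by
    rw [← h0]; exact h.En_mono hq le_rfl hx.1 hx.2
  refine ⟨hE N ⟨hN, le_rfl⟩, ?_⟩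
  have := monoOn_of_hasDerivAt (f := fun x : ℝ => normSq (sol q 1 1 x) - 2 * x) (a := 0) (b := N)
    (fun x => (h.hasDerivAt_normSq x).sub ((hasDerivAt_id x).const_mul _))
    (fun x hx => by have := hE x hx; linarith) le_rfl hN le_rfl
  simp [sol_zero] at this
  linarith

/-- Weyl-type condition on the parameter `D` at the point `N`. -/
def AdmD (q : ℂ[X]) (N : ℝ) (D : ℂ) : Prop := En (sol q (1 + D) D) (sol' q (1 + D) D) N ≤ 0

theorem AdmD.mono {q : ℂ[X]} {N M : ℝ} {D : ℂ} (h : AdmD q N D) (hM : 0 ≤ M) (hMN : M ≤ N)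
    (hq : ∀ x ∈ Set.Icc 0 N, 0 ≤ (q.eval (x : ℂ)).re) : AdmD q M D :=
  ((sol_isS q _ _).En_mono hq hM hMN le_rfl).trans h

theorem AdmD.bound {q : ℂ[X]} {D : ℂ} (h : AdmD q 0 D) :
    normSq (1 + D) + normSq D ≤ 1 ∧ -En (sol q (1 + D) D) (sol' q (1 + D) D) 0 ≤ 1 := by
  rw [AdmD] at h
  simp only [En, ofReal_zero, sol_zero, sol'_zero] at h ⊢
  simp [normSq_apply] at h ⊢
  constructor <;> nlinarith [sq_nonneg D.re, sq_nonneg D.im, sq_nonneg (1 + D.re)]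

theorem sol_D (q : ℂ[X]) (D z : ℂ) :
    sol q (1 + D) D z = sol q 1 0 z + D * sol q 1 1 z ∧
    sol' q (1 + D) D z = sol' q 1 0 z + D * sol' q 1 1 z := by
  simpa using sol_comb q 1 0 1 1 1 D z

theorem AdmD.norm_sub_le {q : ℂ[X]} {N : ℝ} (hN : 0 ≤ N) {D D' : ℂ} (h : AdmD q N D)
    (h' : AdmD q N D') (hq : ∀ x ∈ Set.Icc 0 N, 0 ≤ (q.eval (x : ℂ)).re) :
    ‖D - D'‖ * √(1 + 2 * N) ≤ 2 := by
  have key : ∀ D, AdmD q N D → ‖sol q (1 + D) D N‖ ≤ 1 := by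
    intro D h
    have h1 := (sol_isS q (1 + D) D).normSq_anti hq h le_rfl hN le_rfl
    have h2 := (h.mono le_rfl hN hq).bound.1
    rw [ofReal_zero, sol_zero] at h1
    have h3 : ‖sol q (1 + D) D N‖ ^ 2 ≤ 1 := by
      rw [← normSq_eq_norm_sq]; linarith [normSq_nonneg D]
    nlinarith [norm_nonneg (sol q (1 + D) D N)]
  have h1 := key D h
  have h2 := key D' h'
  have h3 : (D - D') * sol q 1 1 N = sol q (1 + D) D N - sol q (1 + D') D' N := by
    rw [(sol_D q D N).1, (sol_D q D' N).1]; ring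
  have h4 : √(1 + 2 * N) ≤ ‖sol q 1 1 N‖ := by
    rw [Real.sqrt_le_left (norm_nonneg _), ← normSq_eq_norm_sq]
    exact (sol_one_one_bound hN hq).2
  calc ‖D - D'‖ * √(1 + 2 * N) ≤ ‖D - D'‖ * ‖sol q 1 1 N‖ := by gcongr
    _ = ‖sol q (1 + D) D N - sol q (1 + D') D' N‖ := by rw [← h3, norm_mul]
    _ ≤ _ := _root_.norm_sub_le _ _
    _ ≤ 2 := by linarith

/-- `Re q ≥ 1` on the positive half-line. -/
def Adm (q : ℂ[X]) : Prop := ∀ x : ℝ, 0 ≤ x → 1 ≤ (q.eval (x : ℂ)).re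

theorem Adm.nonneg {q : ℂ[X]} (h : Adm q) (N : ℝ) : ∀ x ∈ Set.Icc 0 N, 0 ≤ (q.eval (x : ℂ)).re :=
  fun x hx => by linarith [h x hx.1]

/-- The Dirichlet parameter at `N`. -/
noncomputable def dirD (q : ℂ[X]) (N : ℝ) : ℂ := -sol q 1 0 N / sol q 1 1 N

theorem sol_one_one_ne {q : ℂ[X]} {N : ℝ} (hN : 0 ≤ N)
    (hq : ∀ x ∈ Set.Icc 0 N, 0 ≤ (q.eval (x : ℂ)).re) : sol q 1 1 N ≠ 0 := by
  intro h
  have := (sol_one_one_bound hN hq).2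
  rw [h] at this
  simp at this; linarith

theorem admD_dirD {q : ℂ[X]} {N : ℝ} (hN : 0 ≤ N)
    (hq : ∀ x ∈ Set.Icc 0 N, 0 ≤ (q.eval (x : ℂ)).re) : AdmD q N (dirD q N) := by
  have : sol q (1 + dirD q N) (dirD q N) N = 0 := by
    rw [(sol_D _ _ _).1, dirD]
    field_simp [sol_one_one_ne hN hq]
    ring
  simp [AdmD, En, this]

theorem AdmD.eq_of_forall {q : ℂ[X]} (hq : Adm q) {D D' : ℂ} (h : ∀ N : ℝ, 0 ≤ N → AdmD q N D)
    (h' : ∀ N : ℝ, 0 ≤ N → AdmD q N D') : D = D' := by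
  by_contra hne
  have hpos : 0 < ‖D - D'‖ := norm_pos_iff.2 (sub_ne_zero.2 hne)
  set N : ℝ := (4 / ‖D - D'‖ ^ 2) with hN
  have hN0 : 0 ≤ N := by positivity
  have h1 := (h N hN0).norm_sub_le hN0 (h' N hN0) (hq.nonneg N)
  have h2 : 2 < ‖D - D'‖ * √(1 + 2 * N) := by
    refine lt_of_pow_lt_pow_left₀ 2 (by positivity) ?_
    rw [mul_pow, Real.sq_sqrt (by positivity), hN]
    field_simp
    nlinarith [sq_nonneg ‖D - D'‖]
  linarith

theorem En_tendsto {ι : Type*} {l : Filter ι} {y v : ι → ℂ → ℂ} {y0 v0 : ℂ → ℂ} {x : ℝ}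
    (h1 : Tendsto (fun t => y t x) l (𝓝 (y0 x))) (h2 : Tendsto (fun t => v t x) l (𝓝 (v0 x))) :
    Tendsto (fun t => En (y t) (v t) x) l (𝓝 (En y0 v0 x)) :=
  (Complex.continuous_re.tendsto _).comp (((Complex.continuous_conj.tendsto _).comp h1).mul h2)

theorem admD_limit {ι : Type*} {l : Filter ι} [l.NeBot] {p : ι → ℂ[X]} {q : ℂ[X]}
    (hp : PTend l p q) {N : ι → ℝ} (hN : Tendsto N l atTop)
    (hpN : ∀ᶠ t in l, ∀ x ∈ Set.Icc 0 (N t), 0 ≤ ((p t).eval (x : ℂ)).re) {D : ι → ℂ} {D0 : ℂ}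
    (hD : ∀ᶠ t in l, AdmD (p t) (N t) (D t)) (hD0 : Tendsto D l (𝓝 D0)) (M : ℝ) (hM : 0 ≤ M) :
    AdmD q M D0 := by
  have h1 : Tendsto (fun t => En (sol (p t) (1 + D t) (D t)) (sol' (p t) (1 + D t) (D t)) M) l
      (𝓝 (En (sol q (1 + D0) D0) (sol' q (1 + D0) D0) M)) :=
    En_tendsto (sol_tendsto hp (hD0.const_add 1) hD0 tendsto_const_nhds)
      (sol'_tendsto hp (hD0.const_add 1) hD0 tendsto_const_nhds)
  refine le_of_tendsto h1 ?_
  filter_upwards [hpN, hD, hN.eventually_ge_atTop M] with t h1 h2 h3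
  exact h2.mono hM h3 h1

theorem exists_ultra_limit {ι : Type*} (u : Ultrafilter ι) {p : ι → ℂ[X]}
    {N : ι → ℝ} (hN : Tendsto N u atTop)
    (hpN : ∀ᶠ t in u, ∀ x ∈ Set.Icc 0 (N t), 0 ≤ ((p t).eval (x : ℂ)).re) {D : ι → ℂ}
    (hD : ∀ᶠ t in u, AdmD (p t) (N t) (D t)) : ∃ D0, Tendsto D u (𝓝 D0) := by
  have : ∀ᶠ t in u, D t ∈ Metric.closedBall (0 : ℂ) 1 := by
    filter_upwards [hpN, hD, hN.eventually_ge_atTop 0] with t h1 h2 h3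
    have := (h2.mono le_rfl h3 h1).bound.1
    rw [mem_closedBall_zero_iff]
    have h4 : ‖D t‖ ^ 2 ≤ 1 := by
      rw [← normSq_eq_norm_sq]; linarith [normSq_nonneg (1 + D t)]
    nlinarith [norm_nonneg (D t)]
  obtain ⟨D0, -, h⟩ := (isCompact_closedBall (0 : ℂ) 1).ultrafilter_le_nhds' (u.map D) this
  exact ⟨D0, h⟩

theorem Adm.exists_D {q : ℂ[X]} (hq : Adm q) : ∃ D, ∀ N : ℝ, 0 ≤ N → AdmD q N D := by
  let u : Ultrafilter ℝ := Ultrafilter.of atTop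
  have hu : Tendsto (fun x : ℝ => x) u atTop := Ultrafilter.of_le atTop
  have h1 : ∀ᶠ t in (u : Filter ℝ), AdmD q t (dirD q t) :=
    (hu.eventually_ge_atTop 0).mono fun t ht => admD_dirD ht (hq.nonneg t)
  have h0 : ∀ᶠ t in (u : Filter ℝ), ∀ x ∈ Set.Icc (0 : ℝ) t, 0 ≤ (q.eval (x : ℂ)).re :=
    Eventually.of_forall fun t => hq.nonneg t
  obtain ⟨D0, hD0⟩ := exists_ultra_limit u hu h0 h1
  refine ⟨D0, admD_limit (p := fun _ => q) ?_ hu h0 h1 hD0⟩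
  exact ⟨⟨q.natDegree, by simp⟩, fun j => tendsto_const_nhds⟩

open Classical in
/-- The Weyl parameter of `q`. -/
noncomputable def wD (q : ℂ[X]) : ℂ :=
  if h : ∃ D, ∀ N : ℝ, 0 ≤ N → AdmD q N D then h.choose else 0

theorem Adm.admD {q : ℂ[X]} (hq : Adm q) (N : ℝ) (hN : 0 ≤ N) : AdmD q N (wD q) := by
  have h := hq.exists_D
  rw [wD, dif_pos h]
  exact h.choose_spec N hN

/-- Parameters admissible on longer and longer intervals converge to the Weyl parameter. -/
theorem wD_tendsto_of_admD {ι : Type*} {l : Filter ι} {p : ι → ℂ[X]} {q : ℂ[X]}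
    (hp : PTend l p q) (hq : Adm q) {N : ι → ℝ} (hN : Tendsto N l atTop)
    (hpN : ∀ᶠ t in l, ∀ x ∈ Set.Icc 0 (N t), 0 ≤ ((p t).eval (x : ℂ)).re) {D : ι → ℂ}
    (hD : ∀ᶠ t in l, AdmD (p t) (N t) (D t)) : Tendsto D l (𝓝 (wD q)) := by
  rw [tendsto_iff_ultrafilter]
  intro u hu
  obtain ⟨D0, hD0⟩ := exists_ultra_limit u (hN.mono_left hu) (hu hpN) (hu hD)
  have hp' : PTend (u : Filter ι) p q :=
    ⟨⟨hp.1.choose, hu hp.1.choose_spec⟩, fun j => (hp.2 j).mono_left hu⟩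
  have h1 := admD_limit hp' (hN.mono_left hu) (hu hpN) (hu hD) hD0
  rwa [AdmD.eq_of_forall hq h1 hq.admD] at hD0

theorem wD_tendsto {ι : Type*} {l : Filter ι} {p : ι → ℂ[X]} {q : ℂ[X]}
    (hp : PTend l p q) (hq : Adm q) (hpa : ∀ᶠ t in l, Adm (p t)) :
    Tendsto (fun t => wD (p t)) l (𝓝 (wD q)) := by
  rw [tendsto_iff_ultrafilter]
  intro u hu
  have h1 : ∀ t, Adm (p t) → AdmD (p t) 0 (wD (p t)) := fun t ht => ht.admD 0 le_rfl
  have hp' : PTend (u : Filter ι) p q :=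
    ⟨⟨hp.1.choose, hu hp.1.choose_spec⟩, fun j => (hp.2 j).mono_left hu⟩
  have : ∀ᶠ t in u, wD (p t) ∈ Metric.closedBall (0 : ℂ) 1 := by
    filter_upwards [hu hpa] with t ht
    have := (h1 t ht).bound.1
    rw [mem_closedBall_zero_iff]
    have h4 : ‖wD (p t)‖ ^ 2 ≤ 1 := by
      rw [← normSq_eq_norm_sq]; linarith [normSq_nonneg (1 + wD (p t))]
    nlinarith [norm_nonneg (wD (p t))]
  obtain ⟨D0, -, h⟩ := (isCompact_closedBall (0 : ℂ) 1).ultrafilter_le_nhds'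
    (u.map fun t => wD (p t)) this
  have h' : Tendsto (fun t => wD (p t)) u (𝓝 D0) := h
  have key : ∀ M : ℝ, 0 ≤ M → AdmD q M D0 := by
    intro M hM
    refine le_of_tendsto (En_tendsto (sol_tendsto hp' (h'.const_add 1) h' tendsto_const_nhds)
      (sol'_tendsto hp' (h'.const_add 1) h' tendsto_const_nhds)) ?_
    exact (show ∀ᶠ t in (u : Filter ι), Adm (p t) from hu hpa).mono fun t ht => ht.admD M hM
  rw [AdmD.eq_of_forall hq key hq.admD] at h
  exact h

theorem wD_hol {Ω : Set ℂ} (hΩ : IsOpen Ω) {p : ℂ → ℂ[X]} (h : PHol Ω p)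
    (ha : ∀ w ∈ Ω, Adm (p w)) : DifferentiableOn ℂ (fun w => wD (p w)) Ω := by
  have h1 : TendstoUniformlyOn (fun (n : ℕ) w => dirD (p w) n) (fun w => wD (p w)) atTop Ω := by
    rw [Metric.tendstoUniformlyOn_iff]
    intro ε hε
    have : ∀ᶠ n : ℕ in atTop, 4 / ε ^ 2 < n :=
      tendsto_natCast_atTop_atTop.eventually_gt_atTop _
    filter_upwards [this] with n hn w hw
    have hn0 : (0 : ℝ) ≤ n := Nat.cast_nonneg n
    have h2 := ((ha w hw).admD n hn0).norm_sub_le hn0 (admD_dirD hn0 ((ha w hw).nonneg n))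
      ((ha w hw).nonneg n)
    rw [dist_eq_norm]
    by_contra hcon
    push Not at hcon
    have h3 : 2 < ε * √(1 + 2 * n) := by
      refine lt_of_pow_lt_pow_left₀ 2 (by positivity) ?_
      rw [mul_pow, Real.sq_sqrt (by positivity)]
      rw [div_lt_iff₀ (by positivity)] at hn
      nlinarith [sq_nonneg ε]
    have h4 : ε * √(1 + 2 * n) ≤ ‖wD (p w) - dirD (p w) n‖ * √(1 + 2 * n) := by gcongr
    linarith
  refine h1.tendstoLocallyUniformlyOn.differentiableOn (Eventually.of_forall fun n => ?_) hΩ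
  have hn0 : (0 : ℝ) ≤ n := Nat.cast_nonneg n
  exact DifferentiableOn.div (sol_hol hΩ h (differentiableOn_const _) (differentiableOn_const _)
      _).neg
    (sol_hol hΩ h (differentiableOn_const _) (differentiableOn_const _) _)
    fun w hw => sol_one_one_ne hn0 ((ha w hw).nonneg n)

/-- The decaying solution on the positive half-line. -/
noncomputable def yW (q : ℂ[X]) : ℂ → ℂ := sol q (1 + wD q) (wD q)

/-- The derivative of `yW`. -/
noncomputable def vW (q : ℂ[X]) : ℂ → ℂ := sol' q (1 + wD q) (wD q)

theorem yW_isS (q : ℂ[X]) : IsS q (yW q) (vW q) := sol_isS _ _ _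

theorem yW_zero (q : ℂ[X]) : yW q 0 = 1 + wD q := sol_zero _ _ _

theorem vW_zero (q : ℂ[X]) : vW q 0 = wD q := sol'_zero _ _ _

theorem Adm.En_nonpos {q : ℂ[X]} (hq : Adm q) {x : ℝ} (hx : 0 ≤ x) : En (yW q) (vW q) x ≤ 0 :=
  hq.admD x hx

theorem Adm.yW_anti {q : ℂ[X]} (hq : Adm q) {s t : ℝ} (hs : 0 ≤ s) (hst : s ≤ t) :
    normSq (yW q t) ≤ normSq (yW q s) :=
  (yW_isS q).normSq_anti (hq.nonneg t) (hq.En_nonpos (hs.trans hst)) hs hst le_rfl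

theorem Adm.yW_le_one {q : ℂ[X]} (hq : Adm q) {x : ℝ} (hx : 0 ≤ x) : ‖yW q x‖ ≤ 1 := by
  have h1 := hq.yW_anti le_rfl hx
  have h2 := (hq.admD 0 le_rfl).bound.1
  rw [ofReal_zero, yW_zero] at h1
  have h3 : ‖yW q x‖ ^ 2 ≤ 1 := by
    rw [← normSq_eq_norm_sq]; linarith [normSq_nonneg (wD q)]
  nlinarith [norm_nonneg (yW q x)]

theorem Adm.mul_normSq_yW_le {q : ℂ[X]} (hq : Adm q) {x : ℝ} (hx : 0 ≤ x) :
    x * normSq (yW q x) ≤ 1 := by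
  have := (yW_isS q).normSq_le hx (fun t ht => hq t ht.1) (hq.En_nonpos hx)
  have h2 := (hq.admD 0 le_rfl).bound.2
  rw [yW, vW] at this
  rw [yW]
  linarith

theorem tendsto_zero_of_mul_normSq_le {f : ℝ → ℂ} {C : ℝ}
    (h : ∀ᶠ x : ℝ in atTop, x * normSq (f x) ≤ C) : Tendsto f atTop (𝓝 0) := by
  rw [tendsto_zero_iff_norm_tendsto_zero]
  have h1 : Tendsto (fun x : ℝ => ‖f x‖ ^ 2) atTop (𝓝 0) := by
    refine squeeze_zero' (g := fun x => C / x) (Eventually.of_forall fun _ => by positivity) ?_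
      (tendsto_const_nhds.div_atTop tendsto_id)
    filter_upwards [h, eventually_gt_atTop 0] with x hx hx0
    rw [le_div_iff₀ hx0, ← normSq_eq_norm_sq]; linarith
  simpa using h1.sqrt

theorem Adm.yW_tendsto {q : ℂ[X]} (hq : Adm q) :
    Tendsto (fun x : ℝ => yW q x) atTop (𝓝 0) :=
  tendsto_zero_of_mul_normSq_le
    ((eventually_ge_atTop 0).mono fun _ hx => hq.mul_normSq_yW_le hx)

theorem yW_or_vW_ne (q : ℂ[X]) : ¬ (yW q 0 = 0 ∧ vW q 0 = 0) := by
  rw [yW_zero, vW_zero]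
  rintro ⟨h1, h2⟩
  rw [h2] at h1; simp at h1

/-- Every decaying solution is a multiple of `yW`. -/
theorem Adm.eq_mul_yW {q : ℂ[X]} (hq : Adm q) {y v : ℂ → ℂ} (h : IsS q y v)
    (hy : Tendsto (fun x : ℝ => y x) atTop (𝓝 0)) :
    ∃ c, (∀ z, y z = c * yW q z) ∧ ∀ z, v z = c * vW q z := by
  set c := y 0 - v 0 with hc
  set e := v 0 - c * wD q with he
  have h1 := ((yW_isS q).comb (sol_isS q 1 1) c e).eq_of h (x := 0)
    (by simp only [yW_zero, sol_zero, he, hc]; ring)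
    (by simp only [vW_zero, sol'_zero, he]; ring)
  have h2 : Tendsto (fun x : ℝ => e * sol q 1 1 x) atTop (𝓝 0) := by
    have := hy.sub (hq.yW_tendsto.const_mul c)
    simp only [mul_zero, sub_zero] at this
    refine this.congr fun x => ?_
    rw [← (h1 x).1]; ring
  have he0 : e = 0 := by
    by_contra hne
    have h3 := h2.norm
    rw [norm_zero] at h3
    have h4 : ∀ᶠ x : ℝ in atTop, ‖e‖ ≤ ‖e * sol q 1 1 x‖ := by
      filter_upwards [eventually_ge_atTop 0] with x hx
      have h5 := (sol_one_one_bound hx (hq.nonneg x)).2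
      rw [normSq_eq_norm_sq] at h5
      have h6 : 1 ≤ ‖sol q 1 1 x‖ := by
        by_contra hlt
        push Not at hlt
        nlinarith [norm_nonneg (sol q 1 1 x)]
      rw [norm_mul]
      nlinarith [norm_nonneg e]
    have := ge_of_tendsto h3 h4
    exact hne (norm_le_zero_iff.1 this)
  refine ⟨c, fun z => ?_, fun z => ?_⟩
  · rw [← (h1 z).1, he0]; ring
  · rw [← (h1 z).2, he0]; ring

/-- Exponential decay of `yW`. -/
theorem Adm.yW_exp {q : ℂ[X]} (hq : Adm q) {κ r : ℝ} (hr : 0 ≤ r)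
    (h : ∀ x : ℝ, r ≤ x → κ ^ 2 / 4 ≤ (q.eval (x : ℂ)).re) {x : ℝ} (hx : r ≤ x) :
    normSq (yW q x) ≤ normSq (yW q r) * Real.exp (-(κ * (x - r))) := by
  have hS := yW_isS q
  have hB : ∀ x, r ≤ x → 2 * En (yW q) (vW q) x + κ * normSq (yW q x) ≤ 0 := by
    intro x hx
    by_contra hpos
    push Not at hpos
    set δ := 2 * En (yW q) (vW q) x + κ * normSq (yW q x) with hδ
    have h1 : ∀ t, x ≤ t → δ ≤ κ * normSq (yW q t) := by
      intro t ht
      have := monoOn_of_hasDerivAt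
        (f := fun x => 2 * En (yW q) (vW q) x + κ * normSq (yW q x)) (a := x) (b := t)
        (fun x => ((hS.hasDerivAt_En x).const_mul 2).add ((hS.hasDerivAt_normSq x).const_mul κ))
        (fun s hs => by
          have h2 := h s (hx.trans hs.1)
          have h3 := mul_le_mul_of_nonneg_right h2 (normSq_nonneg (yW q s))
          have h4 : 0 ≤ normSq (vW q s) + κ ^ 2 / 4 * normSq (yW q s) + κ * En (yW q) (vW q) s := by
            have e : normSq (vW q s) + κ ^ 2 / 4 * normSq (yW q s) + κ * En (yW q) (vW q) s
                = normSq (vW q s + (κ / 2 : ℝ) * yW q s) := by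
              simp [En, normSq_apply]; ring
            rw [e]; exact normSq_nonneg _
          linarith) le_rfl ht le_rfl
      have h5 := hq.En_nonpos (x := t) (by linarith)
      linarith
    have h2 := hq.yW_tendsto.norm.pow 2
    have h3 : Tendsto (fun t : ℝ => κ * normSq (yW q t)) atTop (𝓝 0) := by
      simpa [normSq_eq_norm_sq] using h2.const_mul κ
    have := ge_of_tendsto h3 ((eventually_ge_atTop x).mono h1)
    linarith
  have := monoOn_of_hasDerivAt (f := fun x => -(normSq (yW q x) * Real.exp (κ * (x - r))))
    (f' := fun x => -((2 * En (yW q) (vW q) x + κ * normSq (yW q x)) * Real.exp (κ * (x - r))))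
    (a := r) (b := x)
    (fun x => by
      have h1 : HasDerivAt (fun x => Real.exp (κ * (x - r))) (Real.exp (κ * (x - r)) * (κ * 1)) x :=
        (((hasDerivAt_id x).sub_const r).const_mul κ).exp
      exact ((hS.hasDerivAt_normSq x).mul h1).neg.congr_deriv (by ring))
    (fun s hs => by
      have := hB s hs.1
      have h2 := Real.exp_pos (κ * (s - r))
      simp only [Left.nonneg_neg_iff]
      nlinarith) le_rfl hx le_rfl
  simp only [sub_self, mul_zero, Real.exp_zero, mul_one, neg_le_neg_iff] at this
  rw [Real.exp_neg]
  rw [← div_eq_mul_inv, le_div_iff₀ (Real.exp_pos _)]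
  exact this

end HalfLine

section Decay

open Polynomial Asymptotics

/-- Decay at `+∞` faster than every exponential. -/
def ED (f : ℝ → ℂ) : Prop := ∀ k : ℝ, f =O[atTop] fun x : ℝ => Real.exp (-(k * x))

/-- `Re q → +∞` along the positive half-line. -/
def Coer (q : ℂ[X]) : Prop := Tendsto (fun x : ℝ => (q.eval (x : ℂ)).re) atTop atTop

theorem exp_isBigO_of_le {k k' : ℝ} (h : k ≤ k') :
    (fun x : ℝ => Real.exp (-(k' * x))) =O[atTop] fun x : ℝ => Real.exp (-(k * x)) := by
  refine IsBigO.of_bound 1 ?_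
  filter_upwards [eventually_ge_atTop 0] with x hx
  rw [Real.norm_of_nonneg (Real.exp_pos _).le, Real.norm_of_nonneg (Real.exp_pos _).le, one_mul,
    Real.exp_le_exp]
  nlinarith

theorem ED.of_nonneg {f : ℝ → ℂ}
    (h : ∀ k : ℝ, 0 ≤ k → f =O[atTop] fun x : ℝ => Real.exp (-(k * x))) : ED f := fun k =>
  (h (max k 0) (le_max_right _ _)).trans (exp_isBigO_of_le (le_max_left _ _))

theorem ED.add {f g : ℝ → ℂ} (hf : ED f) (hg : ED g) : ED (fun x => f x + g x) :=
  fun k => (hf k).add (hg k)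

theorem ED.const_mul {f : ℝ → ℂ} (hf : ED f) (c : ℂ) : ED (fun x => c * f x) :=
  fun k => (hf k).const_mul_left c

theorem ED.mul_exp {f g : ℝ → ℂ} (hf : ED f) {a : ℝ}
    (hg : g =O[atTop] fun x : ℝ => Real.exp (a * x)) : ED (fun x => g x * f x) := by
  intro k
  refine (hg.mul (hf (k + a))).congr_right fun x => ?_
  rw [← Real.exp_add]; congr 1; ring

theorem poly_isBigO_exp (q : ℂ[X]) :
    (fun x : ℝ => q.eval (x : ℂ)) =O[atTop] fun x : ℝ => Real.exp (1 * x) := by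
  induction q using Polynomial.induction_on' with
  | add p q hp hq => simpa using hp.add hq
  | monomial n a =>
    simp only [eval_monomial]
    refine IsBigO.const_mul_left ?_ a
    refine IsBigO.trans ?_ (isLittleO_pow_exp_pos_mul_atTop n one_pos).isBigO
    refine IsBigO.of_bound 1 (Eventually.of_forall fun x => ?_)
    simp

theorem ED.poly_mul {f : ℝ → ℂ} (hf : ED f) (q : ℂ[X]) : ED (fun x => q.eval (x : ℂ) * f x) :=
  hf.mul_exp (poly_isBigO_exp q)

theorem ED.mul_bounded {f g : ℝ → ℂ} (hf : ED f) (hg : g =O[atTop] fun _ => (1 : ℝ)) :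
    ED (fun x => g x * f x) :=
  hf.mul_exp (a := 0) (by simpa using hg)

theorem ED.tendsto {f : ℝ → ℂ} (hf : ED f) : Tendsto f atTop (𝓝 0) := by
  refine (hf 1).trans_tendsto ?_
  simpa using Real.tendsto_exp_neg_atTop_nhds_zero

theorem ED.isBigO_one {f : ℝ → ℂ} (hf : ED f) : f =O[atTop] fun _ => (1 : ℝ) := by
  simpa using hf 0

theorem ED.comp_add {f : ℝ → ℂ} (hf : ED f) (a : ℝ) : ED (fun x => f (x + a)) := by
  intro k
  have := (hf k).comp_tendsto (tendsto_atTop_add_const_right atTop a tendsto_id)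
  refine this.trans (IsBigO.of_bound (Real.exp (-(k * a))) (Eventually.of_forall fun x => ?_))
  simp only [Function.comp, id]
  rw [Real.norm_of_nonneg (Real.exp_pos _).le, Real.norm_of_nonneg (Real.exp_pos _).le,
    ← Real.exp_add]
  apply le_of_eq; congr 1; ring

theorem ED.integrableOn {f : ℝ → ℂ} (hf : ED f) (hc : Continuous f) (a : ℝ) :
    MeasureTheory.IntegrableOn f (Set.Ioi a) :=
  (MeasureTheory.integrable_norm_iff hc.aestronglyMeasurable).1
    (integrable_of_isBigO_exp_neg one_pos hc.norm.continuousOn (by simpa using (hf 1).norm_left))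

theorem Adm.yW_ED {q : ℂ[X]} (hq : Adm q) (hc : Coer q) : ED (fun x => yW q x) := by
  refine ED.of_nonneg fun k hk => ?_
  obtain ⟨r, hr⟩ := (hc.eventually_ge_atTop (k ^ 2)).exists_forall_of_atTop
  set s := max r 0
  refine IsBigO.of_bound (Real.exp (k * s)) ?_
  filter_upwards [eventually_ge_atTop s] with x hx
  have hs0 : 0 ≤ s := le_max_right _ _
  have h1 := hq.yW_exp (κ := 2 * k) hs0
    (fun t ht => by have := hr t ((le_max_left _ _).trans ht); nlinarith) hx
  have h2 := hq.yW_le_one hs0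
  have h3 : normSq (yW q s) ≤ 1 := by
    rw [normSq_eq_norm_sq]; nlinarith [norm_nonneg (yW q s)]
  rw [Real.norm_of_nonneg (Real.exp_pos _).le, ← Real.exp_add]
  refine le_of_sq_le_sq ?_ (Real.exp_pos _).le
  rw [← normSq_eq_norm_sq, ← Real.exp_nat_mul]
  refine h1.trans ?_
  calc _ ≤ 1 * Real.exp (-(2 * k * (x - s))) := by gcongr
    _ = _ := by rw [one_mul]; congr 1; push_cast; ring

/-- The derivative of a rapidly decaying solution decays rapidly. -/
theorem IsS.deriv_ED {q : ℂ[X]} {y v : ℂ → ℂ} (h : IsS q y v) (hy : ED (fun x => y x)) :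
    ED (fun x => v x) := by
  refine ED.of_nonneg fun k hk => ?_
  obtain ⟨C, hC0, hC⟩ := ((hy.poly_mul q) k).exists_pos
  rw [isBigOWith_iff] at hC
  obtain ⟨X0, hX0⟩ := hC.exists_forall_of_atTop
  have h1 : ∀ x : ℝ, X0 ≤ x →
      ‖y (x + 1 : ℝ) - y x - v x‖ ≤ C * Real.exp (-(k * x)) := by
    intro x hx
    set M := C * Real.exp (-(k * x))
    have hM : ∀ s ∈ Set.Icc x (x + 1), ‖q.eval (s : ℂ) * y s‖ ≤ M := by
      intro s hs
      refine (hX0 s (hx.trans hs.1)).trans ?_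
      rw [Real.norm_of_nonneg (Real.exp_pos _).le]
      have : k * x ≤ k * s := by gcongr; exact hs.1
      simp only [M]; gcongr
    have h2 : ∀ s ∈ Set.Icc x (x + 1), ‖v s - v x‖ ≤ M := by
      intro s hs
      have := norm_image_sub_le_of_norm_deriv_le_segment' (f := fun t : ℝ => v t)
        (f' := fun t => q.eval (t : ℂ) * y t) (a := x) (b := x + 1)
        (fun t _ => (h.hasDerivAt_real t).2.hasDerivWithinAt)
        (fun t ht => hM t ⟨ht.1, ht.2.le⟩) s hs
      refine this.trans ?_
      have hM0 : 0 ≤ M := by positivity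
      nlinarith [hs.1, hs.2]
    have h3 : ∀ t : ℝ, HasDerivAt (fun t : ℝ => y t - v x * t) (v t - v x) t := fun t => by
      have := ((h.hasDerivAt_real t).1).sub ((hasDerivAt_id t).ofReal_comp.const_mul (v x))
      exact this.congr_deriv (by simp)
    have := norm_image_sub_le_of_norm_deriv_le_segment' (a := x) (b := x + 1)
        (fun t _ => (h3 t).hasDerivWithinAt)
        (fun t ht => h2 t ⟨ht.1, ht.2.le⟩) (x + 1) (by simp)
    have e : y (x + 1 : ℝ) - y x - v x = y (x + 1 : ℝ) - v x * (x + 1 : ℝ) - (y x - v x * x) := by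
      push_cast; ring
    rw [e]
    refine this.trans (le_of_eq (by ring))
  have h2 : (fun x : ℝ => y (x + 1 : ℝ) - y x - v x) =O[atTop] fun x => Real.exp (-(k * x)) := by
    refine IsBigO.of_bound C ?_
    filter_upwards [eventually_ge_atTop X0] with x hx
    rw [Real.norm_of_nonneg (Real.exp_pos _).le]
    exact h1 x hx
  have h3 := ((hy.comp_add 1) k |>.sub (hy k)).sub h2
  refine h3.congr_left fun x => ?_
  ring

theorem IsS.continuous {q : ℂ[X]} {y v : ℂ → ℂ} (h : IsS q y v) : Continuous y ∧ Continuous v :=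
  ⟨continuous_iff_continuousAt.2 fun z => (h z).1.continuousAt,
    continuous_iff_continuousAt.2 fun z => (h z).2.continuousAt⟩

theorem IsS.continuous_real {q : ℂ[X]} {y v : ℂ → ℂ} (h : IsS q y v) :
    Continuous (fun x : ℝ => y x) ∧ Continuous (fun x : ℝ => v x) :=
  ⟨h.continuous.1.comp continuous_ofReal, h.continuous.2.comp continuous_ofReal⟩

theorem poly_continuous_real (q : ℂ[X]) : Continuous fun x : ℝ => q.eval (x : ℂ) :=
  q.continuous.comp continuous_ofReal

/-- Wronskian of solutions of two different equations. -/
theorem wronskian_integral {q q' : ℂ[X]} {y v w u : ℂ → ℂ} (h1 : IsS q y v) (h2 : IsS q' w u)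
    (hy : ED (fun x => y x)) (hw : ED (fun x => w x)) (x0 : ℝ) :
    v x0 * w x0 - y x0 * u x0 = ∫ x in Set.Ioi x0, (q' - q).eval (x : ℂ) * (y x * w x) := by
  have hv := h1.deriv_ED hy
  have hu := h2.deriv_ED hw
  have hd : ∀ x ∈ Set.Ici x0, HasDerivAt (fun x : ℝ => y x * u x - v x * w x)
      ((q' - q).eval (x : ℂ) * (y x * w x)) x := by
    intro x _
    refine (((h1.hasDerivAt_real x).1.mul (h2.hasDerivAt_real x).2).sub
      ((h1.hasDerivAt_real x).2.mul (h2.hasDerivAt_real x).1)).congr_deriv ?_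
    rw [eval_sub]; ring
  have hi : ED (fun x => (q' - q).eval (x : ℂ) * (y x * w x)) :=
    (hw.mul_bounded hy.isBigO_one).poly_mul _
  have hintg := hi.integrableOn ((poly_continuous_real _).mul
    (h1.continuous_real.1.mul h2.continuous_real.1)) x0
  have hlim : Tendsto (fun x : ℝ => y x * u x - v x * w x) atTop (𝓝 0) := by
    simpa using ((hu.mul_bounded hy.isBigO_one).tendsto).sub
      ((hw.mul_bounded hv.isBigO_one).tendsto)
  have := MeasureTheory.integral_Ioi_of_hasDerivAt_of_tendsto' hd hintg hlim
  rw [this]; ring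

theorem sol_ev_bound {ι : Type*} {l : Filter ι} {p : ι → ℂ[X]} {q : ℂ[X]} (h : PTend l p q)
    {a b : ι → ℂ} {a0 b0 : ℂ} (ha : Tendsto a l (𝓝 a0)) (hb : Tendsto b l (𝓝 b0)) (R : ℝ)
    (hR : 1 ≤ R) : ∃ C : ℝ, ∀ᶠ t in l, ∀ z : ℂ, ‖z‖ ≤ R → ‖sol (p t) (a t) (b t) z‖ ≤ C := by
  obtain ⟨C, hC⟩ := cf_ev_bound h ha hb (2 * R) (by linarith)
  refine ⟨C * 2, hC.mono fun t ht z hz => ?_⟩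
  have := tsum_of_norm_bounded (hasSum_geometric_two.mul_left C)
    (fun n => ps_term_bound hR ht hz n)
  exact this

/-- The limit of the integrals in `wronskian_integral`. -/
theorem integral_yW_tendsto {ι : Type*} {l : Filter ι} [l.IsCountablyGenerated]
    {p : ι → ℂ[X]} {q : ℂ[X]} (h : PTend l p q)
    (hq : Adm q) (hc : Coer q) (hp : ∀ᶠ t in l, Adm (p t)) (δ : ℂ[X]) (x0 : ℝ) :
    Tendsto (fun t => ∫ x in Set.Ioi x0, δ.eval (x : ℂ) * (yW (p t) x * yW q x)) l
      (𝓝 (∫ x in Set.Ioi x0, δ.eval (x : ℂ) * (yW q x * yW q x))) := by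
  have hD := wD_tendsto h hq hp
  obtain ⟨C, hC⟩ := sol_ev_bound h (hD.const_add 1) hD (1 + |x0|) (by linarith [abs_nonneg x0])
  have hcont : ∀ p : ℂ[X], Continuous fun x : ℝ => δ.eval (x : ℂ) * (yW p x * yW q x) := fun p =>
    (poly_continuous_real _).mul ((yW_isS p).continuous_real.1.mul (yW_isS q).continuous_real.1)
  refine MeasureTheory.tendsto_integral_filter_of_dominated_convergence
    (fun x => (max C 1) * ‖δ.eval (x : ℂ) * yW q x‖) ?_ ?_ ?_ ?_
  · exact Eventually.of_forall fun t => (hcont _).aestronglyMeasurable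
  · filter_upwards [hC, hp] with t ht1 ht2
    refine (MeasureTheory.ae_restrict_iff' measurableSet_Ioi).2 (Eventually.of_forall fun x hx =>
        ?_)
    have hb : ‖yW (p t) x‖ ≤ max C 1 := by
      rcases le_total 0 x with h0 | h0
      · exact (ht2.yW_le_one h0).trans (le_max_right _ _)
      · refine (ht1 x ?_).trans (le_max_left _ _)
        have hx' : x0 < x := hx
        rw [Complex.norm_real, Real.norm_eq_abs, abs_of_nonpos h0, abs_of_nonpos (by linarith)]
        linarith
    calc ‖δ.eval (x : ℂ) * (yW (p t) x * yW q x)‖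
        = ‖yW (p t) x‖ * ‖δ.eval (x : ℂ) * yW q x‖ := by simp only [norm_mul]; ring
      _ ≤ _ := by gcongr
  · have := ((hq.yW_ED hc).poly_mul δ).integrableOn
      ((poly_continuous_real _).mul (yW_isS q).continuous_real.1) x0
    exact this.norm.const_mul _
  · refine (MeasureTheory.ae_restrict_iff' measurableSet_Ioi).2 (Eventually.of_forall fun x hx =>
      ?_)
    exact ((sol_tendsto h (hD.const_add 1) hD tendsto_const_nhds).mul_const _).const_mul _

theorem PTend.line (q δ : ℂ[X]) : PTend (𝓝 (0 : ℂ)) (fun τ => q + C τ * δ) q := by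
  refine ⟨⟨max q.natDegree δ.natDegree, Eventually.of_forall fun τ => ?_⟩, fun j => ?_⟩
  · exact (natDegree_add_le _ _).trans (max_le_max le_rfl (natDegree_C_mul_le _ _))
  · simp only [coeff_add, coeff_C_mul]
    have : Continuous fun τ : ℂ => q.coeff j + τ * δ.coeff j := by fun_prop
    simpa using this.tendsto 0

theorem PHol.line (q δ : ℂ[X]) (Ω : Set ℂ) : PHol Ω (fun τ => q + C τ * δ) := by
  refine ⟨⟨max q.natDegree δ.natDegree, fun τ _ => ?_⟩, fun j => ?_⟩
  · exact (natDegree_add_le _ _).trans (max_le_max le_rfl (natDegree_C_mul_le _ _))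
  · simp only [coeff_add, coeff_C_mul]
    fun_prop

/-- First-order variation of the decaying solution. -/
theorem yW_variation {q δ : ℂ[X]} {ρ : ℝ} (hρ : 0 < ρ)
    (ha : ∀ τ ∈ Metric.ball (0 : ℂ) ρ, Adm (q + C τ * δ))
    (hc : ∀ τ ∈ Metric.ball (0 : ℂ) ρ, Coer (q + C τ * δ)) (x0 : ℝ) :
    ∃ a b : ℂ, HasDerivAt (fun τ => yW (q + C τ * δ) x0) a 0 ∧
      HasDerivAt (fun τ => vW (q + C τ * δ) x0) b 0 ∧
      a * vW q x0 - b * yW q x0 = ∫ x in Set.Ioi x0, δ.eval (x : ℂ) * (yW q x * yW q x) := by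
  have h0 : (0 : ℂ) ∈ Metric.ball (0 : ℂ) ρ := by simpa using hρ
  have hq : Adm q := by simpa using ha 0 h0
  have hqc : Coer q := by simpa using hc 0 h0
  have hH := PHol.line q δ (Metric.ball (0 : ℂ) ρ)
  have hD := wD_hol Metric.isOpen_ball hH ha
  have hy := (sol_hol Metric.isOpen_ball hH (hD.const_add 1) hD x0).differentiableAt
    (Metric.isOpen_ball.mem_nhds h0)
  have hv := (sol'_hol Metric.isOpen_ball hH (hD.const_add 1) hD x0).differentiableAt
    (Metric.isOpen_ball.mem_nhds h0)
  refine ⟨_, _, hy.hasDerivAt, hv.hasDerivAt, ?_⟩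
  set a := deriv (fun w => sol (q + C w * δ) (1 + wD (q + C w * δ)) (wD (q + C w * δ)) x0) 0
  set b := deriv (fun w => sol' (q + C w * δ) (1 + wD (q + C w * δ)) (wD (q + C w * δ)) x0) 0
  have h1 : HasDerivAt (fun τ => yW (q + C τ * δ) x0 * vW q x0 - vW (q + C τ * δ) x0 * yW q x0)
      (a * vW q x0 - b * yW q x0) 0 :=
    (hy.hasDerivAt.mul_const _).sub (hv.hasDerivAt.mul_const _)
  have h2 := h1.tendsto_slope
  have hb := Metric.isOpen_ball.mem_nhds h0
  have h3 := integral_yW_tendsto (PTend.line q δ) hq hqc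
    (eventually_of_mem hb ha) δ x0
  refine tendsto_nhds_unique h2 ((h3.mono_left nhdsWithin_le_nhds).congr' ?_)
  filter_upwards [self_mem_nhdsWithin, mem_nhdsWithin_of_mem_nhds hb] with τ hτ hτb
  have h4 := wronskian_integral (yW_isS (q + C τ * δ)) (yW_isS q)
    ((ha τ hτb).yW_ED (hc τ hτb)) (hq.yW_ED hqc) x0
  have h5 : ∀ x : ℝ, (q - (q + C τ * δ)).eval (x : ℂ) * (yW (q + C τ * δ) x * yW q x) =
      (-τ) * (δ.eval (x : ℂ) * (yW (q + C τ * δ) x * yW q x)) := fun x => by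
    simp; ring
  simp only [h5] at h4
  rw [MeasureTheory.integral_const_mul] at h4
  have hτ0 : τ ≠ 0 := hτ
  simp only [slope_def_module, sub_zero, C_0, zero_mul, add_zero, smul_eq_mul]
  rw [eq_inv_mul_iff_mul_eq₀ hτ0]
  linear_combination h4

end Decay

section TwoSided

open Polynomial Asymptotics

/-- `y'' = q y` has a nonzero solution decaying at both ends of the real axis. -/
def Bd (q : ℂ[X]) : Prop := ∃ y v : ℂ → ℂ, IsS q y v ∧ y ≠ 0 ∧
  Tendsto (fun x : ℝ => y x) atTop (𝓝 0) ∧ Tendsto (fun x : ℝ => y x) atBot (𝓝 0)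

/-- `Re q ≥ 1` on the real axis outside `(-r, r)`. -/
def AdmR (r : ℝ) (q : ℂ[X]) : Prop := ∀ x : ℝ, r ≤ |x| → 1 ≤ (q.eval (x : ℂ)).re

/-- `Re q → +∞` at both ends of the real axis. -/
def Coer2 (q : ℂ[X]) : Prop := Coer q ∧ Coer (aff (-1) 0 q)

/-- Right half of the potential, based at `r`. -/
noncomputable def qR (r : ℝ) (q : ℂ[X]) : ℂ[X] := aff 1 r q

/-- Left half of the potential, based at `-r`, reflected. -/
noncomputable def qL (r : ℝ) (q : ℂ[X]) : ℂ[X] := aff (-1) (-r) q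

theorem qR_eval (r : ℝ) (q : ℂ[X]) (z : ℂ) : (qR r q).eval z = q.eval (z + r) := by
  simp [qR, aff_eval]

theorem qL_eval (r : ℝ) (q : ℂ[X]) (z : ℂ) : (qL r q).eval z = q.eval (-z - r) := by
  simp [qL, aff_eval, sub_eq_add_neg]

theorem qR_add (r : ℝ) (q δ : ℂ[X]) (τ : ℂ) : qR r (q + C τ * δ) = qR r q + C τ * qR r δ := by
  simp [qR, aff]

theorem qL_add (r : ℝ) (q δ : ℂ[X]) (τ : ℂ) : qL r (q + C τ * δ) = qL r q + C τ * qL r δ := by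
  simp [qL, aff]

theorem AdmR.right {r : ℝ} (hr : 0 ≤ r) {q : ℂ[X]} (h : AdmR r q) : Adm (qR r q) := by
  intro x hx
  rw [qR_eval]
  have := h (x + r) (by rw [abs_of_nonneg (by linarith)]; linarith)
  simpa using this

theorem AdmR.left {r : ℝ} (hr : 0 ≤ r) {q : ℂ[X]} (h : AdmR r q) : Adm (qL r q) := by
  intro x hx
  rw [qL_eval]
  have := h (-x - r) (by rw [abs_of_nonpos (by linarith)]; linarith)
  simpa using this

theorem Coer2.right {q : ℂ[X]} (h : Coer2 q) (r : ℝ) : Coer (qR r q) := by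
  have := h.1.comp (tendsto_atTop_add_const_right atTop r tendsto_id)
  refine this.congr fun x => ?_
  simp [qR_eval]

theorem Coer2.left {q : ℂ[X]} (h : Coer2 q) (r : ℝ) : Coer (qL r q) := by
  have := h.2.comp (tendsto_atTop_add_const_right atTop r tendsto_id)
  refine this.congr fun x => ?_
  simp [qL_eval, aff_eval]; ring_nf

theorem IsS.of_right {r : ℝ} {q : ℂ[X]} {y v : ℂ → ℂ} (h : IsS (qR r q) y v) :
    IsS q (fun z => y (z - r)) (fun z => v (z - r)) := by
  have := h.aff_one (-r)
  have e : _root_.aff 1 (-r) (qR r q) = q := by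
    apply Polynomial.funext; intro z; rw [aff_eval, qR_eval]; congr 1; ring
  rw [e] at this
  simpa [sub_eq_add_neg] using this

theorem IsS.to_right {r : ℝ} {q : ℂ[X]} {y v : ℂ → ℂ} (h : IsS q y v) :
    IsS (qR r q) (fun z => y (z + r)) (fun z => v (z + r)) := h.aff_one r

theorem IsS.of_left {r : ℝ} {q : ℂ[X]} {y v : ℂ → ℂ} (h : IsS (qL r q) y v) :
    IsS q (fun z => y (-z - r)) (fun z => -v (-z - r)) := by
  have := h.aff_neg (-r)
  have e : _root_.aff (-1) (-r) (qL r q) = q := by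
    apply Polynomial.funext; intro z; rw [aff_eval, qL_eval]; congr 1; ring
  rw [e] at this
  simpa [sub_eq_add_neg] using this

theorem IsS.to_left {r : ℝ} {q : ℂ[X]} {y v : ℂ → ℂ} (h : IsS q y v) :
    IsS (qL r q) (fun z => y (-z - r)) (fun z => -v (-z - r)) := by
  rw [qL]
  simpa [sub_eq_add_neg] using h.aff_neg (-r)

/-- The spectral determinant based at `±r`. -/
noncomputable def FF (r : ℝ) (q : ℂ[X]) : ℂ :=
  yW (qR r q) (-2 * r) * vW (qL r q) 0 + vW (qR r q) (-2 * r) * yW (qL r q) 0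

theorem yW_ne_zero (q : ℂ[X]) : yW q ≠ 0 := by
  intro h
  have h1 : ∀ z, vW q z = 0 := fun z => by
    have := (yW_isS q z).1
    rw [h] at this
    exact this.unique (hasDerivAt_const z 0)
  exact yW_or_vW_ne q ⟨by rw [h]; rfl, h1 0⟩

/-- Proportionality data at a zero of the spectral determinant. -/
theorem FF_zero_data {r : ℝ} {q : ℂ[X]} (h : FF r q = 0) : ∃ κ : ℂ, κ ≠ 0 ∧
    (∀ z, yW (qL r q) (-z - r) = κ * yW (qR r q) (z - r)) ∧
    (∀ z, -vW (qL r q) (-z - r) = κ * vW (qR r q) (z - r)) := by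
  have hR := (yW_isS (qR r q)).of_right
  have hL := (yW_isS (qL r q)).of_left
  set a := yW (qR r q) (-2 * r) with ha
  set b := vW (qR r q) (-2 * r) with hb
  set a' := yW (qL r q) 0 with ha'
  set b' := vW (qL r q) 0 with hb'
  have e1 : yW (qR r q) (-r - r) = a := by rw [ha]; ring_nf
  have e2 : vW (qR r q) (-r - r) = b := by rw [hb]; ring_nf
  have hF : a * b' + b * a' = 0 := h
  have hab : ¬ (a = 0 ∧ b = 0) := by
    rintro ⟨h1, h2⟩
    have := fun z => ((yW_isS (qR r q)).eq_zero (x := -2 * r) h1 h2 z).1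
    exact yW_ne_zero (qR r q) (_root_.funext this)
  have hab' : ¬ (a' = 0 ∧ b' = 0) := yW_or_vW_ne _
  obtain ⟨κ, hκ, h1, h2⟩ : ∃ κ : ℂ, κ ≠ 0 ∧ a' = κ * a ∧ -b' = κ * b := by
    by_cases ha0 : a = 0
    · have hb0 : b ≠ 0 := fun h => hab ⟨ha0, h⟩
      have ha'0 : a' = 0 := by
        rw [ha0] at hF; simpa [hb0] using hF
      have hb'0 : b' ≠ 0 := fun h => hab' ⟨ha'0, h⟩
      refine ⟨-b' / b, by simp [hb0, hb'0], by rw [ha0, ha'0]; simp, by field_simp⟩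
    · have ha'0 : a' ≠ 0 := by
        intro h0
        rw [h0] at hF
        exact hab' ⟨h0, by simpa [ha0] using hF⟩
      refine ⟨a' / a, by simp [ha0, ha'0], by field_simp, ?_⟩
      field_simp
      linear_combination -hF
  have key := hL.eq_of ((hR.comb hR κ 0)) (x := -r)
    (by simp only [neg_neg, sub_self]; rw [e1]; simp [← h1, ha'])
    (by simp only [neg_neg, sub_self]; rw [e2]; simp [← h2, hb'])
  exact ⟨κ, hκ, fun z => by simpa using (key z).1, fun z => by simpa using (key z).2⟩

theorem Bd_iff {r : ℝ} (hr : 0 ≤ r) {q : ℂ[X]} (h : AdmR r q) : Bd q ↔ FF r q = 0 := by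
  constructor
  · rintro ⟨y, v, hy, hne, ht, hb⟩
    obtain ⟨c, hc1, hc2⟩ := (h.right hr).eq_mul_yW (hy.to_right (r := r)) (by
      have := ht.comp (tendsto_atTop_add_const_right atTop r tendsto_id)
      refine this.congr fun x => ?_
      simp)
    obtain ⟨e, he1, he2⟩ := (h.left hr).eq_mul_yW (hy.to_left (r := r)) (by
      have h1 : Tendsto (fun x : ℝ => -x - r) atTop atBot :=
        tendsto_atBot_add_const_right atTop (-r) tendsto_neg_atTop_atBot
      refine (hb.comp h1).congr fun x => ?_
      simp)
    have hc : c ≠ 0 := by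
      rintro rfl
      apply hne; funext z
      simpa using hc1 (z - r)
    have he : e ≠ 0 := by
      rintro rfl
      apply hne; funext z
      simpa using he1 (-z - r)
    have h1 := hc1 (-2 * r)
    have h2 := hc2 (-2 * r)
    have h3 := he1 0
    have h4 := he2 0
    have e1 : (-2 * r + r : ℂ) = -0 - r := by ring
    rw [e1] at h1 h2
    rw [h3] at h1
    have h5 : -(e * vW (qL r q) 0) = c * vW (qR r q) (-2 * r) := by rw [← h4, ← h2]; ring
    have : c * e * FF r q = 0 := by
      rw [FF]
      linear_combination (-e * vW (qL r q) 0) * h1 - e * yW (qL r q) 0 * h5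
    simpa [hc, he] using this
  · intro hF
    obtain ⟨κ, hκ, h1, h2⟩ := FF_zero_data hF
    refine ⟨fun z => yW (qR r q) (z - r), fun z => vW (qR r q) (z - r),
      (yW_isS (qR r q)).of_right, ?_, ?_, ?_⟩
    · intro h0
      apply yW_ne_zero (qR r q); funext z
      have := congrFun h0 (z + r)
      simpa using this
    · have := (h.right hr).yW_tendsto.comp (tendsto_atTop_add_const_right atTop (-r) tendsto_id)
      refine this.congr fun x => ?_
      simp [sub_eq_add_neg]
    · have h3 : Tendsto (fun x : ℝ => -x - r) atBot atTop :=
        tendsto_atTop_add_const_right atBot (-r) tendsto_neg_atBot_atTop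
      have := ((h.left hr).yW_tendsto.comp h3).const_mul κ⁻¹
      simp only [mul_zero] at this
      refine this.congr fun x => ?_
      have := h1 x
      simp only [Function.comp]
      push_cast
      rw [this]; field_simp

theorem FF_tendsto {ι : Type*} {l : Filter ι} {p : ι → ℂ[X]} {q : ℂ[X]} {r : ℝ} (hr : 0 ≤ r)
    (hp : PTend l p q) (hq : AdmR r q) (hpa : ∀ᶠ t in l, AdmR r (p t)) :
    Tendsto (fun t => FF r (p t)) l (𝓝 (FF r q)) := by
  have hR := wD_tendsto (hp.aff 1 r) (hq.right hr) (hpa.mono fun t ht => ht.right hr)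
  have hL := wD_tendsto (hp.aff (-1) (-r)) (hq.left hr) (hpa.mono fun t ht => ht.left hr)
  exact ((sol_tendsto (hp.aff 1 r) (hR.const_add 1) hR tendsto_const_nhds).mul
    (sol'_tendsto (hp.aff (-1) (-r)) (hL.const_add 1) hL tendsto_const_nhds)).add
    ((sol'_tendsto (hp.aff 1 r) (hR.const_add 1) hR tendsto_const_nhds).mul
    (sol_tendsto (hp.aff (-1) (-r)) (hL.const_add 1) hL tendsto_const_nhds))

theorem FF_hol {Ω : Set ℂ} (hΩ : IsOpen Ω) {p : ℂ → ℂ[X]} (h : PHol Ω p) {r : ℝ} (hr : 0 ≤ r)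
    (ha : ∀ w ∈ Ω, AdmR r (p w)) : DifferentiableOn ℂ (fun w => FF r (p w)) Ω := by
  have hR := wD_hol hΩ (h.aff 1 r) fun w hw => (ha w hw).right hr
  have hL := wD_hol hΩ (h.aff (-1) (-r)) fun w hw => (ha w hw).left hr
  exact ((sol_hol hΩ (h.aff 1 r) (hR.const_add 1) hR _).mul
    (sol'_hol hΩ (h.aff (-1) (-r)) (hL.const_add 1) hL _)).add
    ((sol'_hol hΩ (h.aff 1 r) (hR.const_add 1) hR _).mul
    (sol_hol hΩ (h.aff (-1) (-r)) (hL.const_add 1) hL _))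

theorem ED.comp_neg_integrable {f : ℝ → ℂ} (h1 : ED f) (h2 : ED (fun x => f (-x)))
    (hc : Continuous f) : MeasureTheory.Integrable f := by
  rw [← MeasureTheory.integrableOn_univ, ← Set.Iic_union_Ioi (a := (0 : ℝ))]
  refine MeasureTheory.IntegrableOn.union ?_ (h1.integrableOn hc 0)
  have h3 := (h2.integrableOn (hc.comp continuous_neg) 0)
  rw [integrableOn_Iic_iff_integrableOn_Iio]
  have h4 := (MeasureTheory.Measure.measurePreserving_neg MeasureTheory.volume (G :=
      ℝ)).integrableOn_comp_preimage
    (Homeomorph.neg ℝ).measurableEmbedding (f := f) (s := Set.Iio 0)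
  refine h4.1 ?_
  have e : Neg.neg ⁻¹' Set.Iio (0 : ℝ) = Set.Ioi 0 := by ext x; simp
  rw [e]
  exact h3

theorem integral_split (g : ℝ → ℂ) (hg : MeasureTheory.Integrable g) (r : ℝ) :
    ∫ x, g x = (∫ x in Set.Ioi (-2 * r), g (x + r)) + ∫ x in Set.Ioi 0, g (-x - r) := by
  have h1 := MeasureTheory.integral_indicator (μ := MeasureTheory.volume) (f := g)
      (measurableSet_Ioi (a := -r))
  have h2 := MeasureTheory.integral_indicator (μ := MeasureTheory.volume) (f := g)
      (measurableSet_Iio (a := -r))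
  rw [← MeasureTheory.integral_add_right_eq_self _ r, ] at h1
  rw [← MeasureTheory.integral_sub_left_eq_self _ _ (-r)] at h2
  rw [← MeasureTheory.integral_indicator measurableSet_Ioi,
    ← MeasureTheory.integral_indicator measurableSet_Ioi,
    ← intervalIntegral.integral_Iic_add_Ioi (b := -r) hg.integrableOn hg.integrableOn,
    MeasureTheory.integral_Iic_eq_integral_Iio, ← h1, ← h2, add_comm]
  congr 1
  · congr 1
    ext x
    simp only [Set.indicator_apply, Set.mem_Ioi]
    congr 1
    rw [eq_iff_iff]; constructor <;> intro h <;> linarith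
  · congr 1
    ext x
    have : -x - r = -r - x := by ring
    simp only [Set.indicator_apply, Set.mem_Ioi, Set.mem_Iio, this]
    congr 1
    rw [eq_iff_iff]; constructor <;> intro h <;> linarith

end TwoSided

section Derivative

open Polynomial Asymptotics

theorem ED.congr_fun {f g : ℝ → ℂ} (h : ED f) (e : ∀ x, f x = g x) : ED g := by
  rwa [← show f = g from _root_.funext e]

theorem ED.two_sided_integrable {f : ℝ → ℂ} (h1 : ED f) (h2 : ED (fun x => f (-x)))
    (hc : Continuous f) (δ : ℂ[X]) :
    MeasureTheory.Integrable fun x : ℝ => δ.eval (x : ℂ) * f x := by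
  refine (h1.poly_mul δ).comp_neg_integrable ?_ ((poly_continuous_real δ).mul hc)
  refine (h2.poly_mul (aff (-1) 0 δ)).congr_fun ?_
  intro x
  simp [aff_eval]

theorem FF_deriv {r : ℝ} (hr : 0 ≤ r) {q : ℂ[X]} (hF : FF r q = 0) (ha : AdmR r q)
    (hc : Coer2 q) : ∃ κ : ℂ, κ ≠ 0 ∧ ∃ Y V : ℂ → ℂ, IsS q Y V ∧ Y ≠ 0 ∧
      ED (fun x => Y x) ∧ ED (fun x : ℝ => Y (-x)) ∧
      ∀ (δ : ℂ[X]) (ρ : ℝ), 0 < ρ → (∀ τ ∈ Metric.ball (0 : ℂ) ρ, AdmR r (q + C τ * δ)) →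
        (∀ τ ∈ Metric.ball (0 : ℂ) ρ, Coer2 (q + C τ * δ)) →
        HasDerivAt (fun τ => FF r (q + C τ * δ))
          (κ * ∫ x : ℝ, δ.eval (x : ℂ) * (Y x * Y x)) 0 := by
  obtain ⟨κ, hκ, h1, h2⟩ := FF_zero_data hF
  have hY := (yW_isS (qR r q)).of_right
  have hED : ED (fun x : ℝ => yW (qR r q) (x - r)) := by
    have := ((ha.right hr).yW_ED (hc.right r)).comp_add (-r)
    simpa [sub_eq_add_neg] using this
  have hED' : ED (fun x : ℝ => yW (qR r q) (-x - r)) := by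
    have := (((ha.left hr).yW_ED (hc.left r)).comp_add (-r)).const_mul κ⁻¹
    refine this.congr_fun ?_
    intro x
    have e := h1 (-x)
    rw [neg_neg] at e
    push_cast
    rw [← sub_eq_add_neg, e]; field_simp
  refine ⟨-κ, neg_ne_zero.2 hκ, fun z => yW (qR r q) (z - r), fun z => vW (qR r q) (z - r),
    hY, ?_, hED, hED', ?_⟩
  · intro h0
    apply yW_ne_zero (qR r q); funext z
    have := congrFun h0 (z + r)
    simpa using this
  intro δ ρ hρ haρ hcρ
  obtain ⟨a, b, hda, hdb, hab⟩ := yW_variation (q := qR r q) (δ := qR r δ) hρ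
    (fun τ hτ => by rw [← qR_add]; exact (haρ τ hτ).right hr)
    (fun τ hτ => by rw [← qR_add]; exact (hcρ τ hτ).right r) (-2 * r)
  obtain ⟨a', b', hda', hdb', hab'⟩ := yW_variation (q := qL r q) (δ := qL r δ) hρ
    (fun τ hτ => by rw [← qL_add]; exact (haρ τ hτ).left hr)
    (fun τ hτ => by rw [← qL_add]; exact (hcρ τ hτ).left r) 0
  have hintg : MeasureTheory.Integrable fun x : ℝ => δ.eval (x : ℂ) *
      (yW (qR r q) (x - r) * yW (qR r q) (x - r)) := by
    refine ED.two_sided_integrable (hED.mul_bounded hED.isBigO_one)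
      ((hED'.mul_bounded hED'.isBigO_one).congr_fun fun x => ?_)
      (hY.continuous_real.1.mul hY.continuous_real.1) δ
    push_cast; rfl
  rw [integral_split _ hintg r]
  push_cast at hda hdb hab hda' hdb' hab'
  have hd := (hda.mul hdb').add (hdb.mul hda')
  have e0 : ∀ τ, FF r (q + C τ * δ) = yW (qR r q + C τ * qR r δ) (-2 * r) *
      vW (qL r q + C τ * qL r δ) 0 + vW (qR r q + C τ * qR r δ) (-2 * r) *
      yW (qL r q + C τ * qL r δ) 0 := fun τ => by rw [FF, qR_add, qL_add]
  rw [show (fun τ => FF r (q + C τ * δ)) = _ from _root_.funext e0]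
  refine hd.congr_deriv ?_
  have i1 : (∫ x in Set.Ioi (-2 * r), δ.eval ((x + r : ℝ) : ℂ) *
      (yW (qR r q) (((x + r : ℝ) : ℂ) - r) * yW (qR r q) (((x + r : ℝ) : ℂ) - r))) =
      a * vW (qR r q) (-2 * r) - b * yW (qR r q) (-2 * r) := by
    rw [hab]
    congr 1; ext x
    rw [qR_eval]; push_cast; simp
  have i2 : (∫ x in Set.Ioi (0 : ℝ), δ.eval ((-x - r : ℝ) : ℂ) *
      (yW (qR r q) (((-x - r : ℝ) : ℂ) - r) * yW (qR r q) (((-x - r : ℝ) : ℂ) - r))) =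
      κ⁻¹ ^ 2 * (a' * vW (qL r q) 0 - b' * yW (qL r q) 0) := by
    rw [hab', ← MeasureTheory.integral_const_mul]
    congr 1; ext x
    have := h1 (-x - r)
    have e : -(-(x : ℂ) - r) - r = x := by ring
    rw [e] at this
    rw [qL_eval, this]; push_cast; field_simp
  rw [i1, i2]
  have k1 := h1 (-r)
  have k2 := h2 (-r)
  have e1 : -(-(r : ℂ)) - r = 0 := by ring
  have e2 : -(r : ℂ) - r = -2 * r := by ring
  rw [e1, e2] at k1 k2
  simp only [map_zero, zero_mul, add_zero]
  rw [k1, show vW (qL r q) 0 = -(κ * vW (qR r q) (-2 * r)) by rw [← k2]; ring]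
  field_simp
  ring

end Derivative

section Moments

open Polynomial Asymptotics MeasureTheory FourierTransform

theorem eq_zero_of_moments {g : ℝ → ℂ} (h1 : ED g) (h2 : ED (fun x => g (-x)))
    (hc : Continuous g) (hm : ∀ n : ℕ, ∫ x : ℝ, (x : ℂ) ^ n * g x = 0) : g = 0 := by
  have hexp : ∀ c : ℝ, Integrable fun x : ℝ => (Real.exp (c * |x|) : ℂ) * g x := by
    intro c
    have hO : (fun x : ℝ => (Real.exp (c * |x|) : ℂ)) =O[atTop] fun x : ℝ => Real.exp (c * x) := by
      refine IsBigO.of_bound 1 ?_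
      filter_upwards [eventually_ge_atTop 0] with x hx
      rw [abs_of_nonneg hx, norm_real, one_mul]
    refine ED.comp_neg_integrable (h1.mul_exp hO) ?_ (by fun_prop)
    refine (h2.mul_exp hO).congr_fun fun x => ?_
    rw [abs_neg]
  have hintg : Integrable g := by simpa using hexp 0
  have hF : 𝓕 g = 0 := by
    ext t
    rw [Real.fourier_real_eq_integral_exp_smul]
    have key := hasSum_integral_of_dominated_convergence (μ := (volume : Measure ℝ))
      (F := fun (n : ℕ) (x : ℝ) => ((-2 * Real.pi * t : ℝ) * I * x : ℂ) ^ n / (n.factorial : ℂ) *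
          g x)
      (f := fun x => cexp ((-2 * Real.pi * t : ℝ) * I * x) * g x)
      (fun n x => ‖(-2 * Real.pi * t : ℝ) * x‖ ^ n / (n.factorial : ℝ) * ‖g x‖)
      (fun n => by
        refine Continuous.aestronglyMeasurable ?_
        fun_prop)
      (fun n => Eventually.of_forall fun x => by
        rw [norm_mul, norm_div, norm_pow]
        simp)
      (Eventually.of_forall fun x => (Real.summable_pow_div_factorial _).mul_right _)
      (by
        have := (hexp |(-2 * Real.pi * t)|).norm
        refine this.congr (Eventually.of_forall fun x => ?_)
        simp only
        rw [tsum_mul_right, norm_mul, norm_real, Real.norm_of_nonneg (Real.exp_pos _).le,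
          Real.exp_eq_exp_ℝ, NormedSpace.exp_eq_tsum_div, norm_mul, Real.norm_eq_abs,
          Real.norm_eq_abs])
      (Eventually.of_forall fun x => by
        have := NormedSpace.expSeries_div_hasSum_exp (𝔸 := ℂ) ((-2 * Real.pi * t : ℝ) * I * x)
        rw [← Complex.exp_eq_exp_ℂ] at this
        exact this.mul_right _)
    have h0 : ∀ n : ℕ, ∫ x : ℝ, ((-2 * Real.pi * t : ℝ) * I * x : ℂ) ^ n / (n.factorial : ℂ) * g x
        = 0 := by
      intro n
      have : ∀ x : ℝ, ((-2 * Real.pi * t : ℝ) * I * x : ℂ) ^ n / (n.factorial : ℂ) * g x =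
          (((-2 * Real.pi * t : ℝ) * I : ℂ) ^ n / (n.factorial : ℂ)) * ((x : ℂ) ^ n * g x) := by
        intro x; rw [mul_pow]; ring
      simp only [this]
      rw [integral_const_mul, hm n, mul_zero]
    simp only [h0] at key
    have := key.unique hasSum_zero
    simp only [smul_eq_mul, Pi.zero_apply]
    rw [← this]
    congr 1; ext x; congr 2; push_cast; ring
  have := hc.fourierInv_fourier_eq hintg (by rw [hF]; exact integrable_zero _ _ _)
  rw [← this, hF]
  ext t
  rw [Real.fourierInv_eq]
  simp

theorem moment_identity {q : ℂ[X]} {Y V : ℂ → ℂ} (h : IsS q Y V) (hY : ED (fun x => Y x))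
    (hY' : ED (fun x : ℝ => Y (-x))) (T : ℂ[X]) :
    ∫ x : ℝ, (derivative (derivative (derivative T)) - 4 * derivative T * q
      - 2 * T * derivative q).eval (x : ℂ) * (Y x * Y x) = 0 := by
  have hV := h.deriv_ED hY
  have hs := h.aff_neg 0
  simp only [add_zero] at hs
  have hV' : ED (fun x : ℝ => V (-x)) := by
    have := (hs.deriv_ED hY').const_mul (-1)
    exact this.congr_fun fun x => by ring
  set Ψ : ℝ → ℂ := fun x => T.eval (x : ℂ) * (2 * V x * V x - 2 * q.eval (x : ℂ) * (Y x * Y x)) -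
    2 * (derivative T).eval (x : ℂ) * (Y x * V x) +
    (derivative (derivative T)).eval (x : ℂ) * (Y x * Y x) with hΨ
  have hd : ∀ x : ℝ, HasDerivAt Ψ ((derivative (derivative (derivative T)) - 4 * derivative T * q
      - 2 * T * derivative q).eval (x : ℂ) * (Y x * Y x)) x := by
    intro x
    obtain ⟨a, b⟩ := h.hasDerivAt_real x
    have p : ∀ P : ℂ[X], HasDerivAt (fun x : ℝ => P.eval (x : ℂ)) ((derivative P).eval (x : ℂ)) x :=
      fun P => (P.hasDerivAt (x : ℂ)).comp_ofReal
    refine ((((p T).mul ((b.const_mul 2).mul b |>.sub (((p q).const_mul 2).mul (a.mul a)))).sub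
      (((p _).const_mul 2).mul (a.mul b))).add ((p _).mul (a.mul a))).congr_deriv ?_
    simp only [eval_sub, eval_mul, eval_ofNat, Pi.mul_apply, Pi.sub_apply]
    ring
  have ev : ∀ {Y V : ℂ → ℂ} {q T : ℂ[X]}, ED (fun x => Y x) → ED (fun x => V x) →
      ∀ A B C' D : ℂ[X], ED (fun x : ℝ => A.eval (x : ℂ) * (V x * V x) + B.eval (x : ℂ) * (Y x * Y
          x) +
        C'.eval (x : ℂ) * (Y x * V x) + D.eval (x : ℂ) * (Y x * Y x)) := by
    intro Y V q T hY hV A B C' D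
    exact ((((hV.mul_bounded hV.isBigO_one).poly_mul A).add
      ((hY.mul_bounded hY.isBigO_one).poly_mul B)).add
      ((hV.mul_bounded hY.isBigO_one).poly_mul C')).add
      ((hY.mul_bounded hY.isBigO_one).poly_mul D)
  have t1 : Tendsto Ψ atTop (𝓝 0) := by
    refine (ev (q := q) (T := T) hY hV (2 * T) (-(2 * T * q)) (-(2 * derivative T))
      (derivative (derivative T))).tendsto.congr fun x => ?_
    simp [hΨ]; ring
  have t2 : Tendsto Ψ atBot (𝓝 0) := by
    have := (ev (Y := fun z => Y (-z)) (V := fun z => V (-z)) (q := q) (T := T) hY' hV'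
      (aff (-1) 0 (2 * T)) (aff (-1) 0 (-(2 * T * q)))
      (aff (-1) 0 (-(2 * derivative T)))
      (aff (-1) 0 (derivative (derivative T)))).tendsto.comp tendsto_neg_atBot_atTop
    refine this.congr fun x => ?_
    simp [hΨ, aff_eval]; ring
  have hintg : Integrable fun x : ℝ => (derivative (derivative (derivative T)) - 4 * derivative T
      * q
      - 2 * T * derivative q).eval (x : ℂ) * (Y x * Y x) := by
    refine ED.two_sided_integrable (hY.mul_bounded hY.isBigO_one)
      ((hY'.mul_bounded hY'.isBigO_one).congr_fun fun x => ?_)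
      (h.continuous_real.1.mul h.continuous_real.1) _
    push_cast; rfl
  have := integral_of_hasDerivAt_of_tendsto hd hintg t2 t1
  simpa using this

theorem eq_zero_of_low_moments {q : ℂ[X]} {d : ℕ} (hd : 1 ≤ d) (hq : q.natDegree ≤ d)
    (hq1 : q.coeff d = 1) {Y V : ℂ → ℂ} (h : IsS q Y V) (hY : ED (fun x => Y x))
    (hY' : ED (fun x : ℝ => Y (-x)))
    (hm : ∀ k < d, ∫ x : ℝ, (x : ℂ) ^ k * (Y x * Y x) = 0) : Y = 0 := by
  have hg := hY.mul_bounded hY.isBigO_one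
  have hg' : ED (fun x : ℝ => Y ((-x : ℝ) : ℂ) * Y ((-x : ℝ) : ℂ)) :=
    (hY'.mul_bounded hY'.isBigO_one).congr_fun fun x => by push_cast; rfl
  have hcont := h.continuous_real.1.mul h.continuous_real.1
  have hlin : ∀ (P : ℂ[X]) (n : ℕ), P.natDegree < n → ∫ x : ℝ, P.eval (x : ℂ) * (Y x * Y x) =
      ∑ k ∈ Finset.range n, P.coeff k * ∫ x : ℝ, (x : ℂ) ^ k * (Y x * Y x) := by
    intro P n hn
    simp only [eval_eq_sum_range' hn, Finset.sum_mul, mul_assoc]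
    rw [integral_finsetSum]
    · simp only [integral_const_mul]
    · intro k _
      have := (ED.two_sided_integrable hg hg' hcont (X ^ k)).const_mul (P.coeff k)
      simpa using this
  have hall : ∀ n : ℕ, ∫ x : ℝ, (x : ℂ) ^ n * (Y x * Y x) = 0 := by
    intro n
    induction n using Nat.strong_induction_on with
    | _ n ih =>
    by_cases hn : n < d
    · exact hm n hn
    obtain ⟨i, rfl⟩ : ∃ i, n = i + d := ⟨n - d, by omega⟩
    have hid := moment_identity h hY hY' (X ^ (i + 1))
    set P := derivative (derivative (derivative (X ^ (i + 1) : ℂ[X]))) - 4 * derivative (X ^ (i +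
        1)) * q
      - 2 * X ^ (i + 1) * derivative q with hP
    have c1 : ∀ (m : ℕ), i + d ≤ m → (derivative (derivative (derivative (X ^ (i + 1) :
        ℂ[X])))).coeff m = 0 := by
      intro m hm
      simp only [coeff_derivative]
      rw [coeff_X_pow, if_neg (by omega)]; simp
    have e2 : (4 * derivative (X ^ (i + 1)) * q : ℂ[X]) = C (4 * ((i : ℂ) + 1)) * (X ^ i * q) := by
      rw [C_mul, show (C 4 : ℂ[X]) = 4 from rfl]; simp; ring
    have e3 : (2 * X ^ (i + 1) * derivative q : ℂ[X]) = C 2 * (X ^ (i + 1) * derivative q) := by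
      rw [show (C 2 : ℂ[X]) = 2 from rfl]; ring
    have hcoef : ∀ j, P.coeff (i + d + j) = -(4 * ((i : ℂ) + 1)) * q.coeff (d + j)
        - 2 * (q.coeff (d + j) * (d + j)) := by
      intro j
      rw [hP, coeff_sub, coeff_sub, c1 _ (by omega), e2, e3, coeff_C_mul, coeff_C_mul,
        show i + d + j = (d + j) + i by ring, coeff_X_pow_mul,
        show (d + j) + i = (d + j - 1) + (i + 1) by omega, coeff_X_pow_mul, coeff_derivative,
        show d + j - 1 + 1 = d + j by omega]
      have : ((d + j - 1 : ℕ) : ℂ) + 1 = d + j := by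
        rw [Nat.cast_sub (by omega)]; push_cast; ring
      rw [this]; ring
    have hdeg : P.natDegree < i + d + 1 := by
      rw [Nat.lt_succ_iff, natDegree_le_iff_coeff_eq_zero]
      intro N hN
      obtain ⟨j, rfl⟩ : ∃ j, N = i + d + j := ⟨N - (i + d), by omega⟩
      rw [hcoef, coeff_eq_zero_of_natDegree_lt (show q.natDegree < d + j by omega)]; simp
    rw [hlin P _ hdeg, Finset.sum_range_succ, Finset.sum_eq_zero, zero_add] at hid
    · have hne : P.coeff (i + d) ≠ 0 := by
        have := hcoef 0
        simp only [add_zero, hq1] at this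
        rw [this]
        intro h0
        have h0' := congrArg Complex.re h0
        simp at h0'
        have : (0 : ℝ) ≤ i := Nat.cast_nonneg i
        have : (0 : ℝ) ≤ d := Nat.cast_nonneg d
        linarith
      simpa [hne] using hid
    · intro k hk
      rw [ih k (Finset.mem_range.1 hk), mul_zero]
  have h0 := eq_zero_of_moments hg hg' hcont hall
  have hr : ∀ x : ℝ, Y x = 0 := fun x => by simpa using congrFun h0 x
  have hv : V 0 = 0 := by
    have := (h.hasDerivAt_real 0).1
    rw [show (fun x : ℝ => Y x) = fun _ => (0 : ℂ) from _root_.funext hr] at this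
    simpa using this.unique (hasDerivAt_const 0 0)
  ext z
  exact (h.eq_zero (x := 0) (by simpa using hr 0) hv z).1

end Moments

section Eigenfunctions

open Polynomial Asymptotics MeasureTheory ComplexConjugate

/-- `Y`, with derivative `V`, is a nonzero solution decaying superexponentially at both ends. -/
structure EF (q : ℂ[X]) (Y V : ℂ → ℂ) : Prop where
  isS : IsS q Y V
  ne : Y ≠ 0
  right : ED (fun x => Y x)
  left : ED (fun x : ℝ => Y (-x))

theorem EF.bd {q : ℂ[X]} {Y V : ℂ → ℂ} (h : EF q Y V) : Bd q := by
  refine ⟨Y, V, h.isS, h.ne, h.right.tendsto, ?_⟩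
  have := h.left.tendsto.comp tendsto_neg_atBot_atTop
  refine this.congr fun x => ?_
  simp

theorem Coer2.exists_admR {q : ℂ[X]} (h : Coer2 q) : ∃ r : ℝ, 0 ≤ r ∧ AdmR r q := by
  obtain ⟨a, ha⟩ := (h.1.eventually_ge_atTop 1).exists_forall_of_atTop
  obtain ⟨b, hb⟩ := (h.2.eventually_ge_atTop 1).exists_forall_of_atTop
  refine ⟨max 0 (max a b), le_max_left _ _, fun x hx => ?_⟩
  rcases abs_cases x with ⟨h1, h2⟩ | ⟨h1, h2⟩
  · exact ha x (by rw [← h1]; exact ((le_max_left _ _).trans (le_max_right _ _)).trans hx)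
  · have := hb (-x) (by rw [← h1]; exact ((le_max_right _ _).trans (le_max_right _ _)).trans hx)
    simpa [aff_eval] using this

theorem EF.of_tendsto {q : ℂ[X]} (hc : Coer2 q) {Y V : ℂ → ℂ} (h : IsS q Y V) (hne : Y ≠ 0)
    (ht : Tendsto (fun x : ℝ => Y x) atTop (𝓝 0)) (hb : Tendsto (fun x : ℝ => Y x) atBot (𝓝 0)) :
    EF q Y V := by
  obtain ⟨r, hr, ha⟩ := hc.exists_admR
  refine ⟨h, hne, ?_, ?_⟩
  · obtain ⟨c, hc1, -⟩ := (ha.right hr).eq_mul_yW (h.to_right (r := r)) (by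
      refine (ht.comp (tendsto_atTop_add_const_right atTop r tendsto_id)).congr fun x => ?_
      simp)
    refine ((((ha.right hr).yW_ED (hc.right r)).comp_add (-r)).const_mul c).congr_fun fun x => ?_
    rw [← hc1]; push_cast; congr 1; ring
  · obtain ⟨c, hc1, -⟩ := (ha.left hr).eq_mul_yW (h.to_left (r := r)) (by
      have h1 : Tendsto (fun x : ℝ => -x - r) atTop atBot :=
        tendsto_atBot_add_const_right atTop (-r) tendsto_neg_atTop_atBot
      refine (hb.comp h1).congr fun x => ?_
      simp)
    refine ((((ha.left hr).yW_ED (hc.left r)).comp_add (-r)).const_mul c).congr_fun fun x => ?_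
    rw [← hc1]; push_cast; congr 1; ring

theorem Bd.exists_EF {q : ℂ[X]} (hc : Coer2 q) (h : Bd q) : ∃ Y V, EF q Y V := by
  obtain ⟨Y, V, h1, h2, h3, h4⟩ := h
  exact ⟨Y, V, EF.of_tendsto hc h1 h2 h3 h4⟩

theorem EF.right' {q : ℂ[X]} {Y V : ℂ → ℂ} (h : EF q Y V) : ED (fun x => V x) :=
  h.isS.deriv_ED h.right

theorem EF.left' {q : ℂ[X]} {Y V : ℂ → ℂ} (h : EF q Y V) : ED (fun x : ℝ => V (-x)) := by
  have hs := h.isS.aff_neg 0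
  simp only [add_zero] at hs
  have := (hs.deriv_ED h.left).const_mul (-1)
  exact this.congr_fun fun x => by ring

theorem EF.exists_ne {q : ℂ[X]} {Y V : ℂ → ℂ} (h : EF q Y V) : ∃ x : ℝ, Y x ≠ 0 := by
  by_contra! hr
  have hv : V 0 = 0 := by
    have := (h.isS.hasDerivAt_real 0).1
    rw [show (fun x : ℝ => Y x) = fun _ => (0 : ℂ) from _root_.funext hr] at this
    simpa using this.unique (hasDerivAt_const 0 0)
  exact h.ne (_root_.funext fun z => (h.isS.eq_zero (x := 0) (by simpa using hr 0) hv z).1)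

theorem EF.flux {q : ℂ[X]} {Y V : ℂ → ℂ} (h : EF q Y V) {c : ℂ} (hc : 0 ≤ c.re)
    (hq : ∀ x : ℝ, 0 ≤ (c * q.eval (x : ℂ)).re) (x : ℝ) :
    (c * (conj (Y x) * V x)).re = 0 ∧ (c * q.eval (x : ℂ)).re * normSq (Y x) = 0 := by
  have hd : ∀ x : ℝ, HasDerivAt (fun x : ℝ => (c * (conj (Y x) * V x)).re)
      (c.re * normSq (V x) + (c * q.eval (x : ℂ)).re * normSq (Y x)) x := by
    intro x
    obtain ⟨a, b⟩ := h.isS.hasDerivAt_real x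
    have := ((a.star.mul b).const_mul c)
    have := reCLM.hasFDerivAt.comp_hasDerivAt x this
    refine this.congr_deriv ?_
    simp [normSq_apply]
    ring
  have hm : Monotone (fun x : ℝ => (c * (conj (Y x) * V x)).re) :=
    monotone_of_hasDerivAt_nonneg hd fun x =>
      add_nonneg (mul_nonneg hc (normSq_nonneg _)) (mul_nonneg (hq x) (normSq_nonneg _))
  have key : ∀ {l : Filter ℝ}, Tendsto (fun x : ℝ => Y x) l (𝓝 0) →
      Tendsto (fun x : ℝ => V x) l (𝓝 0) →
      Tendsto (fun x : ℝ => (c * (conj (Y x) * V x)).re) l (𝓝 0) := by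
    intro l h1 h2
    have : Continuous fun p : ℂ × ℂ => (c * (conj p.1 * p.2)).re := by fun_prop
    simpa [Function.comp_def] using (this.tendsto (0, 0)).comp (h1.prodMk_nhds h2)
  have t1 := key h.right.tendsto h.right'.tendsto
  have t2 : Tendsto (fun x : ℝ => (c * (conj (Y x) * V x)).re) atBot (𝓝 0) := by
    refine key ?_ ?_
    · exact (h.left.tendsto.comp tendsto_neg_atBot_atTop).congr fun x => by simp
    · exact (h.left'.tendsto.comp tendsto_neg_atBot_atTop).congr fun x => by simp
  have h0 : (fun x : ℝ => (c * (conj (Y x) * V x)).re) = fun _ => 0 := by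
    ext x
    exact le_antisymm (hm.ge_of_tendsto t1 x) (hm.le_of_tendsto t2 x)
  refine ⟨congrFun h0 x, ?_⟩
  have := (hd x)
  rw [h0] at this
  have e := this.unique (hasDerivAt_const x 0)
  have p1 := mul_nonneg hc (normSq_nonneg (V x))
  have p2 := mul_nonneg (hq x) (normSq_nonneg (Y x))
  linarith

theorem EF.not_re_pos {q : ℂ[X]} {Y V : ℂ → ℂ} (h : EF q Y V) :
    ¬ ∀ x : ℝ, 0 < (q.eval (x : ℂ)).re := by
  intro hp
  obtain ⟨x, hx⟩ := h.exists_ne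
  have := (h.flux (c := 1) (by simp) (fun x => by simpa using (hp x).le) x).2
  simp only [one_mul] at this
  exact mul_ne_zero (hp x).ne' (by simpa using hx) this

theorem EF.im_eq_zero {q : ℂ[X]} {Y V : ℂ → ℂ} (h : EF q Y V) {m : ℝ}
    (hq : ∀ x : ℝ, (q.eval (x : ℂ)).im = m) : m = 0 := by
  obtain ⟨x, hx⟩ := h.exists_ne
  rcases le_total 0 m with hm | hm
  · have := (h.flux (c := -I) (by simp) (fun x => by simpa [hq] using hm) x).2
    simpa [hq, hx] using this
  · have := (h.flux (c := I) (by simp) (fun x => by simpa [hq] using hm) x).2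
    simpa [hq, hx] using this

/-- The polynomial takes real values on the real axis. -/
def RealPoly (q : ℂ[X]) : Prop := ∀ x : ℝ, (q.eval (x : ℂ)).im = 0

theorem RealPoly.eval_conj {q : ℂ[X]} (h : RealPoly q) (z : ℂ) :
    q.eval (conj z) = conj (q.eval z) := by
  have e : q.map (starRingEnd ℂ) = q := by
    refine Polynomial.eq_of_infinite_eval_eq _ _ ?_
    refine (Set.infinite_range_of_injective ofReal_injective).mono ?_
    rintro _ ⟨x, rfl⟩
    have : (q.map (starRingEnd ℂ)).eval (conj (x : ℂ)) = conj (q.eval (x : ℂ)) := by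
      rw [eval_map_apply]
    rw [conj_ofReal] at this
    simp only [Set.mem_ofPred_eq, this]
    exact conj_eq_iff_im.2 (h x)
  conv_lhs => rw [← e]
  rw [eval_map_apply]

theorem IsS.conj {q : ℂ[X]} (hq : RealPoly q) {Y V : ℂ → ℂ} (h : IsS q Y V) :
    IsS q (fun z => conj (Y (conj z))) (fun z => conj (V (conj z))) := by
  intro z
  obtain ⟨a, b⟩ := h (conj z)
  refine ⟨?_, ?_⟩
  · simpa [Function.comp_def] using a.conj_conj
  · simpa [Function.comp_def, hq.eval_conj] using b.conj_conj

theorem EF.const_mul {q : ℂ[X]} {Y V : ℂ → ℂ} (h : EF q Y V) {c : ℂ} (hc : c ≠ 0) :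
    EF q (fun z => c * Y z) (fun z => c * V z) := by
  refine ⟨by simpa using h.isS.comb h.isS c 0, ?_, h.right.const_mul c, h.left.const_mul c⟩
  intro h0
  exact h.ne (_root_.funext fun z => by simpa [hc] using congrFun h0 z)

theorem EF.exists_real {q : ℂ[X]} (hq : RealPoly q) {Y V : ℂ → ℂ} (h : EF q Y V) :
    ∃ c : ℂ, c ≠ 0 ∧ ∀ x : ℝ, (c * Y x).im = 0 ∧ (c * V x).im = 0 := by
  obtain ⟨x, hx⟩ := h.exists_ne
  have hf := (h.flux (c := I) (by simp) (fun x => by simp [hq x]) x).1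
  refine ⟨(Y x)⁻¹, inv_ne_zero hx, ?_⟩
  have hs := (h.const_mul (inv_ne_zero hx)).isS
  have hv : ((Y x)⁻¹ * V x).im = 0 := by
    have : (Y x)⁻¹ * V x = (conj (Y x) * V x) * ((normSq (Y x))⁻¹ : ℝ) := by
      rw [Complex.inv_def]; push_cast; ring
    rw [this, im_mul_ofReal]
    simp only [I_mul_re] at hf
    rw [neg_eq_zero.1 hf, zero_mul]
  intro t
  have := (hs.conj hq).eq_of hs (x := (x : ℂ)) (by simp [hx])
    (by simp only [conj_ofReal]; exact conj_eq_iff_im.2 hv) t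
  simp only [conj_ofReal] at this
  exact ⟨conj_eq_iff_im.1 this.1, conj_eq_iff_im.1 this.2⟩

theorem EF.integral_sq_ne_zero {q : ℂ[X]} (hq : RealPoly q) {Y V : ℂ → ℂ} (h : EF q Y V) :
    ∫ x : ℝ, Y x * Y x ≠ 0 := by
  obtain ⟨c, hc, hr⟩ := h.exists_real hq
  set g : ℝ → ℝ := fun x => (c * Y x).re ^ 2 with hg
  have e : ∀ x : ℝ, Y x * Y x = (c ^ 2)⁻¹ * (g x : ℂ) := by
    intro x
    have : c * Y x = ((c * Y x).re : ℂ) := by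
      apply Complex.ext <;> simp [(hr x).1]
    simp only [hg]
    push_cast
    rw [← this]; field_simp
  have hgc : Continuous g := by
    have := h.isS.continuous_real.1
    exact (continuous_re.comp (continuous_const.mul this)).pow 2
  have hintg : Integrable g := by
    have h1 := ED.two_sided_integrable (h.right.mul_bounded h.right.isBigO_one)
      ((h.left.mul_bounded h.left.isBigO_one).congr_fun fun x => by push_cast; rfl)
      (h.isS.continuous_real.1.mul h.isS.continuous_real.1) 1
    have h2 := (h1.const_mul (c ^ 2)).re
    refine h2.congr (Eventually.of_forall fun x => ?_)
    simp only [eval_one, one_mul]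
    have := e x
    rw [this, ← mul_assoc, mul_inv_cancel₀ (pow_ne_zero 2 hc), one_mul]
    simp
  simp only [e]
  rw [integral_const_mul, integral_complex_ofReal]
  refine mul_ne_zero (inv_ne_zero (pow_ne_zero 2 hc)) (ofReal_ne_zero.2 ?_)
  obtain ⟨x, hx⟩ := h.exists_ne
  refine (integral_pos_of_integrable_nonneg_nonzero hgc hintg (fun x => sq_nonneg _) (x := x)
      ?_).ne'
  intro h0
  have h1 : (c * Y x).re = 0 := by simpa [hg] using h0
  exact mul_ne_zero hc hx (Complex.ext h1 (hr x).1)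

end Eigenfunctions

section Hurwitz

/-- Continuous convergence of a family of functions on `U`. -/
def CTend {ι : Type*} (l : Filter ι) (f : ι → ℂ → ℂ) (f0 : ℂ → ℂ) (U : Set ℂ) : Prop :=
  ∀ z ∈ U, Tendsto (fun p : ι × ℂ => f p.1 p.2) (l ×ˢ 𝓝 z) (𝓝 (f0 z))

variable {ι : Type*} {l : Filter ι} {f : ι → ℂ → ℂ} {f0 : ℂ → ℂ} {U : Set ℂ}

theorem IsCompact.eventually_forall_prod {K : Set ℂ} (hK : IsCompact K) {P : ι → ℂ → Prop}
    (h : ∀ z ∈ K, ∀ᶠ p : ι × ℂ in l ×ˢ 𝓝 z, P p.1 p.2) : ∀ᶠ x in l, ∀ z ∈ K, P x z := by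
  have h1 := hK.mem_prod_nhdsSet_of_forall (s := {p : ι × ℂ | P p.1 p.2}) h
  have h2 : ∀ᶠ p : ι × ℂ in l ×ˢ 𝓝ˢ K, P p.1 p.2 := h1
  refine h2.curry.mono fun x hx => hx.self_of_nhdsSet

theorem CTend.point (h : CTend l f f0 U) {z : ℂ} (hz : z ∈ U) :
    Tendsto (fun x => f x z) l (𝓝 (f0 z)) :=
  (h z hz).comp (tendsto_id.prodMk tendsto_const_nhds)

theorem CTend.eventually_ne (h : CTend l f f0 U) {K : Set ℂ} (hK : IsCompact K) (hKU : K ⊆ U)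
    (hne : ∀ z ∈ K, f0 z ≠ 0) : ∀ᶠ x in l, ∀ z ∈ K, f x z ≠ 0 :=
  hK.eventually_forall_prod fun z hz => (h z (hKU hz)).eventually_ne (hne z hz)

theorem CTend.locally (h : CTend l f f0 U) (hU : IsOpen U) (hf0 : ContinuousOn f0 U) :
    TendstoLocallyUniformlyOn f f0 l U := by
  rw [hU.tendstoLocallyUniformlyOn_iff_forall_tendsto]
  intro z hz
  have h1 : Tendsto (fun p : ι × ℂ => f0 p.2) (l ×ˢ 𝓝 z) (𝓝 (f0 z)) :=
    (hf0.continuousAt (hU.mem_nhds hz)).tendsto.comp tendsto_snd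
  exact (h1.prodMk_nhds (h z hz)).mono_right (nhds_le_uniformity (f0 z))

theorem CTend.exists_zero (h : CTend l f f0 U) (hU : IsOpen U) (hf0 : DifferentiableOn ℂ f0 U)
    (hf : ∀ᶠ x in l, DifferentiableOn ℂ (f x) U) {z0 : ℂ} (hz0 : z0 ∈ U) (h0 : f0 z0 = 0)
    (hne : ¬ ∀ᶠ z in 𝓝 z0, f0 z = 0) {ρ : ℝ} (hρ : 0 < ρ) :
    ∀ᶠ x in l, ∃ z ∈ Metric.ball z0 ρ, f x z = 0 := by
  have han : AnalyticAt ℂ f0 z0 := hf0.analyticAt (hU.mem_nhds hz0)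
  have hiso := han.eventually_eq_zero_or_eventually_ne_zero.resolve_left hne
  obtain ⟨s, hs, hs2⟩ := Metric.eventually_nhds_iff_ball.1 (eventually_nhdsWithin_iff.1 hiso)
  obtain ⟨s', hs', hs'U⟩ := Metric.isOpen_iff.1 hU z0 hz0
  set r := min (min s s') ρ / 2 with hr
  have hr0 : 0 < r := by positivity
  have hrs : r < s := by
    have : min (min s s') ρ ≤ s := (min_le_left _ _).trans (min_le_left _ _)
    have : 0 < min (min s s') ρ := by positivity
    linarith
  have hrs' : r < s' := by
    have : min (min s s') ρ ≤ s' := (min_le_left _ _).trans (min_le_right _ _)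
    have : 0 < min (min s s') ρ := by positivity
    linarith
  have hrρ : r < ρ := by
    have : min (min s s') ρ ≤ ρ := min_le_right _ _
    have : 0 < min (min s s') ρ := by positivity
    linarith
  have hcU : Metric.closedBall z0 r ⊆ U :=
    (Metric.closedBall_subset_ball hrs').trans hs'U
  have hSU : Metric.sphere z0 r ⊆ U := Metric.sphere_subset_closedBall.trans hcU
  have hSne : ∀ z ∈ Metric.sphere z0 r, f0 z ≠ 0 := fun z hz => by
    refine hs2 z ?_ ?_
    · rw [Metric.mem_ball, Metric.mem_sphere.1 hz]; exact hrs
    · rintro rfl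
      rw [Metric.mem_sphere, dist_self] at hz
      exact hr0.ne hz
  obtain ⟨m, hm0, hm⟩ : ∃ m : ℝ, 0 < m ∧ ∀ z ∈ Metric.sphere z0 r, m < ‖f0 z‖ := by
    obtain ⟨z1, hz1, hmin⟩ := (isCompact_sphere z0 r).exists_isMinOn
      ((NormedSpace.sphere_nonempty (x := z0)).2 hr0.le) (hf0.continuousOn.norm.mono hSU)
    have h1 := norm_pos_iff.2 (hSne z1 hz1)
    exact ⟨‖f0 z1‖ / 2, half_pos h1, fun z hz => lt_of_lt_of_le (half_lt_self h1) (hmin hz)⟩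
  have e1 : ∀ᶠ x in l, ∀ z ∈ Metric.sphere z0 r, m < ‖f x z‖ :=
    (isCompact_sphere z0 r).eventually_forall_prod fun z hz =>
      (h z (hSU hz)).norm.eventually (lt_mem_nhds (hm z hz))
  have e2 : ∀ᶠ x in l, ‖f x z0‖ < m := by
    have := (h.point hz0).norm
    rw [h0, norm_zero] at this
    exact this.eventually (gt_mem_nhds hm0)
  filter_upwards [e1, e2, hf] with x h1 h2 h3
  by_contra! hno
  have hnz : ∀ z ∈ Metric.closedBall z0 r, f x z ≠ 0 := fun z hz =>
    hno z (Metric.closedBall_subset_ball hrρ hz)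
  have hd : DifferentiableOn ℂ (fun z => (f x z)⁻¹) (Metric.closedBall z0 r) :=
    (h3.mono hcU).inv hnz
  have hdc : DiffContOnCl ℂ (fun z => (f x z)⁻¹) (Metric.ball z0 r) := by
    refine DifferentiableOn.diffContOnCl ?_
    rwa [closure_ball z0 hr0.ne']
  have := norm_le_of_forall_mem_frontier_norm_le Metric.isBounded_ball hdc (C := m⁻¹)
    (fun z hz => by
      rw [frontier_ball z0 hr0.ne'] at hz
      rw [norm_inv]
      exact inv_anti₀ hm0 (h1 z hz).le) (z := z0) (subset_closure (Metric.mem_ball_self hr0))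
  rw [norm_inv] at this
  have h4 : 0 < ‖f x z0‖ := norm_pos_iff.2 (hnz z0 (Metric.mem_closedBall_self hr0.le))
  exact absurd ((inv_le_inv₀ h4 hm0).1 this) (not_le.2 h2)

theorem CTend.exists_injOn (h : CTend l f f0 U) (hU : IsOpen U) (hf0 : DifferentiableOn ℂ f0 U)
    (hf : ∀ᶠ x in l, DifferentiableOn ℂ (f x) U) {z0 : ℂ} (hz0 : z0 ∈ U)
    (hd : deriv f0 z0 ≠ 0) :
    ∃ r > 0, Metric.ball z0 r ⊆ U ∧ ∀ᶠ x in l, Set.InjOn (f x) (Metric.ball z0 r) := by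
  have hloc := (h.locally hU hf0.continuousOn).deriv hf hU
  have hpos : 0 < ‖deriv f0 z0‖ / 4 := by positivity
  have hcont : ContinuousAt (deriv f0) z0 :=
    ((hf0.analyticAt (hU.mem_nhds hz0)).deriv).continuousAt
  obtain ⟨s, hs, hs2⟩ := Metric.continuousAt_iff.1 hcont _ hpos
  obtain ⟨s', hs', hs'U⟩ := Metric.isOpen_iff.1 hU z0 hz0
  obtain ⟨t, ht, ht2⟩ := Metric.tendstoLocallyUniformlyOn_iff.1 hloc _ hpos z0 hz0
  rw [hU.nhdsWithin_eq hz0] at ht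
  obtain ⟨s'', hs'', hs''t⟩ := Metric.mem_nhds_iff.1 ht
  set r := min (min s s') s'' with hr
  have hrU : Metric.ball z0 r ⊆ U :=
    (Metric.ball_subset_ball ((min_le_left _ _).trans (min_le_right _ _))).trans hs'U
  refine ⟨r, by positivity, hrU, ?_⟩
  filter_upwards [hf, ht2] with x hx hx2
  intro u hu v hv huv
  set a := deriv f0 z0 with ha
  have hder : ∀ z ∈ Metric.ball z0 r, HasDerivWithinAt (fun z => f x z - a * z)
      (deriv (f x) z - a) (Metric.ball z0 r) z := by
    intro z hz
    have h1 := ((hx z (hrU hz)).differentiableAt (hU.mem_nhds (hrU hz))).hasDerivAt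
    exact ((h1.sub ((hasDerivAt_id z).const_mul a)).congr_deriv (by simp)).hasDerivWithinAt
  have hb : ∀ z ∈ Metric.ball z0 r, ‖deriv (f x) z - a‖ ≤ ‖a‖ / 2 := by
    intro z hz
    have h1 := hx2 z (hs''t (Metric.ball_subset_ball (min_le_right _ _) hz))
    have h2 := hs2 (Metric.ball_subset_ball ((min_le_left _ _).trans (min_le_left _ _)) hz)
    rw [dist_eq_norm] at h1 h2
    have h3 : deriv (f x) z - a = -(deriv f0 z - deriv (f x) z) + (deriv f0 z - a) := by ring
    rw [h3]
    refine (norm_add_le _ _).trans ?_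
    rw [norm_neg]
    simp only [Function.comp] at h1
    linarith
  have := Convex.norm_image_sub_le_of_norm_hasDerivWithin_le hder hb (convex_ball z0 r) hu hv
  rw [huv] at this
  have e : f x v - a * v - (f x v - a * u) = -(a * (v - u)) := by ring
  rw [e, norm_neg, norm_mul] at this
  by_contra hne
  have hp : 0 < ‖v - u‖ := norm_pos_iff.2 (sub_ne_zero.2 (Ne.symm hne))
  have ha0 : 0 < ‖a‖ := norm_pos_iff.2 hd
  nlinarith [mul_pos ha0 hp]

theorem not_eventually_zero_of_deriv_ne {f0 : ℂ → ℂ} {z0 : ℂ} (hd : deriv f0 z0 ≠ 0) :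
    ¬ ∀ᶠ z in 𝓝 z0, f0 z = 0 := fun h =>
  hd (by rw [Filter.EventuallyEq.deriv_eq (f := fun _ => (0 : ℂ)) h]; simp)

end Hurwitz

section Family
open Polynomial

/-- The potential `P_α - λ` as a polynomial. -/
noncomputable def PolP (d : ℕ) (p : (Fin (d - 1) → ℂ) × ℂ) : ℂ[X] :=
  X ^ d + ∑ i : Fin (d - 1), C (p.1 i) * X ^ ((i : ℕ) + 1) - C p.2

/-- The eigenvalue locus. -/
def Sg (d : ℕ) : Set ((Fin (d - 1) → ℂ) × ℂ) := {p | Bd (PolP d p)}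

theorem PolP_eval (d : ℕ) (p : (Fin (d - 1) → ℂ) × ℂ) (z : ℂ) :
    (PolP d p).eval z = Pol d p.1 z - p.2 := by
  simp [PolP, Pol, eval_finsetSum]

theorem Sg_eq (d : ℕ) : Sg d = {p : (Fin (d - 1) → ℂ) × ℂ | ∃ y : ℂ → ℂ, y ≠ 0 ∧
    IsSol d p.1 p.2 y ∧ Tendsto (fun x : ℝ => y (x : ℂ)) atTop (𝓝 0) ∧
    Tendsto (fun x : ℝ => y (x : ℂ)) atBot (𝓝 0)} := by
  ext p
  constructor
  · rintro ⟨y, v, h, hne, h1, h2⟩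
    have e : deriv y = v := _root_.funext fun z => (h z).1.deriv
    refine ⟨y, hne, ⟨fun z => (h z).1.differentiableAt, fun z => ?_⟩, h1, h2⟩
    rw [e, (h z).2.deriv, PolP_eval]
  · rintro ⟨y, hne, ⟨hd, h⟩, h1, h2⟩
    refine ⟨y, deriv y, fun z => ⟨(hd z).hasDerivAt, ?_⟩, hne, h1, h2⟩
    rw [PolP_eval, ← h]
    exact ((hd.differentiableOn (s := Set.univ)).deriv isOpen_univ |>.differentiableAt
      univ_mem).hasDerivAt

theorem PolP_natDegree_le {d : ℕ} (hd : 1 ≤ d) (p : (Fin (d - 1) → ℂ) × ℂ) :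
    (PolP d p).natDegree ≤ d := by
  unfold PolP
  refine (natDegree_sub_le _ _).trans (max_le ((natDegree_add_le _ _).trans (max_le ?_ ?_)) ?_)
  · simp
  · refine natDegree_sum_le_of_forall_le _ _ fun i _ => ?_
    refine (natDegree_C_mul_X_pow_le _ _).trans ?_
    have := i.2
    omega
  · simp

theorem PolP_coeff (d : ℕ) (p : (Fin (d - 1) → ℂ) × ℂ) (j : ℕ) : (PolP d p).coeff j =
    (if j = d then 1 else 0) + (∑ i : Fin (d - 1), p.1 i * (if j = (i : ℕ) + 1 then 1 else 0))
      - (if j = 0 then p.2 else 0) := by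
  simp [PolP, coeff_X_pow, coeff_C, Polynomial.finsetSum_coeff]

theorem PolP_coeff_top {d : ℕ} (hd : 1 ≤ d) (p : (Fin (d - 1) → ℂ) × ℂ) :
    (PolP d p).coeff d = 1 := by
  rw [PolP_coeff, if_pos rfl, if_neg (by omega), Finset.sum_eq_zero]
  · simp
  · intro i _
    have := i.2
    rw [if_neg (by omega), mul_zero]

theorem PolP_tend {ι : Type*} {l : Filter ι} {d : ℕ} (hd : 1 ≤ d)
    {p : ι → (Fin (d - 1) → ℂ) × ℂ} {p0 : (Fin (d - 1) → ℂ) × ℂ} (h : Tendsto p l (𝓝 p0)) :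
    PTend l (fun t => PolP d (p t)) (PolP d p0) := by
  refine ⟨⟨d, Eventually.of_forall fun t => PolP_natDegree_le hd _⟩, fun j => ?_⟩
  simp only [PolP_coeff]
  have hc : Continuous fun p : (Fin (d - 1) → ℂ) × ℂ => (if j = d then (1 : ℂ) else 0) +
      (∑ i : Fin (d - 1), p.1 i * (if j = (i : ℕ) + 1 then 1 else 0))
      - (if j = 0 then p.2 else 0) := by
    split_ifs <;> fun_prop
  exact (hc.tendsto p0).comp h

theorem PolP_hol {Ω : Set ℂ} {d : ℕ} (hd : 1 ≤ d) {p : ℂ → (Fin (d - 1) → ℂ) × ℂ}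
    (h : DifferentiableOn ℂ p Ω) : PHol Ω (fun w => PolP d (p w)) := by
  refine ⟨⟨d, fun w _ => PolP_natDegree_le hd _⟩, fun j => ?_⟩
  simp only [PolP_coeff]
  have hc : Differentiable ℂ fun p : (Fin (d - 1) → ℂ) × ℂ => (if j = d then (1 : ℂ) else 0) +
      (∑ i : Fin (d - 1), p.1 i * (if j = (i : ℕ) + 1 then 1 else 0))
      - (if j = 0 then p.2 else 0) := by
    split_ifs <;> fun_prop
  exact hc.comp_differentiableOn h

theorem PolP_lower {d : ℕ} (hd : 2 ≤ d) (hev : Even d) (M : ℝ) : ∃ K : ℝ, 0 ≤ K ∧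
    ∀ p : (Fin (d - 1) → ℂ) × ℂ, ‖p.1‖ ≤ M → ∀ x : ℝ,
      |x| - K - p.2.re ≤ ((PolP d p).eval (x : ℂ)).re := by
  set B := d * |M| with hB
  have hB0 : 0 ≤ B := by positivity
  have hR1 : 1 ≤ (1 + B) ^ d := one_le_pow₀ (by linarith)
  refine ⟨B + (1 + B) * (1 + B) ^ d, by positivity, fun p hp x => ?_⟩
  rw [PolP_eval, Pol]
  simp only [sub_re, add_re]
  have e1 : ((x : ℂ) ^ d).re = |x| ^ d := by
    rw [← ofReal_pow, ofReal_re, Even.pow_abs hev]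
  have hsum : ‖∑ i : Fin (d - 1), p.1 i * (x : ℂ) ^ ((i : ℕ) + 1)‖ ≤
      B * (max 1 |x|) ^ (d - 1) := by
    have h1 : ∀ i ∈ (Finset.univ : Finset (Fin (d - 1))),
        ‖p.1 i * (x : ℂ) ^ ((i : ℕ) + 1)‖ ≤ |M| * (max 1 |x|) ^ (d - 1) := by
      intro i _
      rw [norm_mul, norm_pow, norm_real, Real.norm_eq_abs]
      have h2 : ‖p.1 i‖ ≤ |M| := (norm_le_pi_norm _ _).trans (hp.trans (le_abs_self _))
      have h3 : |x| ^ ((i : ℕ) + 1) ≤ (max 1 |x|) ^ (d - 1) :=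
        (pow_le_pow_left₀ (abs_nonneg _) (le_max_right _ _) _).trans
          (pow_le_pow_right₀ (le_max_left _ _) (by have := i.2; omega))
      exact mul_le_mul h2 h3 (by positivity) (abs_nonneg _)
    refine (norm_sum_le _ _).trans ((Finset.sum_le_sum h1).trans ?_)
    rw [Finset.sum_const, Finset.card_univ, Fintype.card_fin, nsmul_eq_mul, ← mul_assoc, hB]
    have : ((d - 1 : ℕ) : ℝ) ≤ d := by exact_mod_cast Nat.sub_le _ _
    gcongr
  have hre := (abs_le.1 ((abs_re_le_norm _).trans hsum)).1
  rw [e1]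
  suffices |x| - (B + (1 + B) * (1 + B) ^ d) ≤ |x| ^ d - B * (max 1 |x|) ^ (d - 1) by linarith
  generalize |x| = u at *
  have hpd : (1 + B) ^ d = (1 + B) ^ (d - 1) * (1 + B) := by
    rw [← pow_succ]; congr 1; omega
  by_cases hu : u ≤ 1 + B
  · have hm : (max 1 u) ^ (d - 1) ≤ (1 + B) ^ d :=
      (pow_le_pow_left₀ (by positivity) (max_le (by linarith) hu) _).trans
        (pow_le_pow_right₀ (by linarith) (by omega))
    have h4 : B * (max 1 u) ^ (d - 1) ≤ B * (1 + B) ^ d := by gcongr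
    have h5 : 0 ≤ u ^ d ∨ u < 0 := by
      by_cases h : 0 ≤ u
      · left; positivity
      · right; linarith
    have h6 : 0 ≤ u ^ d := hev.pow_nonneg u
    nlinarith
  · have hu : 1 + B < u := not_le.1 hu
    have h1 : 1 ≤ u ^ (d - 1) := one_le_pow₀ (by linarith)
    have h2 : u ^ d = u ^ (d - 1) * u := by rw [← pow_succ]; congr 1; omega
    rw [max_eq_right (by linarith), h2]
    nlinarith [mul_nonneg (sub_nonneg.2 h1) (by linarith : 0 ≤ u - B)]

theorem PolP_coer {d : ℕ} (hd : 2 ≤ d) (hev : Even d) (p : (Fin (d - 1) → ℂ) × ℂ) :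
    Coer2 (PolP d p) := by
  obtain ⟨K, _, hK⟩ := PolP_lower hd hev ‖p.1‖
  constructor
  · refine tendsto_atTop_mono (fun x => (sub_le_sub_right (sub_le_sub_right (le_abs_self x) _)
      _).trans (hK p le_rfl x)) ?_
    simpa only [sub_eq_add_neg, add_assoc, id] using tendsto_atTop_add_const_right _ _ tendsto_id
  · unfold Coer
    simp only [aff_eval]
    have : ∀ x : ℝ, x - K - p.2.re ≤ ((PolP d p).eval (-1 * (x : ℂ) + 0)).re := fun x => by
      have := hK p le_rfl (-x)
      rw [abs_neg] at this
      have h2 := le_abs_self x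
      have e : -1 * (x : ℂ) + 0 = ((-x : ℝ) : ℂ) := by push_cast; ring
      rw [e]
      linarith
    refine tendsto_atTop_mono this ?_
    simpa only [sub_eq_add_neg, add_assoc, id] using tendsto_atTop_add_const_right _ _ tendsto_id

/-- A bounded region of parameters. -/
def Bx (d : ℕ) (M : ℝ) : Set ((Fin (d - 1) → ℂ) × ℂ) := {p | ‖p.1‖ < M ∧ p.2.re < M}

theorem Bx_open (d : ℕ) (M : ℝ) : IsOpen (Bx d M) :=
  (isOpen_lt (continuous_norm.comp continuous_fst) continuous_const).inter
    (isOpen_lt (continuous_re.comp continuous_snd) continuous_const)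

theorem mem_Bx {d : ℕ} (p : (Fin (d - 1) → ℂ) × ℂ) : ∃ M, p ∈ Bx d M :=
  ⟨max ‖p.1‖ p.2.re + 1, lt_of_le_of_lt (le_max_left _ _) (lt_add_one _),
    lt_of_le_of_lt (le_max_right _ _) (lt_add_one _)⟩

theorem exists_Bx_adm {d : ℕ} (hd : 2 ≤ d) (hev : Even d) (M : ℝ) :
    ∃ r : ℝ, 0 ≤ r ∧ ∀ p ∈ Bx d M, AdmR r (PolP d p) := by
  obtain ⟨K, hK0, hK⟩ := PolP_lower hd hev M
  refine ⟨max 0 (K + M + 1), le_max_left _ _, fun p hp x hx => ?_⟩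
  have h1 := hK p hp.1.le x
  have h2 := hp.2
  have h3 := (le_max_right 0 (K + M + 1)).trans hx
  linarith

theorem exists_re_bound {d : ℕ} (hd : 2 ≤ d) (hev : Even d) (M : ℝ) :
    ∃ K : ℝ, 0 ≤ K ∧ ∀ p ∈ Sg d, ‖p.1‖ ≤ M → -K ≤ p.2.re := by
  obtain ⟨K, hK0, hK⟩ := PolP_lower hd hev M
  refine ⟨K, hK0, fun p hp hpM => ?_⟩
  by_contra! hlt
  obtain ⟨Y, V, h⟩ := Bd.exists_EF (PolP_coer hd hev p) hp
  refine h.not_re_pos fun x => ?_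
  have := hK p hpM x
  have := abs_nonneg x
  linarith

/-- Defining function of the eigenvalue locus on a region where `r` is admissible. -/
theorem mem_Sg_iff {d : ℕ} {r : ℝ} (hr : 0 ≤ r) {p : (Fin (d - 1) → ℂ) × ℂ}
    (h : AdmR r (PolP d p)) : p ∈ Sg d ↔ FF r (PolP d p) = 0 := Bd_iff hr h

theorem FP_continuousAt {d : ℕ} (hd : 2 ≤ d) {M r : ℝ} (hr : 0 ≤ r)
    (ha : ∀ p ∈ Bx d M, AdmR r (PolP d p)) {p : (Fin (d - 1) → ℂ) × ℂ} (hp : p ∈ Bx d M) :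
    ContinuousAt (fun p => FF r (PolP d p)) p :=
  FF_tendsto hr (PolP_tend (by omega) tendsto_id) (ha p hp)
    (((Bx_open d M).eventually_mem hp).mono fun q hq => ha q hq)

theorem FP_hol {d : ℕ} (hd : 2 ≤ d) {M r : ℝ} (hr : 0 ≤ r)
    (ha : ∀ p ∈ Bx d M, AdmR r (PolP d p)) {Ω : Set ℂ} (hΩ : IsOpen Ω)
    {p : ℂ → (Fin (d - 1) → ℂ) × ℂ} (h : DifferentiableOn ℂ p Ω) (hm : ∀ w ∈ Ω, p w ∈ Bx d M) :
    DifferentiableOn ℂ (fun w => FF r (PolP d (p w))) Ω :=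
  FF_hol hΩ (PolP_hol (by omega) h) hr fun w hw => ha _ (hm w hw)

theorem Sg_closed {d : ℕ} (hd : 2 ≤ d) (hev : Even d) : IsClosed (Sg d) := by
  rw [← isOpen_compl_iff, isOpen_iff_mem_nhds]
  intro p hp
  obtain ⟨M, hM⟩ := mem_Bx p
  obtain ⟨r, hr, ha⟩ := exists_Bx_adm hd hev M
  have h1 : FF r (PolP d p) ≠ 0 := fun h => hp ((mem_Sg_iff hr (ha p hM)).2 h)
  filter_upwards [(FP_continuousAt hd hr ha hM).eventually_ne h1, (Bx_open d M).mem_nhds hM]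
    with q hq hqM hqS
  exact hq ((mem_Sg_iff hr (ha q hqM)).1 hqS)

theorem PolP_dir {d k : ℕ} (hk : k < d) : ∃ v : (Fin (d - 1) → ℂ) × ℂ, ∀ p (τ : ℂ),
    PolP d (p + τ • v) = PolP d p + C τ * X ^ k := by
  rcases k with _ | k
  · refine ⟨(0, -1), fun p τ => ?_⟩
    simp [PolP]
    ring
  · refine ⟨(Pi.single ⟨k, by omega⟩ 1, 0), fun p τ => ?_⟩
    simp only [PolP, Prod.fst_add, Prod.snd_add, Prod.smul_fst, Prod.smul_snd, smul_zero,
      add_zero, Pi.add_apply, Pi.smul_apply, C_add, add_mul, Finset.sum_add_distrib]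
    rw [Finset.sum_eq_single (⟨k, by omega⟩ : Fin (d - 1)) (f := fun x : Fin (d - 1) =>
      C (τ • (Pi.single (⟨k, by omega⟩ : Fin (d - 1)) (1 : ℂ) : Fin (d - 1) → ℂ) x)
        * X ^ ((x : ℕ) + 1))]
    · simp
      ring
    · intro b _ hb
      simp [Pi.single_eq_of_ne hb]
    · simp

theorem FP_exists_dir {d : ℕ} (hd : 2 ≤ d) (hev : Even d) {M r : ℝ} (hr : 0 ≤ r)
    (ha : ∀ p ∈ Bx d M, AdmR r (PolP d p)) {p : (Fin (d - 1) → ℂ) × ℂ} (hp : p ∈ Bx d M)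
    (h0 : FF r (PolP d p) = 0) : ∃ v : (Fin (d - 1) → ℂ) × ℂ,
      deriv (fun τ : ℂ => FF r (PolP d (p + τ • v))) 0 ≠ 0 := by
  obtain ⟨κ, hκ, Y, V, hS, hne, hY, hY', hder⟩ := FF_deriv hr h0 (ha p hp) (PolP_coer hd hev p)
  by_contra! hall
  refine hne (eq_zero_of_low_moments (by omega) (PolP_natDegree_le (by omega) p)
    (PolP_coeff_top (by omega) p) hS hY hY' fun k hk => ?_)
  obtain ⟨v, hv⟩ := PolP_dir hk
  have hcont : ContinuousAt (fun τ : ℂ => p + τ • v) 0 := by fun_prop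
  have hnb : ∀ᶠ τ in 𝓝 (0 : ℂ), p + τ • v ∈ Bx d M :=
    hcont.eventually_mem ((Bx_open d M).mem_nhds (by simpa using hp))
  obtain ⟨ρ, hρ, hb⟩ := Metric.eventually_nhds_iff_ball.1 hnb
  have := hder (X ^ k) ρ hρ (fun τ hτ => hv p τ ▸ ha _ (hb τ hτ))
    (fun τ _ => hv p τ ▸ PolP_coer hd hev _)
  have h2 := hall v
  simp only [hv] at h2
  rw [this.deriv] at h2
  simpa using (mul_eq_zero.1 h2).resolve_left hκ

theorem FP_not_eventually_zero {d : ℕ} (hd : 2 ≤ d) (hev : Even d) {M r : ℝ} (hr : 0 ≤ r)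
    (ha : ∀ p ∈ Bx d M, AdmR r (PolP d p)) {α : Fin (d - 1) → ℂ} {lam : ℂ}
    (hp : (α, lam) ∈ Bx d M) : ¬ ∀ᶠ z in 𝓝 lam, FF r (PolP d (α, z)) = 0 := by
  intro h
  set U : Set ℂ := {z | z.re < M} with hU
  have hUo : IsOpen U := isOpen_lt continuous_re continuous_const
  have hmem : ∀ z ∈ U, (α, z) ∈ Bx d M := fun z hz => ⟨hp.1, hz⟩
  have hdiff : DifferentiableOn ℂ (fun z => FF r (PolP d (α, z))) U :=
    FP_hol hd hr ha hUo (by fun_prop) hmem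
  have hz := (hdiff.analyticOnNhd hUo).eqOn_zero_of_preconnected_of_eventuallyEq_zero
    (convex_halfSpace_re_lt M).isPreconnected (z₀ := lam) hp.2 h
  obtain ⟨K, hK, hb⟩ := exists_re_bound hd hev ‖α‖
  have hm : ((min (-K) M - 1 : ℝ) : ℂ) ∈ U := by
    change (((min (-K) M - 1 : ℝ) : ℂ)).re < M
    rw [ofReal_re]
    have := min_le_right (-K) M
    linarith
  have h1 := hb (α, ((min (-K) M - 1 : ℝ) : ℂ)) ((mem_Sg_iff hr (ha _ (hmem _ hm))).2 (hz hm))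
    le_rfl
  rw [ofReal_re] at h1
  have := min_le_left (-K) M
  linarith

/-- `A` is relatively clopen in the eigenvalue locus. -/
def LC (d : ℕ) (A : Set ((Fin (d - 1) → ℂ) × ℂ)) : Prop :=
  ∀ p ∈ Sg d, ∀ᶠ q in 𝓝 p, q ∈ Sg d → (q ∈ A ↔ p ∈ A)

theorem LC.compl {d : ℕ} {A : Set ((Fin (d - 1) → ℂ) × ℂ)} (h : LC d A) : LC d Aᶜ :=
  fun p hp => (h p hp).mono fun _ hq hqS => not_congr (hq hqS)

theorem LC.mem_of_tendsto {d : ℕ} (hd : 2 ≤ d) (hev : Even d) {A : Set ((Fin (d - 1) → ℂ) × ℂ)}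
    (h : LC d A) {ι : Type*} {l : Filter ι} [l.NeBot] {p : ι → (Fin (d - 1) → ℂ) × ℂ}
    {p0 : (Fin (d - 1) → ℂ) × ℂ} (ht : Tendsto p l (𝓝 p0))
    (hp : ∃ᶠ t in l, p t ∈ Sg d ∩ A) : p0 ∈ Sg d ∩ A := by
  have h1 : p0 ∈ Sg d := (Sg_closed hd hev).mem_of_frequently_of_tendsto
    (hp.mono fun _ h => h.1) ht
  obtain ⟨t, ht1, ht2⟩ := (hp.and_eventually (ht.eventually (h p0 h1))).exists
  exact ⟨h1, (ht2 ht1.1).1 ht1.2⟩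

theorem LC.closed {d : ℕ} (hd : 2 ≤ d) (hev : Even d) {A : Set ((Fin (d - 1) → ℂ) × ℂ)}
    (h : LC d A) : IsClosed (Sg d ∩ A) :=
  isClosed_iff_frequently.2 fun _ hx => h.mem_of_tendsto hd hev tendsto_id hx

theorem LC.persist {d : ℕ} (hd : 2 ≤ d) (hev : Even d) {A : Set ((Fin (d - 1) → ℂ) × ℂ)}
    (h : LC d A) {α : Fin (d - 1) → ℂ} {lam : ℂ} (hp : (α, lam) ∈ Sg d ∩ A) {ρ : ℝ}
    (hρ : 0 < ρ) : ∀ᶠ α' in 𝓝 α, ∃ lam' ∈ Metric.ball lam ρ, (α', lam') ∈ Sg d ∩ A := by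
  obtain ⟨M, hM⟩ := mem_Bx (α, lam)
  obtain ⟨r, hr, ha⟩ := exists_Bx_adm hd hev M
  have hlc := h _ hp.1
  rw [nhds_prod_eq] at hlc
  obtain ⟨S, hS, T, hT, hST⟩ := eventually_prod_iff.1 hlc
  obtain ⟨ρ', hρ', hT'⟩ := Metric.eventually_nhds_iff_ball.1 hT
  set U : Set ℂ := {z | z.re < M} with hU
  have hUo : IsOpen U := isOpen_lt continuous_re continuous_const
  have hαM : ∀ᶠ α' in 𝓝 α, ‖α'‖ < M := (continuous_norm.tendsto α).eventually (gt_mem_nhds hM.1)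
  have hct : CTend (𝓝 α) (fun α' z => FF r (PolP d (α', z)))
      (fun z => FF r (PolP d (α, z))) U := fun z hz => by
    rw [← nhds_prod_eq]
    exact FP_continuousAt hd hr ha (p := (α, z)) ⟨hM.1, hz⟩
  have hx := hct.exists_zero hUo (FP_hol hd hr ha hUo (by fun_prop) fun z hz => ⟨hM.1, hz⟩)
    (hαM.mono fun α' hα' => FP_hol hd hr ha hUo (by fun_prop) fun z hz => ⟨hα', hz⟩) hM.2
    ((mem_Sg_iff hr (ha _ hM)).1 hp.1) (FP_not_eventually_zero hd hev hr ha hM)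
    (lt_min (lt_min hρ hρ') (by have := hM.2; linarith : 0 < M - lam.re))
  filter_upwards [hx, hS, hαM] with α' ⟨z, hz, hz0⟩ hα' hα'M
  rw [Metric.mem_ball, lt_min_iff, lt_min_iff] at hz
  have hzM : z.re < M := by
    have h1 := (abs_re_le_norm (z - lam)).trans_lt (dist_eq_norm z lam ▸ hz.2)
    rw [sub_re] at h1
    have := (abs_lt.1 h1).2
    linarith
  have hzS : (α', z) ∈ Sg d := (mem_Sg_iff hr (ha _ ⟨hα'M, hzM⟩)).2 hz0
  exact ⟨z, hz.1.1, hzS, (hST hα' (hT' z hz.1.2) hzS).2 hp.2⟩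

theorem exists_implicit_root {W : Type*} [TopologicalSpace W] {f : W → ℂ → ℂ} {w0 : W}
    {N : Set W} (hN : IsOpen N) (hw0 : w0 ∈ N) {ρ : ℝ} (hρ : 0 < ρ)
    (hc : ∀ w ∈ N, ∀ z ∈ Metric.ball (0 : ℂ) ρ, ContinuousAt (fun p : W × ℂ => f p.1 p.2) (w, z))
    (hd : ∀ w ∈ N, DifferentiableOn ℂ (f w) (Metric.ball 0 ρ)) (h0 : f w0 0 = 0)
    (hder : deriv (f w0) 0 ≠ 0) : ∃ N' ∈ 𝓝 w0, N' ⊆ N ∧ ∃ τ : W → ℂ, ∀ w ∈ N',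
      ContinuousAt τ w ∧ f w (τ w) = 0 ∧ τ w ∈ Metric.ball 0 ρ ∧ (f w 0 = 0 → τ w = 0) := by
  have hct : ∀ w ∈ N, CTend (𝓝 w) f (f w) (Metric.ball 0 ρ) := fun w hw z hz => by
    rw [← nhds_prod_eq]; exact hc w hw z hz
  have hdiff : ∀ w ∈ N, ∀ᶠ w' in 𝓝 w, DifferentiableOn ℂ (f w') (Metric.ball 0 ρ) := fun w hw =>
    (hN.eventually_mem hw).mono fun w' hw' => hd w' hw'
  have h00 := Metric.mem_ball_self (x := (0 : ℂ)) hρ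
  obtain ⟨r, hr, hrρ, hinj⟩ := (hct w0 hw0).exists_injOn Metric.isOpen_ball (hd w0 hw0)
    (hdiff w0 hw0) h00 hder
  have hz := (hct w0 hw0).exists_zero Metric.isOpen_ball (hd w0 hw0) (hdiff w0 hw0) h00 h0
    (not_eventually_zero_of_deriv_ne hder) hr
  have hall : ∀ᶠ w in 𝓝 w0, w ∈ N ∧ Set.InjOn (f w) (Metric.ball 0 r) ∧
      ∃ z ∈ Metric.ball (0 : ℂ) r, f w z = 0 := (hN.eventually_mem hw0).and (hinj.and hz)
  obtain ⟨N', hN', hN'o, hw0'⟩ := eventually_nhds_iff.1 hall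
  choose! τ hτ hτ0 using fun w hw => (hN' w hw).2.2
  refine ⟨N', hN'o.mem_nhds hw0', fun w hw => (hN' w hw).1, τ, fun w hw => ⟨?_, hτ0 w hw,
    hrρ (hτ w hw), fun h => (hN' w hw).2.1 (hτ w hw) (Metric.mem_ball_self hr)
      ((hτ0 w hw).trans h.symm)⟩⟩
  have hwN := (hN' w hw).1
  rw [Metric.continuousAt_iff']
  intro s hs
  obtain ⟨s', hs', hss'⟩ := Metric.isOpen_iff.1 Metric.isOpen_ball _ (hτ w hw)
  have hne : ¬ ∀ᶠ z in 𝓝 (τ w), f w z = 0 := by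
    intro hev
    have h2 : ∀ᶠ z in 𝓝 (τ w), z = τ w := by
      filter_upwards [hev, Metric.isOpen_ball.mem_nhds (hτ w hw)] with z hz hzb
      exact (hN' w hw).2.1 hzb (hτ w hw) (hz.trans (hτ0 w hw).symm)
    obtain ⟨z, hz, hz'⟩ := ((eventually_nhdsWithin_of_eventually_nhds (s := {τ w}ᶜ) h2).and
      self_mem_nhdsWithin).exists
    exact hz' hz
  have h3 := (hct w hwN).exists_zero Metric.isOpen_ball (hd w hwN) (hdiff w hwN) (hrρ (hτ w hw))
    (hτ0 w hw) hne (lt_min hs hs')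
  filter_upwards [h3, hN'o.mem_nhds hw] with w' ⟨z, hz, hz0⟩ hw'
  rw [Metric.mem_ball, lt_min_iff] at hz
  have := (hN' w' hw').2.1 (hss' hz.2) (hτ w' hw') (hz0.trans (hτ0 w' hw').symm)
  exact this ▸ hz.1

set_option maxHeartbeats 400000 in
theorem Sg_locally_joined {d : ℕ} (hd : 2 ≤ d) (hev : Even d) {p0 : (Fin (d - 1) → ℂ) × ℂ}
    (h0 : p0 ∈ Sg d) : ∀ᶠ p in 𝓝 p0, p ∈ Sg d → JoinedIn (Sg d) p0 p := by
  obtain ⟨M, hM⟩ := mem_Bx p0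
  obtain ⟨r, hr, ha⟩ := exists_Bx_adm hd hev M
  have hF0 := (mem_Sg_iff hr (ha _ hM)).1 h0
  obtain ⟨v, hv⟩ := FP_exists_dir hd hev hr ha hM hF0
  have hcont : Continuous fun x : ((Fin (d - 1) → ℂ) × ℂ) × ℂ => x.1 + x.2 • v := by fun_prop
  have hev1 : ∀ᶠ x in 𝓝 p0 ×ˢ 𝓝 (0 : ℂ), x.1 + x.2 • v ∈ Bx d M := by
    rw [← nhds_prod_eq]
    exact hcont.continuousAt.eventually_mem ((Bx_open d M).mem_nhds (by simpa using hM))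
  obtain ⟨S, hS, T, hT, hST⟩ := eventually_prod_iff.1 hev1
  obtain ⟨N, hN, hNo, hN0⟩ := eventually_nhds_iff.1 hS
  obtain ⟨ρ, hρ, hρT⟩ := Metric.eventually_nhds_iff_ball.1 hT
  have hmem : ∀ w ∈ N, ∀ z ∈ Metric.ball (0 : ℂ) ρ, w + z • v ∈ Bx d M := fun w hw z hz =>
    hST (hN w hw) (hρT z hz)
  obtain ⟨g, hg⟩ : ∃ g : (Fin (d - 1) → ℂ) × ℂ → ℂ, g = fun p => FF r (PolP d p) := ⟨_, rfl⟩
  have hgc : ∀ w ∈ N, ∀ z ∈ Metric.ball (0 : ℂ) ρ,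
      ContinuousAt (fun x : ((Fin (d - 1) → ℂ) × ℂ) × ℂ => g (x.1 + x.2 • v)) (w, z) := by
    intro w hw z hz
    have h1 : Tendsto g (𝓝 (w + z • v)) (𝓝 (g (w + z • v))) :=
      hg ▸ FP_continuousAt hd hr ha (hmem w hw z hz)
    exact h1.comp (hcont.tendsto (w, z))
  have hgd : ∀ w ∈ N, DifferentiableOn ℂ (fun z : ℂ => g (w + z • v)) (Metric.ball 0 ρ) :=
    fun w hw => hg ▸ FP_hol hd hr ha Metric.isOpen_ball (by fun_prop) (hmem w hw)
  have hg0 : g (p0 + (0 : ℂ) • v) = 0 := by rw [zero_smul, add_zero, hg]; exact hF0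
  have hgv : deriv (fun z : ℂ => g (p0 + z • v)) 0 ≠ 0 := hg ▸ hv
  obtain ⟨N', hN', hN'N, τ, hτ⟩ := exists_implicit_root (f := fun w z => g (w + z • v))
    hNo hN0 hρ hgc hgd hg0 hgv
  subst hg
  obtain ⟨s, hs, hsN⟩ := Metric.mem_nhds_iff.1 hN'
  filter_upwards [Metric.ball_mem_nhds p0 hs] with p hp hpS
  have hw : ∀ t ∈ Set.Icc (0 : ℝ) 1, p0 + t • (p - p0) ∈ N' := fun t ht => by
    refine hsN ?_
    rw [Metric.mem_ball, dist_eq_norm, add_sub_cancel_left, norm_smul, Real.norm_eq_abs,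
      abs_of_nonneg ht.1]
    rw [Metric.mem_ball, dist_eq_norm] at hp
    nlinarith [ht.2, norm_nonneg (p - p0)]
  have e0 : p0 + (0 : ℝ) • (p - p0) = p0 := by simp
  have e1 : p0 + (1 : ℝ) • (p - p0) = p := by simp
  have hz : ∀ w ∈ N', w ∈ Sg d → τ w = 0 := fun w hw hwS => (hτ w hw).2.2.2 (by
    have hb : w ∈ Bx d M := by simpa using hmem w (hN'N hw) 0 (Metric.mem_ball_self hρ)
    simpa using (mem_Sg_iff hr (ha w hb)).1 hwS)
  have hp' : p ∈ N' := e1 ▸ hw 1 (by simp)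
  have hp0' : p0 ∈ N' := e0 ▸ hw 0 (by simp)
  refine JoinedIn.ofLine (f := fun t : ℝ => (p0 + t • (p - p0)) + τ (p0 + t • (p - p0)) • v)
    (fun t ht => ContinuousAt.continuousWithinAt ?_) ?_ ?_ ?_
  · have h1 : ContinuousAt (fun t : ℝ => p0 + t • (p - p0)) t := by fun_prop
    have h2 := ContinuousAt.comp (f := fun t : ℝ => p0 + t • (p - p0)) (hτ _ (hw t ht)).1 h1
    exact h1.add (h2.smul continuousAt_const)
  · simp only [e0, hz p0 hp0' h0]; simp
  · simp only [e1, hz p hp' hpS]; simp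
  · rintro _ ⟨t, ht, rfl⟩
    have h1 := hτ _ (hw t ht)
    exact (mem_Sg_iff hr (ha _ (hmem _ (hN'N (hw t ht)) _ h1.2.2.1))).2 h1.2.1

theorem LC_joined {d : ℕ} (hd : 2 ≤ d) (hev : Even d) (p : (Fin (d - 1) → ℂ) × ℂ) :
    LC d {q | JoinedIn (Sg d) p q} := fun p0 hp0 => by
  filter_upwards [Sg_locally_joined hd hev hp0] with q hq hqS
  exact ⟨fun h => h.trans (hq hqS).symm, fun h => h.trans (hq hqS)⟩

end Family

section RealPoint

/-- The lens-shaped region used to push eigenvalues to the real axis. -/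
def Lens : Set ℂ := {t | 0 ≤ t.im ∧ t.im ≤ 2 ∧ 0 ≤ (4 - t ^ 2 + 9 / 2 * I * t).re}

theorem lens_re (t : ℂ) :
    (4 - t ^ 2 + 9 / 2 * I * t).re = 4 - t.re ^ 2 + t.im ^ 2 - 9 / 2 * t.im := by
  simp [pow_two]
  ring

theorem Lens_compact : IsCompact Lens := by
  refine Metric.isCompact_of_isClosed_isBounded ?_ ?_
  · exact (isClosed_le continuous_const continuous_im).inter
      ((isClosed_le continuous_im continuous_const).inter
        (isClosed_le continuous_const (continuous_re.comp (by fun_prop))))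
  · refine (Metric.isBounded_closedBall (x := (0 : ℂ)) (r := 4)).subset fun t ht => ?_
    obtain ⟨h1, h2, h3⟩ := ht
    rw [lens_re] at h3
    rw [mem_closedBall_zero_iff]
    refine (Complex.norm_le_abs_re_add_abs_im t).trans ?_
    have h4 : |t.re| ≤ 2 := abs_le_of_sq_le_sq (by nlinarith) (by norm_num)
    have h5 : |t.im| ≤ 2 := abs_le.2 ⟨by linarith, h2⟩
    linarith

/-- Every relatively clopen piece of the eigenvalue locus contains a point with real `α`. -/
theorem exists_real_point {d : ℕ} (hd : 2 ≤ d) (hev : Even d)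
    {A : Set ((Fin (d - 1) → ℂ) × ℂ)} (hA : LC d A) {p0 : (Fin (d - 1) → ℂ) × ℂ}
    (hp0 : p0 ∈ Sg d ∩ A) : ∃ p ∈ Sg d ∩ A, ∀ i, (p.1 i).im = 0 := by
  obtain ⟨α, hα⟩ : ∃ α : ℂ → Fin (d - 1) → ℂ,
      α = fun t i => ((p0.1 i).re : ℂ) + t * ((p0.1 i).im : ℂ) := ⟨_, rfl⟩
  have hαd : Differentiable ℂ α := by
    rw [hα, differentiable_pi]
    intro i
    fun_prop
  have hαI : α I = p0.1 := by
    rw [hα]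
    ext i
    simp only
    rw [mul_comm]
    exact re_add_im _
  have hαr : ∀ t : ℂ, t.im = 0 → ∀ i, (α t i).im = 0 := fun t ht i => by
    rw [hα]
    simp [ht]
  by_contra! hno
  obtain ⟨M, hM⟩ := Lens_compact.exists_bound_of_continuousOn (f := α) hαd.continuous.continuousOn
  obtain ⟨K, hK0, hK⟩ := exists_re_bound hd hev M
  obtain ⟨c, hc⟩ : ∃ c : ℂ, c = ((-K - 1 : ℝ) : ℂ) := ⟨_, rfl⟩
  have hone : ∀ t ∈ Lens, ∀ lam, (α t, lam) ∈ Sg d → 1 ≤ ‖lam - c‖ := fun t ht lam h => by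
    have h1 := hK _ h (hM t ht)
    have h2 := re_le_norm (lam - c)
    rw [hc, sub_re, ofReal_re] at h2
    rw [hc]
    linarith
  set k : ℝ := 2 * ‖p0.2 - c‖ with hk
  obtain ⟨e, he⟩ : ∃ e : ℂ → ℂ, e = fun t => cexp (k * (4 - t ^ 2 + 9 / 2 * I * t)) := ⟨_, rfl⟩
  have hed : Differentiable ℂ e := by rw [he]; fun_prop
  have hen : ∀ t, ‖e t‖ = Real.exp (k * (4 - t ^ 2 + 9 / 2 * I * t).re) := fun t => by
    rw [he]
    simp only
    rw [norm_exp, re_ofReal_mul]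
  have he0 : ∀ t, e t ≠ 0 := fun t => by rw [he]; exact exp_ne_zero _
  have hΦc : Continuous fun x : ℂ × ℂ => (α x.1, c + x.2 * e x.1) := by
    have h1 := hαd.continuous
    have h2 := hed.continuous
    fun_prop
  set Z : Set (ℂ × ℂ) := {x | x.1 ∈ Lens ∧ (α x.1, c + x.2 * e x.1) ∈ Sg d ∩ A} with hZ
  have hZc : IsClosed Z := (Lens_compact.isClosed.preimage continuous_fst).inter
    ((hA.closed hd hev).preimage hΦc)
  set ζ0 : ℂ := (p0.2 - c) / e I with hζ0
  have hIL : I ∈ Lens := by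
    refine ⟨by simp, by simp, ?_⟩
    rw [lens_re]; norm_num
  have hζ0Z : (I, ζ0) ∈ Z := by
    refine ⟨hIL, ?_⟩
    simp only [hζ0]
    rw [div_mul_cancel₀ _ (he0 I), hαI, add_sub_cancel]
    exact hp0
  have hζ0n : ‖ζ0‖ < 1 := by
    rw [hζ0, norm_div, div_lt_one (norm_pos_iff.2 (he0 I)), hen, lens_re, hk]
    have := Real.add_one_le_exp (‖p0.2 - c‖)
    have e1 : 2 * ‖p0.2 - c‖ * (4 - I.re ^ 2 + I.im ^ 2 - 9 / 2 * I.im) = ‖p0.2 - c‖ := by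
      simp; ring
    rw [e1]
    linarith
  have hcomp : ∀ R : ℝ, IsCompact (Z ∩ {x | ‖x.2‖ ≤ R}) := fun R => by
    refine (Lens_compact.prod (isCompact_closedBall (0 : ℂ) R)).of_isClosed_subset
      (hZc.inter (isClosed_le (by fun_prop) continuous_const)) fun x hx => ⟨hx.1.1, ?_⟩
    rw [mem_closedBall_zero_iff]
    exact hx.2
  obtain ⟨x0, hx0, hmin⟩ := (hcomp ‖ζ0‖).exists_isMinOn ⟨(I, ζ0), hζ0Z, le_refl ‖ζ0‖⟩
    (f := fun x : ℂ × ℂ => ‖x.2‖) (by fun_prop)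
  obtain ⟨x1, hx1, hmax⟩ := (hcomp ‖x0.2‖).exists_isMaxOn ⟨x0, hx0.1, le_refl ‖x0.2‖⟩
    (f := fun x : ℂ × ℂ => x.1.re) (continuous_re.comp continuous_fst).continuousOn
  have hglob : ∀ x ∈ Z, ‖x0.2‖ ≤ ‖x.2‖ := fun x hx => by
    by_cases h : ‖x.2‖ ≤ ‖ζ0‖
    · exact hmin ⟨hx, h⟩
    · exact le_trans hx0.2 (not_le.1 h).le
  obtain ⟨t1, ζ1⟩ := x1
  obtain ⟨hx1Z, hx1n⟩ := hx1
  have hx1n : ‖ζ1‖ = ‖x0.2‖ := le_antisymm hx1n (hglob _ hx1Z)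
  have hζ1lt : ‖ζ1‖ < 1 := by rw [hx1n]; exact lt_of_le_of_lt hx0.2 hζ0n
  have h1le := hone t1 hx1Z.1 _ hx1Z.2.1
  rw [add_sub_cancel_left, norm_mul, hen] at h1le
  have hζ1 : 0 < ‖ζ1‖ := by
    rw [norm_pos_iff]
    rintro h
    rw [h, norm_zero, zero_mul] at h1le
    linarith
  have him : 0 < t1.im := lt_of_le_of_ne hx1Z.1.1 fun h => by
    obtain ⟨i, hi⟩ := hno _ hx1Z.2
    exact hi (hαr t1 h.symm i)
  have hre : 0 < (4 - t1 ^ 2 + 9 / 2 * I * t1).re := lt_of_le_of_ne hx1Z.1.2.2 fun h => by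
    rw [← h, mul_zero, Real.exp_zero, mul_one] at h1le
    linarith
  have him2 : t1.im < 2 := lt_of_le_of_ne hx1Z.1.2.1 fun h => by
    rw [lens_re, h] at hre
    nlinarith [sq_nonneg t1.re]
  have hLn : ∀ᶠ t in 𝓝 t1, t ∈ Lens := by
    have c1 : Continuous fun t : ℂ => (4 - t ^ 2 + 9 / 2 * I * t).re :=
      continuous_re.comp (by fun_prop)
    filter_upwards [continuous_im.continuousAt.eventually (lt_mem_nhds him),
      continuous_im.continuousAt.eventually (gt_mem_nhds him2),
      c1.continuousAt.eventually (lt_mem_nhds hre)] with t h1 h2 h3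
    exact ⟨h1.le, h2.le, h3.le⟩
  obtain ⟨M', hM'⟩ := mem_Bx (α t1, c + ζ1 * e t1)
  obtain ⟨r, hr, ha⟩ := exists_Bx_adm hd hev M'
  have hΨc : Continuous fun x : ℝ × ℂ => (α x.2, c + ((x.1 : ℂ) * ζ1) * e x.2) :=
    hΦc.comp (f := fun x : ℝ × ℂ => (x.2, (x.1 : ℂ) * ζ1)) (by fun_prop)
  have hΨ1 : ((α t1, c + (((1 : ℝ) : ℂ) * ζ1) * e t1) : (Fin (d - 1) → ℂ) × ℂ)
      = (α t1, c + ζ1 * e t1) := by simp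
  have hprod : ∀ᶠ x in 𝓝 (1 : ℝ) ×ˢ 𝓝 t1, x.2 ∈ Lens ∧
      (α x.2, c + ((x.1 : ℂ) * ζ1) * e x.2) ∈ Bx d M' ∧
      ((α x.2, c + ((x.1 : ℂ) * ζ1) * e x.2) ∈ Sg d →
        (α x.2, c + ((x.1 : ℂ) * ζ1) * e x.2) ∈ A) := by
    have hΨt := hΨc.tendsto (1, t1)
    simp only [hΨ1] at hΨt
    rw [nhds_prod_eq] at hΨt
    filter_upwards [tendsto_snd.eventually hLn, hΨt.eventually ((Bx_open d M').eventually_mem hM'),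
      hΨt.eventually (hA _ hx1Z.2.1)] with x h1 h2 h3
    exact ⟨h1, h2, fun h => (h3 h).2 hx1Z.2.2⟩
  obtain ⟨S, hS, T, hT, hST⟩ := eventually_prod_iff.1 hprod
  obtain ⟨s, hs, hsT⟩ := Metric.eventually_nhds_iff_ball.1 hT
  have hS1 := hS.self_of_nhds
  have hdiff : ∀ ρ : ℝ, S ρ → DifferentiableOn ℂ (fun t => FF r (PolP d
      (α t, c + ((ρ : ℂ) * ζ1) * e t))) (Metric.ball t1 s) := fun ρ hρ =>
    FP_hol hd hr ha Metric.isOpen_ball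
      (hαd.prodMk ((hed.const_mul _).const_add _)).differentiableOn
      fun w hw => (hST hρ (hsT w hw)).2.1
  have hct : CTend (𝓝 (1 : ℝ)) (fun ρ t => FF r (PolP d (α t, c + ((ρ : ℂ) * ζ1) * e t)))
      (fun t => FF r (PolP d (α t, c + (((1 : ℝ) : ℂ) * ζ1) * e t))) (Metric.ball t1 s) := by
    intro z hz
    rw [← nhds_prod_eq]
    have h1 := FP_continuousAt hd hr ha (hST hS1 (hsT z hz)).2.1
    exact Tendsto.comp h1 (hΨc.tendsto (1, z))
  have h00 : FF r (PolP d (α t1, c + (((1 : ℝ) : ℂ) * ζ1) * e t1)) = 0 := by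
    rw [hΨ1]
    exact (mem_Sg_iff hr (ha _ hM')).1 hx1Z.2.1
  have hroot : ∀ ρ : ℝ, S ρ → ∀ t ∈ Metric.ball t1 s,
      FF r (PolP d (α t, c + ((ρ : ℂ) * ζ1) * e t)) = 0 → (t, (ρ : ℂ) * ζ1) ∈ Z := by
    intro ρ hρ t ht h0
    obtain ⟨g1, g2, g3⟩ := hST hρ (hsT t ht)
    have := (mem_Sg_iff hr (ha _ g2)).2 h0
    exact ⟨g1, this, g3 this⟩
  by_cases hz : ∀ᶠ t in 𝓝 t1, FF r (PolP d (α t, c + (((1 : ℝ) : ℂ) * ζ1) * e t)) = 0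
  · have hline : Tendsto (fun ε : ℝ => t1 + (ε : ℂ)) (𝓝[>] 0) (𝓝 t1) := by
      have : Continuous fun ε : ℝ => t1 + (ε : ℂ) := by fun_prop
      have h2 := this.tendsto 0
      rw [ofReal_zero, add_zero] at h2
      exact h2.mono_left nhdsWithin_le_nhds
    obtain ⟨ε, ⟨h1, h2⟩, h3⟩ := ((hline.eventually (hz.and
      (Metric.isOpen_ball.eventually_mem (Metric.mem_ball_self hs)))).and
      self_mem_nhdsWithin).exists
    have h4 := hroot 1 hS1 _ h2 h1
    have h5 : (t1 + (ε : ℂ)).re ≤ t1.re := hmax (a := (t1 + (ε : ℂ), ((1 : ℝ) : ℂ) * ζ1))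
      ⟨h4, by simp [hx1n]⟩
    have h6 : 0 < ε := h3
    rw [add_re, ofReal_re] at h5
    linarith
  · have h1 := hct.exists_zero Metric.isOpen_ball (hdiff 1 hS1) (hS.mono hdiff)
      (Metric.mem_ball_self hs) h00 hz hs
    obtain ⟨ρ, ⟨⟨t, ht, ht0⟩, hρS, hρ0⟩, hρ1⟩ := (((h1.and (hS.and
      (lt_mem_nhds (zero_lt_one (α := ℝ))))).filter_mono
      (nhdsWithin_le_nhds (s := Set.Iio (1 : ℝ)))).and self_mem_nhdsWithin).exists
    have h2 := hglob _ (hroot ρ hρS t ht ht0)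
    have h3 : ρ < 1 := hρ1
    simp only [norm_mul, norm_real, Real.norm_eq_abs, abs_of_pos hρ0] at h2
    rw [← hx1n] at h2
    nlinarith

end RealPoint

section ZeroCount
open Polynomial ComplexConjugate

/-- `Y` has at least `n + 1` real zeros. -/
def Zs (n : ℕ) (Y : ℂ → ℂ) : Prop := ∃ f : Fin (n + 1) → ℝ, StrictMono f ∧ ∀ i, Y (f i) = 0

/-- Some eigenfunction of `q` has at most `n` real zeros. -/
def NZ (n : ℕ) (q : ℂ[X]) : Prop := ∃ Y V : ℂ → ℂ, IsS q Y V ∧ Y ≠ 0 ∧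
  Tendsto (fun x : ℝ => Y x) atTop (𝓝 0) ∧ ¬ Zs n Y

theorem Adm.yW_ne {q : ℂ[X]} (hq : Adm q) {t : ℝ} (ht : 0 ≤ t) : yW q t ≠ 0 := by
  intro h0
  have h1 : ∀ s : ℝ, t ≤ s → yW q s = 0 := fun s hs => by
    have := hq.yW_anti ht hs
    rw [h0, map_zero] at this
    exact normSq_eq_zero.1 (le_antisymm this (normSq_nonneg _))
  have h2 : vW q ((t + 1 : ℝ) : ℂ) = 0 := by
    have h3 := ((yW_isS q).hasDerivAt_real (t + 1)).1
    have h4 : (fun x : ℝ => yW q x) =ᶠ[𝓝 (t + 1)] fun _ => 0 := by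
      filter_upwards [lt_mem_nhds (lt_add_one t)] with s hs
      exact h1 s hs.le
    exact (h4.hasDerivAt_iff.1 h3).unique (hasDerivAt_const _ _)
  refine yW_ne_zero q ?_
  ext z
  exact ((yW_isS q).eq_zero (h1 _ (by linarith)) h2 z).1

theorem Adm.yW_conj {q : ℂ[X]} (hq : Adm q) (hr : RealPoly q) (z : ℂ) :
    conj (yW q (conj z)) = yW q z ∧ conj (vW q (conj z)) = vW q z := by
  have ht : Tendsto (fun x : ℝ => conj (yW q (conj (x : ℂ)))) atTop (𝓝 0) := by
    have := (continuous_conj.tendsto 0).comp hq.yW_tendsto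
    simpa [Function.comp_def] using this
  obtain ⟨c, h1, h2⟩ := hq.eq_mul_yW ((yW_isS q).conj hr) ht
  have a := h1 0
  have b := h2 0
  simp only [map_zero, yW_zero, vW_zero, map_add, map_one] at a b
  have hc : c = 1 := by linear_combination b - a
  rw [hc] at h1 h2
  exact ⟨by rw [h1 z, one_mul], by rw [h2 z, one_mul]⟩

/-- The right Weyl solution in the original coordinate. -/
noncomputable def YW (r : ℝ) (q : ℂ[X]) (z : ℂ) : ℂ := yW (qR r q) (z - r)

/-- The derivative of the right Weyl solution in the original coordinate. -/
noncomputable def VW (r : ℝ) (q : ℂ[X]) (z : ℂ) : ℂ := vW (qR r q) (z - r)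

theorem YW_isS (r : ℝ) (q : ℂ[X]) : IsS q (YW r q) (VW r q) := (yW_isS (qR r q)).of_right

theorem RealPoly.qR {q : ℂ[X]} (h : RealPoly q) (r : ℝ) : RealPoly (qR r q) := fun x => by
  rw [qR_eval, ← ofReal_add]
  exact h _

theorem AdmR.YW_real {r : ℝ} (hr : 0 ≤ r) {q : ℂ[X]} (h : AdmR r q) (hq : RealPoly q) (x : ℝ) :
    (YW r q x).im = 0 ∧ (VW r q x).im = 0 := by
  have := (h.right hr).yW_conj (hq.qR r) ((x - r : ℝ) : ℂ)
  rw [conj_ofReal, ofReal_sub] at this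
  exact ⟨conj_eq_iff_im.1 this.1, conj_eq_iff_im.1 this.2⟩

theorem YW_ne_zero (r : ℝ) (q : ℂ[X]) : YW r q ≠ 0 := fun h => by
  refine yW_ne_zero (qR r q) ?_
  ext z
  have := congrFun h (z + r)
  simpa [YW] using this

theorem YW_not_both (r : ℝ) (q : ℂ[X]) (z : ℂ) (h1 : YW r q z = 0) (h2 : VW r q z = 0) :
    False :=
  YW_ne_zero r q (by ext w; exact ((YW_isS r q).eq_zero h1 h2 w).1)

theorem AdmR.YW_zero_mem {r : ℝ} (hr : 0 ≤ r) {q : ℂ[X]} (h : AdmR r q) (hb : Bd q) {x : ℝ}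
    (h0 : YW r q x = 0) : x ∈ Set.Icc (-r) r := by
  constructor
  · by_contra! hx
    obtain ⟨κ, _, hκ, _⟩ := FF_zero_data ((Bd_iff hr h).1 hb)
    have h1 := hκ x
    unfold YW at h0
    rw [h0, mul_zero] at h1
    refine (h.left hr).yW_ne (t := -x - r) (by linarith) ?_
    push_cast
    exact h1
  · by_contra! hx
    refine (h.right hr).yW_ne (t := x - r) (by linarith) ?_
    push_cast
    exact h0

theorem PTend.qR {ι : Type*} {l : Filter ι} {p : ι → ℂ[X]} {q : ℂ[X]} (h : PTend l p q) (r : ℝ) :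
    PTend l (fun t => qR r (p t)) (qR r q) := h.aff 1 r

theorem YW_tendsto {ι : Type*} {l : Filter ι} {p : ι → ℂ[X]} {q : ℂ[X]} {r : ℝ} (hr : 0 ≤ r)
    (hp : PTend l p q) (hq : AdmR r q) (hpa : ∀ᶠ t in l, AdmR r (p t)) {z : ι → ℂ} {z0 : ℂ}
    (hz : Tendsto z l (𝓝 z0)) :
    Tendsto (fun t => YW r (p t) (z t)) l (𝓝 (YW r q z0)) ∧
    Tendsto (fun t => VW r (p t) (z t)) l (𝓝 (VW r q z0)) := by
  have hw := wD_tendsto (hp.qR r) (hq.right hr) (hpa.mono fun t h => h.right hr)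
  exact ⟨sol_tendsto (hp.qR r) (hw.const_add 1) hw (hz.sub_const _),
    sol'_tendsto (hp.qR r) (hw.const_add 1) hw (hz.sub_const _)⟩

theorem NZ_iff {n : ℕ} {r : ℝ} (hr : 0 ≤ r) {q : ℂ[X]} (h : AdmR r q) :
    NZ n q ↔ ¬ Zs n (YW r q) := by
  constructor
  · rintro ⟨Y, V, hS, hne, ht, hZ⟩ ⟨f, hf, h0⟩
    have ht' : Tendsto (fun x : ℝ => Y ((x : ℂ) + r)) atTop (𝓝 0) := by
      have := ht.comp (tendsto_atTop_add_const_right atTop r tendsto_id)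
      simpa [Function.comp_def] using this
    obtain ⟨c, h1, -⟩ := (h.right hr).eq_mul_yW hS.to_right ht'
    refine hZ ⟨f, hf, fun i => ?_⟩
    have h2 := h1 ((f i : ℂ) - r)
    have h3 : yW (_root_.qR r q) ((f i : ℂ) - r) = 0 := h0 i
    rw [sub_add_cancel, h3, mul_zero] at h2
    exact h2
  · intro hZ
    refine ⟨YW r q, VW r q, YW_isS r q, YW_ne_zero r q, ?_, hZ⟩
    have := (h.right hr).yW_tendsto.comp (tendsto_atTop_add_const_right atTop (-r) tendsto_id)
    refine this.congr fun x => ?_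
    simp only [Function.comp, YW, id]
    congr 1
    push_cast
    ring

theorem IsS.re_hasDerivAt {q : ℂ[X]} {Y V : ℂ → ℂ} (h : IsS q Y V) (x : ℝ) :
    HasDerivAt (fun x : ℝ => (Y x).re) (V x).re x ∧
      HasDerivAt (fun x : ℝ => (V x).re) (q.eval (x : ℂ) * Y x).re x :=
  ⟨(reCLM.hasFDerivAt.comp_hasDerivAt x (h.hasDerivAt_real x).1),
    (reCLM.hasFDerivAt.comp_hasDerivAt x (h.hasDerivAt_real x).2)⟩

theorem eq_zero_of_re_im {z : ℂ} (h : z.re = 0) (h' : z.im = 0) : z = 0 := Complex.ext h h'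

theorem Zs_of_frequently {ι : Type*} {l : Filter ι} {p : ι → ℂ[X]} {q : ℂ[X]} {r : ℝ}
    (hr : 0 ≤ r) (hp : PTend l p q) (hq : AdmR r q)
    (hpa : ∀ᶠ t in l, AdmR r (p t) ∧ Bd (p t) ∧ RealPoly (p t)) {n : ℕ}
    (hZ : ∃ᶠ t in l, Zs n (YW r (p t))) : Zs n (YW r q) := by
  have hne : (l ⊓ 𝓟 {t | Zs n (YW r (p t))}).NeBot := frequently_mem_iff_neBot.1 hZ
  set u := Ultrafilter.of (l ⊓ 𝓟 {t | Zs n (YW r (p t))}) with hu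
  have hul : (u : Filter ι) ≤ l := (Ultrafilter.of_le _).trans inf_le_left
  have huZ : ∀ᶠ t in (u : Filter ι), Zs n (YW r (p t)) :=
    (Ultrafilter.of_le _).trans inf_le_right (mem_principal_self _)
  have hpu : PTend (u : Filter ι) p q :=
    ⟨⟨hp.1.choose, hul hp.1.choose_spec⟩, fun j => (hp.2 j).mono_left hul⟩
  have hau := hul hpa
  have hau1 : ∀ᶠ t in (u : Filter ι), AdmR r (p t) := by
    filter_upwards [hau] with t ht using ht.1
  choose! f hf hf0 using fun t (h : Zs n (YW r (p t))) => h
  have hcpt : IsCompact (Set.univ.pi fun _ : Fin (n + 1) => Set.Icc (-r) r) :=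
    isCompact_univ_pi fun _ => isCompact_Icc
  have hmem : ∀ᶠ t in (u : Filter ι), f t ∈ Set.univ.pi fun _ : Fin (n + 1) => Set.Icc (-r) r := by
    filter_upwards [huZ, hau] with t ht ha i _
    exact ha.1.YW_zero_mem hr ha.2.1 (hf0 t ht i)
  obtain ⟨g, -, hg⟩ := hcpt.ultrafilter_le_nhds (u.map f) (le_principal_iff.2 hmem)
  have hg : Tendsto f u (𝓝 g) := hg
  have hgi : ∀ i, Tendsto (fun t => f t i) u (𝓝 (g i)) := tendsto_pi_nhds.1 hg
  have hz : ∀ i, YW r q (g i) = 0 := fun i => by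
    have h1 := (YW_tendsto hr hpu hq hau1 (z := fun t => (f t i : ℂ))
      ((continuous_ofReal.tendsto _).comp (hgi i))).1
    refine tendsto_nhds_unique (h1.congr' ?_) tendsto_const_nhds
    filter_upwards [huZ] with t ht
    exact hf0 t ht i
  refine ⟨g, fun i j hij => ?_, hz⟩
  have hle : g i ≤ g j := le_of_tendsto_of_tendsto (hgi i) (hgi j) (by
    filter_upwards [huZ] with t ht
    exact (hf t ht hij).le)
  refine lt_of_le_of_ne hle fun heq => ?_
  have hroll : ∀ᶠ t in (u : Filter ι), ∃ ξ : ℝ, f t i ≤ ξ ∧ ξ ≤ f t j ∧ VW r (p t) ξ = 0 := by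
    filter_upwards [huZ, hau] with t ht ha
    obtain ⟨ξ, hξ, h0⟩ := exists_hasDerivAt_eq_zero (f := fun x : ℝ => (YW r (p t) x).re)
      (f' := fun x : ℝ => (VW r (p t) x).re) (hf t ht hij)
      (fun x _ => ((YW_isS r (p t)).re_hasDerivAt x).1.continuousAt.continuousWithinAt)
      (by simp only [hf0 t ht]) (fun x _ => ((YW_isS r (p t)).re_hasDerivAt x).1)
    exact ⟨ξ, hξ.1.le, hξ.2.le, eq_zero_of_re_im h0 (ha.1.YW_real hr ha.2.2 ξ).2⟩
  choose! ξ hξ1 hξ2 hξ0 using fun t (h : ∃ ξ : ℝ, f t i ≤ ξ ∧ ξ ≤ f t j ∧ VW r (p t) ξ = 0) => h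
  have hξt : Tendsto ξ u (𝓝 (g i)) := by
    refine tendsto_of_tendsto_of_tendsto_of_le_of_le' (hgi i) (heq ▸ hgi j) ?_ ?_
    · filter_upwards [hroll] with t ht using hξ1 t ht
    · filter_upwards [hroll] with t ht using hξ2 t ht
  have h1 := (YW_tendsto hr hpu hq hau1 (z := fun t => (ξ t : ℂ))
      ((continuous_ofReal.tendsto _).comp hξt)).2
  have h2 : VW r q (g i) = 0 := by
    refine tendsto_nhds_unique (h1.congr' ?_) tendsto_const_nhds
    filter_upwards [hroll] with t ht
    exact hξ0 t ht
  exact YW_not_both r q _ (hz i) h2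

theorem exists_sign_change {g : ℝ → ℝ} {g' x δ : ℝ} (h : HasDerivAt g g' x) (h0 : g x = 0)
    (hg' : g' ≠ 0) (hδ : 0 < δ) : ∃ a b, x - δ < a ∧ a < b ∧ b < x + δ ∧ g a * g b < 0 := by
  have h1 := hasDerivAt_iff_tendsto_slope.1 h
  have h2 : ∀ᶠ y in 𝓝[≠] x, 0 < slope g x y * g' := by
    have := h1.mul_const g'
    exact this.eventually (lt_mem_nhds (mul_self_pos.2 hg'))
  have h3 : ∀ᶠ y in 𝓝 x, y ≠ x → 0 < slope g x y * g' := eventually_nhdsWithin_iff.1 h2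
  obtain ⟨s, hs, hb⟩ := Metric.eventually_nhds_iff_ball.1 h3
  set m := min s δ / 2 with hm
  have hm0 : 0 < m := by positivity
  have hms : m < s := by have := min_le_left s δ; have : 0 < min s δ := by positivity
                         linarith
  have hmδ : m < δ := by have := min_le_right s δ; have : 0 < min s δ := by positivity
                         linarith
  have ha := hb (x - m) (by rw [Metric.mem_ball, Real.dist_eq]; simpa [abs_of_pos hm0])
    (by linarith)
  have hb := hb (x + m) (by rw [Metric.mem_ball, Real.dist_eq]; simpa [abs_of_pos hm0])
    (by linarith)
  refine ⟨x - m, x + m, by linarith, by linarith, by linarith, ?_⟩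
  rw [slope_def_field, h0] at ha hb
  have e1 : (x - m - x) = -m := by ring
  have e2 : (x + m - x) = m := by ring
  rw [e1] at ha
  rw [e2] at hb
  have e3 : (g (x - m) - 0) / -m * g' * ((g (x + m) - 0) / m * g')
      = -(g (x - m) * g (x + m)) * (g' / m) ^ 2 := by
    simp only [sub_zero]; field_simp
  have h4 := mul_pos ha hb
  rw [e3] at h4
  have h5 : 0 < (g' / m) ^ 2 := by positivity
  nlinarith [(pos_iff_pos_of_mul_pos h4).2 h5]

theorem exists_gap {n : ℕ} {f : Fin n → ℝ} (hf : StrictMono f) :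
    ∃ δ > 0, ∀ i j, i < j → f i + δ < f j - δ := by
  have h : ∀ i j : Fin n, ∀ᶠ δ in 𝓝[>] (0 : ℝ), i < j → f i + δ < f j - δ := fun i j => by
    by_cases hij : i < j
    · have hc : Continuous fun δ : ℝ => f j - δ - (f i + δ) := by fun_prop
      have h1 : 0 < f j - 0 - (f i + 0) := by have := hf hij; linarith
      refine ((hc.tendsto 0).eventually (lt_mem_nhds h1)).filter_mono nhdsWithin_le_nhds
        |>.mono fun δ hδ _ => by linarith
    · exact Eventually.of_forall fun _ h => absurd h hij
  obtain ⟨δ, h1, h2⟩ := ((eventually_all.2 fun i => eventually_all.2 (h i)).and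
    self_mem_nhdsWithin).exists
  exact ⟨δ, h2, h1⟩

theorem Zs.eventually {ι : Type*} {l : Filter ι} {p : ι → ℂ[X]} {q : ℂ[X]} {r : ℝ}
    (hr : 0 ≤ r) (hp : PTend l p q) (hq : AdmR r q) (hqr : RealPoly q)
    (hpa : ∀ᶠ t in l, AdmR r (p t) ∧ RealPoly (p t)) {n : ℕ}
    (hZ : Zs n (YW r q)) : ∀ᶠ t in l, Zs n (YW r (p t)) := by
  obtain ⟨f, hf, h0⟩ := hZ
  obtain ⟨δ, hδ, hgap⟩ := exists_gap hf
  have key : ∀ i, ∀ᶠ t in l, ∃ x : ℝ, f i - δ < x ∧ x < f i + δ ∧ YW r (p t) x = 0 := by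
    intro i
    have hv : (VW r q (f i)).re ≠ 0 := fun h =>
      YW_not_both r q _ (h0 i) (eq_zero_of_re_im h (hq.YW_real hr hqr (f i)).2)
    obtain ⟨a, b, h1, h2, h3, h4⟩ := exists_sign_change ((YW_isS r q).re_hasDerivAt (f i)).1
      (by rw [h0 i, zero_re]) hv hδ
    have ht : ∀ x : ℝ, Tendsto (fun t => (YW r (p t) x).re) l (𝓝 (YW r q x).re) := fun x =>
      (continuous_re.tendsto _).comp
        (YW_tendsto hr hp hq (hpa.mono fun _ h => h.1) tendsto_const_nhds).1
    filter_upwards [((ht a).mul (ht b)).eventually (gt_mem_nhds h4), hpa] with t ht1 ht2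
    have hc : ContinuousOn (fun x : ℝ => (YW r (p t) x).re) (Set.Icc a b) := fun x _ =>
      ((YW_isS r (p t)).re_hasDerivAt x).1.continuousAt.continuousWithinAt
    obtain ⟨x, hx, hx0⟩ : ∃ x ∈ Set.Icc a b, (YW r (p t) x).re = 0 := by
      rcases mul_neg_iff.1 ht1 with ⟨g1, g2⟩ | ⟨g1, g2⟩
      · exact intermediate_value_Icc' h2.le hc ⟨g2.le, g1.le⟩
      · exact intermediate_value_Icc h2.le hc ⟨g1.le, g2.le⟩
    exact ⟨x, by linarith [hx.1], by linarith [hx.2],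
      eq_zero_of_re_im hx0 (ht2.1.YW_real hr ht2.2 x).1⟩
  filter_upwards [eventually_all.2 key] with t ht
  choose g g1 g2 g3 using ht
  refine ⟨g, fun i j hij => ?_, g3⟩
  have := hgap i j hij
  have := g1 j
  have := g2 i
  linarith

theorem sturm_zero {q : ℂ[X]} {Y V : ℂ → ℂ} (h : IsS q Y V)
    (hY : ∀ x : ℝ, (Y x).im = 0) {a : ℝ}
    (hle : ∀ x ∈ Set.Icc a (a + Real.pi), (q.eval (x : ℂ)).re ≤ -1) :
    ∃ x ∈ Set.Icc a (a + Real.pi), Y x = 0 := by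
  by_contra! hne
  have hπ := Real.pi_pos
  have hc : ContinuousOn (fun x : ℝ => (Y x).re) (Set.Icc a (a + Real.pi)) := fun x _ =>
    (h.re_hasDerivAt x).1.continuousAt.continuousWithinAt
  have hne' : ∀ x ∈ Set.Icc a (a + Real.pi), (Y x).re ≠ 0 := fun x hx h0 =>
    hne x hx (eq_zero_of_re_im h0 (hY x))
  obtain ⟨s, hs⟩ : ∃ s : ℝ, ∀ x ∈ Set.Icc a (a + Real.pi), 0 < s * (Y x).re := by
    by_cases h0 : 0 < (Y a).re
    · refine ⟨1, fun x hx => ?_⟩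
      rw [one_mul]
      by_contra! hx0
      obtain ⟨y, hy, hy0⟩ := intermediate_value_Icc' hx.1
        (hc.mono (Set.Icc_subset_Icc_right hx.2)) ⟨hx0, h0.le⟩
      exact hne' y ⟨hy.1, hy.2.trans hx.2⟩ hy0
    · refine ⟨-1, fun x hx => ?_⟩
      by_contra! hx0
      obtain ⟨y, hy, hy0⟩ := intermediate_value_Icc hx.1
        (hc.mono (Set.Icc_subset_Icc_right hx.2)) ⟨not_lt.1 h0, (by linarith : 0 ≤ (Y x).re)⟩
      exact hne' y ⟨hy.1, hy.2.trans hx.2⟩ hy0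
  have hder : ∀ x : ℝ, HasDerivAt (fun x : ℝ => s * ((Y x).re * Real.cos (x - a) -
      (V x).re * Real.sin (x - a))) (-(((q.eval (x : ℂ)).re + 1) * (s * (Y x).re)
        * Real.sin (x - a))) x := fun x => by
    have h1 := h.re_hasDerivAt x
    have h2 : HasDerivAt (fun x : ℝ => x - a) 1 x := (hasDerivAt_id x).sub_const a
    have h3 := ((h1.1.mul h2.cos).sub (h1.2.mul h2.sin)).const_mul s
    refine h3.congr_deriv ?_
    rw [mul_re, hY x]
    ring
  have hmono := monoOn_of_hasDerivAt hder (a := a) (b := a + Real.pi) (fun x hx => by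
    have h1 := hle x hx
    have h2 := hs x hx
    have h3 : 0 ≤ Real.sin (x - a) :=
      Real.sin_nonneg_of_nonneg_of_le_pi (by linarith [hx.1]) (by linarith [hx.2])
    have h4 := mul_nonneg (mul_nonneg (by linarith : 0 ≤ -((q.eval (x : ℂ)).re + 1)) h2.le) h3
    linarith) le_rfl (by linarith : a ≤ a + Real.pi) le_rfl
  simp only [sub_self, Real.cos_zero, Real.sin_zero, add_sub_cancel_left, Real.cos_pi,
    Real.sin_pi] at hmono
  have h1 := hs a ⟨le_rfl, by linarith⟩
  have h2 := hs (a + Real.pi) ⟨by linarith, le_rfl⟩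
  linarith

theorem sturm_count {q : ℂ[X]} {Y V : ℂ → ℂ} (h : IsS q Y V)
    (hY : ∀ x : ℝ, (Y x).im = 0) {a : ℝ} {n : ℕ}
    (hle : ∀ x ∈ Set.Icc a (a + 4 * (n + 1)), (q.eval (x : ℂ)).re ≤ -1) : Zs n Y := by
  have hπ := Real.pi_pos
  have hπ4 := Real.pi_lt_four
  have key : ∀ i : Fin (n + 1), ∃ x ∈ Set.Icc (a + 4 * (i : ℝ)) (a + 4 * (i : ℝ) + Real.pi),
      Y x = 0 := fun i => by
    refine sturm_zero h hY fun x hx => hle x ⟨?_, ?_⟩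
    · have : (0 : ℝ) ≤ (i : ℝ) := by positivity
      linarith [hx.1]
    · have : ((i : ℕ) : ℝ) ≤ n := by exact_mod_cast Nat.lt_succ_iff.1 i.2
      linarith [hx.2]
  choose f hf h0 using key
  refine ⟨f, fun i j hij => ?_, h0⟩
  have h1 := (hf i).2
  have h2 := (hf j).1
  have h3 : ((i : ℕ) : ℝ) + 1 ≤ (j : ℕ) := by exact_mod_cast hij
  linarith

theorem NZ.exists_gt {q : ℂ[X]} {n : ℕ} (h : NZ n q) (hc : Coer2 q) (hq : RealPoly q) (a : ℝ) :
    ∃ x ∈ Set.Icc a (a + 4 * (n + 1)), -1 < (q.eval (x : ℂ)).re := by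
  by_contra! hle
  obtain ⟨r, hr, ha⟩ := hc.exists_admR
  exact (NZ_iff hr ha).1 h (sturm_count (YW_isS r q) (fun x => (ha.YW_real hr hq x).1) hle)

theorem Bd.exists_NZ {q : ℂ[X]} (hb : Bd q) (hc : Coer2 q) : ∃ n, NZ n q := by
  obtain ⟨r, hr, ha⟩ := hc.exists_admR
  have hfin : {x : ℝ | YW r q x = 0}.Finite := by
    by_contra hinf
    obtain ⟨x, -, hx⟩ := Set.Infinite.exists_accPt_of_subset_isCompact hinf
      (isCompact_Icc (a := -r) (b := r)) fun x hx => ha.YW_zero_mem hr hb hx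
    have hfr : ∃ᶠ y : ℝ in 𝓝[≠] x, YW r q (y : ℂ) = 0 := accPt_iff_frequently_nhdsNE.1 hx
    have hmap : Tendsto (fun y : ℝ => (y : ℂ)) (𝓝[≠] x) (𝓝[≠] (x : ℂ)) := by
      refine tendsto_nhdsWithin_iff.2 ⟨(continuous_ofReal.tendsto x).mono_left
        nhdsWithin_le_nhds, ?_⟩
      filter_upwards [self_mem_nhdsWithin] with y hy
      exact fun h => hy (ofReal_inj.1 h)
    have hfr' := hmap.frequently (p := fun z => YW r q z = 0) hfr
    have hd : DifferentiableOn ℂ (YW r q) Set.univ := fun z _ =>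
      ((YW_isS r q z).1.differentiableAt).differentiableWithinAt
    have h0 := (hd.analyticOnNhd isOpen_univ).eqOn_zero_of_preconnected_of_frequently_eq_zero
      isPreconnected_univ (Set.mem_univ (x : ℂ)) hfr'
    exact YW_ne_zero r q (by ext z; exact h0 (Set.mem_univ z))
  refine ⟨hfin.toFinset.card, (NZ_iff hr ha).2 ?_⟩
  rintro ⟨f, hf, h0⟩
  have h1 := Finset.card_le_card_of_injOn (s := Finset.univ) (t := hfin.toFinset) f
    (fun i _ => by simp [h0 i]) hf.injective.injOn
  simp at h1

end ZeroCount

section Homotopy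
open Polynomial

variable {d : ℕ}

theorem realPoly_iff {p : (Fin (d - 1) → ℂ) × ℂ} (h1 : ∀ i, (p.1 i).im = 0) (h2 : p.2.im = 0) :
    RealPoly (PolP d p) := fun x => by
  rw [PolP_eval, Pol, sub_im, h2, add_im, im_sum, ← ofReal_pow, ofReal_im, Finset.sum_eq_zero]
  · simp
  · intro i _
    rw [← ofReal_pow, im_mul_ofReal, h1, zero_mul]

theorem realPoly_of_real (hd : 2 ≤ d) (hev : Even d) {p : (Fin (d - 1) → ℂ) × ℂ}
    (hp : p ∈ Sg d) (h1 : ∀ i, (p.1 i).im = 0) : p.2.im = 0 ∧ RealPoly (PolP d p) := by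
  have h0 : RealPoly (PolP d (p.1, 0)) := realPoly_iff h1 (by simp)
  obtain ⟨Y, V, h⟩ := Bd.exists_EF (PolP_coer hd hev p) hp
  have h2 := h.im_eq_zero (m := -p.2.im) fun x => by
    have := h0 x
    rw [PolP_eval] at this ⊢
    simp only [sub_zero] at this
    rw [sub_im, this, zero_sub]
  have h3 : p.2.im = 0 := neg_eq_zero.1 h2
  exact ⟨h3, realPoly_iff h1 h3⟩

theorem NZ_locally (hd : 2 ≤ d) (hev : Even d) {p0 : (Fin (d - 1) → ℂ) × ℂ}
    (h1 : ∀ i, (p0.1 i).im = 0) (h0 : p0 ∈ Sg d) (n : ℕ) : ∀ᶠ p in 𝓝 p0, p ∈ Sg d →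
      (∀ i, (p.1 i).im = 0) → (NZ n (PolP d p) ↔ NZ n (PolP d p0)) := by
  obtain ⟨M, hM⟩ := mem_Bx p0
  obtain ⟨r, hr, ha⟩ := exists_Bx_adm hd hev M
  set l := 𝓝 p0 ⊓ 𝓟 {p | p ∈ Sg d ∧ ∀ i, (p.1 i).im = 0} with hl
  have hPT : PTend l (fun p => PolP d p) (PolP d p0) :=
    PolP_tend (by omega) (tendsto_id.mono_left inf_le_left)
  have hB : ∀ᶠ p in l, p ∈ Bx d M := ((Bx_open d M).eventually_mem hM).filter_mono inf_le_left
  have hall : ∀ᶠ p in l, AdmR r (PolP d p) ∧ Bd (PolP d p) ∧ RealPoly (PolP d p) := by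
    have hP : ∀ᶠ p in l, p ∈ Sg d ∧ ∀ i, (p.1 i).im = 0 := mem_inf_of_right (mem_principal_self _)
    filter_upwards [hB, hP] with p hp hp2
    exact ⟨ha p hp, hp2.1, (realPoly_of_real hd hev hp2.1 hp2.2).2⟩
  have hkey : ∀ᶠ p in l, NZ n (PolP d p) ↔ NZ n (PolP d p0) := by
    by_cases hZ : Zs n (YW r (PolP d p0))
    · filter_upwards [hB, hZ.eventually hr hPT (ha _ hM) (realPoly_of_real hd hev h0 h1).2
        (hall.mono fun _ h => ⟨h.1, h.2.2⟩)] with p hp hpZ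
      rw [NZ_iff hr (ha p hp), NZ_iff hr (ha _ hM)]
      exact iff_of_false (not_not.2 hpZ) (not_not.2 hZ)
    · have := not_frequently.1 (mt (Zs_of_frequently hr hPT (ha _ hM) hall) hZ)
      filter_upwards [hB, this] with p hp hpZ
      rw [NZ_iff hr (ha p hp), NZ_iff hr (ha _ hM)]
      exact iff_of_true hpZ hZ
  rw [hl, eventually_inf_principal] at hkey
  exact hkey.mono fun p h hS hR => h ⟨hS, hR⟩

theorem NZ.lam_le (hd : 2 ≤ d) (M : ℝ) (n : ℕ) : ∃ R : ℝ, ∀ p : (Fin (d - 1) → ℂ) × ℂ,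
    ‖p.1‖ ≤ M → RealPoly (PolP d p) → Coer2 (PolP d p) → NZ n (PolP d p) → p.2.re ≤ R := by
  set N : ℝ := 4 * (n + 1) with hN
  have hN1 : 1 ≤ N := by
    have : (0 : ℝ) ≤ n := by positivity
    linarith
  refine ⟨N ^ d + d * |M| * N ^ d + 1, fun p hp hR hC hZ => ?_⟩
  obtain ⟨x, hx, h1⟩ := hZ.exists_gt hC hR 0
  rw [zero_add, ← hN] at hx
  rw [PolP_eval, sub_re] at h1
  have h2 : ‖Pol d p.1 x‖ ≤ N ^ d + d * |M| * N ^ d := by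
    have hxn : ‖(x : ℂ)‖ ≤ N := by
      rw [norm_real, Real.norm_eq_abs, abs_of_nonneg hx.1]; exact hx.2
    refine (norm_add_le _ _).trans (add_le_add ?_ ?_)
    · rw [norm_pow]; gcongr
    · refine (norm_sum_le _ _).trans ((Finset.sum_le_sum (g := fun _ => |M| * N ^ d)
        fun i _ => ?_).trans ?_)
      · rw [norm_mul, norm_pow]
        have h2 : ‖p.1 i‖ ≤ |M| := (norm_le_pi_norm _ _).trans (hp.trans (le_abs_self _))
        have h3 : ‖(x : ℂ)‖ ^ ((i : ℕ) + 1) ≤ N ^ d :=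
          (pow_le_pow_left₀ (norm_nonneg _) hxn _).trans
            (pow_le_pow_right₀ hN1 (by have := i.2; omega))
        exact mul_le_mul h2 h3 (by positivity) (abs_nonneg _)
      · rw [Finset.sum_const, Finset.card_univ, Fintype.card_fin, nsmul_eq_mul, ← mul_assoc]
        have : ((d - 1 : ℕ) : ℝ) ≤ d := by exact_mod_cast Nat.sub_le _ _
        gcongr
  have h3 := (re_le_norm _).trans h2
  linarith

/-- Following an eigenvalue with at most `n` zeros along a real segment of potentials. -/
theorem LC.homotopy (hd : 2 ≤ d) (hev : Even d) {A : Set ((Fin (d - 1) → ℂ) × ℂ)}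
    (hA : LC d A) {p : (Fin (d - 1) → ℂ) × ℂ} (hp : p ∈ Sg d ∩ A) (hpr : ∀ i, (p.1 i).im = 0)
    {n : ℕ} (hn : NZ n (PolP d p)) {β : Fin (d - 1) → ℂ} (hβ : ∀ i, (β i).im = 0) :
    ∃ lam, (β, lam) ∈ Sg d ∩ A ∧ NZ n (PolP d (β, lam)) := by
  obtain ⟨γ, hγ⟩ : ∃ γ : ℝ → Fin (d - 1) → ℂ, γ = fun t => p.1 + t • (β - p.1) := ⟨_, rfl⟩
  have hγc : Continuous γ := by rw [hγ]; fun_prop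
  have hγr : ∀ t i, (γ t i).im = 0 := fun t i => by rw [hγ]; simp [hpr i, hβ i]
  have hγ0 : γ 0 = p.1 := by rw [hγ]; simp
  have hγ1 : γ 1 = β := by rw [hγ]; simp
  obtain ⟨M, hM⟩ := (isCompact_Icc (a := (0 : ℝ)) (b := 1)).exists_bound_of_continuousOn
    hγc.continuousOn
  obtain ⟨K, -, hK⟩ := exists_re_bound hd hev M
  obtain ⟨R, hR⟩ := NZ.lam_le hd M n
  set B : Set (ℝ × ℂ) := {x | x.1 ∈ Set.Icc (0 : ℝ) 1 ∧ (γ x.1, x.2) ∈ Sg d ∩ A ∧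
    NZ n (PolP d (γ x.1, x.2))} with hB
  have hΦ : Continuous fun x : ℝ × ℂ => (γ x.1, x.2) := by fun_prop
  have hBc : IsClosed B := by
    refine isClosed_iff_frequently.2 fun x hx => ?_
    have h1 : x.1 ∈ Set.Icc (0 : ℝ) 1 := by
      exact (isClosed_Icc.preimage continuous_fst).mem_of_frequently_of_tendsto
        (hx.mono fun y hy => hy.1) tendsto_id
    have h2 := hA.mem_of_tendsto hd hev (hΦ.tendsto x) (hx.mono fun y hy => hy.2.1)
    refine ⟨h1, h2, ?_⟩
    obtain ⟨y, hy1, hy2⟩ := (hx.and_eventually ((hΦ.tendsto x).eventually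
      (NZ_locally hd hev (hγr _) h2.1 n))).exists
    exact (hy2 hy1.2.1.1 (hγr _)).1 hy1.2.2
  have hBk : IsCompact B := by
    refine (isCompact_Icc.prod (isCompact_Icc (a := -K) (b := R) |>.image
      continuous_ofReal)).of_isClosed_subset hBc fun x hx => ⟨hx.1, x.2.re, ?_, ?_⟩
    · have hr := realPoly_of_real hd hev hx.2.1.1 (hγr _)
      exact ⟨hK _ hx.2.1.1 (hM _ hx.1), hR _ (hM _ hx.1) hr.2 (PolP_coer hd hev _) hx.2.2⟩
    · exact Complex.ext (by simp)
        (by simpa using (realPoly_of_real hd hev hx.2.1.1 (hγr _)).1.symm)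
  have hT : (1 : ℝ) ∈ Prod.fst '' B := by
    refine IsClosed.mem_of_ge_of_forall_exists_gt (a := 0) ?_ ?_ zero_le_one ?_
    · exact ((hBk.image continuous_fst).isClosed).inter isClosed_Icc
    · refine ⟨(0, p.2), ⟨by simp, ?_, ?_⟩, rfl⟩
      · simp only [hγ0]; exact hp
      · simp only [hγ0]; exact hn
    · rintro _ ⟨⟨x, hx, rfl⟩, hx0, hx1⟩
      have h1 := NZ_locally hd hev (hγr x.1) hx.2.1.1 n
      rw [nhds_prod_eq] at h1
      obtain ⟨S, hS, T, hT, hST⟩ := eventually_prod_iff.1 h1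
      obtain ⟨ρ, hρ, hρT⟩ := Metric.eventually_nhds_iff_ball.1 hT
      have h2 := (hγc.tendsto x.1).eventually (hS.and (hA.persist hd hev hx.2.1 hρ))
      have h3 : ∀ᶠ t in 𝓝[>] x.1, t ∈ Set.Ioc x.1 1 := Ioc_mem_nhdsGT hx1
      obtain ⟨t, ⟨ht1, lam, hlam, htS⟩, ht⟩ := ((h2.filter_mono nhdsWithin_le_nhds).and h3).exists
      exact ⟨t, ⟨(t, lam), ⟨⟨hx0.trans ht.1.le, ht.2⟩, htS,
        (hST ht1 (hρT _ hlam) htS.1 (hγr _)).2 hx.2.2⟩, rfl⟩, ht⟩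
  obtain ⟨⟨t, lam⟩, ⟨-, h2, h3⟩, ht⟩ := hT
  simp only at ht h2 h3
  rw [ht, hγ1] at h2 h3
  exact ⟨lam, h2, h3⟩

end Homotopy

section DoubleWell
open Polynomial

/-- The coefficient `D` for which `sol q (1 + D) D` satisfies the Robin condition `φ + φ' = 0`
at `N`. -/
noncomputable def robD (q : ℂ[X]) (N : ℝ) : ℂ :=
  -(sol q 1 0 N + sol' q 1 0 N) / (sol q 1 1 N + sol' q 1 1 N)

theorem robin_ne {q : ℂ[X]} {N : ℝ} (hN : 0 ≤ N)
    (hq : ∀ x ∈ Set.Icc 0 N, 0 ≤ (q.eval (x : ℂ)).re) : sol q 1 1 N + sol' q 1 1 N ≠ 0 := by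
  intro h
  have h1 := (sol_one_one_bound hN hq).1
  rw [En, eq_neg_of_add_eq_zero_right h, mul_neg, neg_re, ← normSq_eq_conj_mul_self,
    ofReal_re] at h1
  linarith [normSq_nonneg (sol q 1 1 N)]

theorem robD_spec {q : ℂ[X]} {N : ℝ} (hN : 0 ≤ N)
    (hq : ∀ x ∈ Set.Icc 0 N, 0 ≤ (q.eval (x : ℂ)).re) :
    sol' q (1 + robD q N) (robD q N) N = -sol q (1 + robD q N) (robD q N) N := by
  have h := robin_ne hN hq
  rw [(sol_D q _ _).1, (sol_D q _ _).2]
  have h2 : robD q N * (sol q 1 1 N + sol' q 1 1 N) = -(sol q 1 0 N + sol' q 1 0 N) :=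
    div_mul_cancel₀ _ h
  linear_combination h2

theorem admD_robD {q : ℂ[X]} {N : ℝ} (hN : 0 ≤ N)
    (hq : ∀ x ∈ Set.Icc 0 N, 0 ≤ (q.eval (x : ℂ)).re) : AdmD q N (robD q N) := by
  rw [AdmD, En, robD_spec hN hq, mul_neg, neg_re, ← normSq_eq_conj_mul_self, ofReal_re]
  linarith [normSq_nonneg (sol q (1 + robD q N) (robD q N) N)]

theorem robin_decay {q : ℂ[X]} {N : ℝ} (hN : 0 ≤ N)
    (hq : ∀ x ∈ Set.Icc 0 N, 1 ≤ (q.eval (x : ℂ)).re) :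
    N * normSq (sol q (1 + robD q N) (robD q N) N) ≤ 1 := by
  have hq0 : ∀ x ∈ Set.Icc 0 N, 0 ≤ (q.eval (x : ℂ)).re := fun x hx =>
    zero_le_one.trans (hq x hx)
  have h := admD_robD hN hq0
  have h1 := (sol_isS q (1 + robD q N) (robD q N)).normSq_le hN hq h
  rw [sub_zero] at h1
  exact h1.trans (AdmD.bound (h.mono le_rfl hN hq0)).2

/-- Matching coefficient between a well and the barrier. -/
noncomputable def wG (r N : ℝ) (R : ℂ[X]) : ℂ :=
  yW (qR r R) (-2 * r) * robD (qL r R) N + vW (qR r R) (-2 * r) * (1 + robD (qL r R) N)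

/-- Secondary matching coefficient between a well and the barrier. -/
noncomputable def sG (r : ℝ) (R : ℂ[X]) : ℂ := yW (qR r R) (-2 * r) + vW (qR r R) (-2 * r)

/-- Transmission coefficient of the barrier. -/
noncomputable def cG (r N : ℝ) (R : ℂ[X]) : ℂ :=
  sol (qL r R) (1 + robD (qL r R) N) (robD (qL r R) N) N

/-- Spectral determinant of a double well, `R` and `R'` being the potential seen from either
well. -/
noncomputable def GG (r N : ℝ) (R R' : ℂ[X]) : ℂ :=
  wG r N R * wG r N R' - cG r N R ^ 2 * (sG r R * sG r R')

theorem GG_iff {r N : ℝ} (hN : 0 ≤ N) {R R' : ℂ[X]}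
    (hRR : ∀ z, R'.eval z = R.eval (-z - N - 2 * r)) (hR : Adm (qR r R)) (hR' : Adm (qR r R'))
    (hB : ∀ x ∈ Set.Icc 0 N, 0 ≤ ((qL r R).eval (x : ℂ)).re) : Bd R ↔ GG r N R R' = 0 := by
  have hB' : ∀ x ∈ Set.Icc 0 N, 0 ≤ ((qL r R').eval (x : ℂ)).re := fun x hx => by
    have h1 := hB (N - x) ⟨by linarith [hx.2], by linarith [hx.1]⟩
    rw [qL_eval] at h1 ⊢
    rw [hRR]
    convert h1 using 3
    push_cast; ring
  have hrefl : aff (-1) (-N - 2 * r : ℂ) R' = R := Polynomial.funext fun z => by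
    rw [aff_eval, hRR]; congr 1; ring
  have hY := (yW_isS (qR r R)).of_right
  have hl := (yW_isS (qR r R')).of_right.aff_neg (-N - 2 * r : ℂ)
  have hΦ := (sol_isS (qL r R) (1 + robD (qL r R) N) (robD (qL r R) N)).of_left
  have hΨ := (sol_isS (qL r R') (1 + robD (qL r R') N)
    (robD (qL r R') N)).of_left.aff_neg (-N - 2 * r : ℂ)
  rw [hrefl] at hl hΨ
  have s1 := robD_spec hN hB
  have s2 := robD_spec hN hB'
  have w1 := hl.wronskian hΨ (-r) (-N - r)
  have w2 := hl.wronskian hΦ (-r) (-N - r)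
  have w3 := hΦ.wronskian hΨ (-r) (-N - r)
  have e0 : (-(-r : ℂ) - r) = 0 := by ring
  have e1 : (-(-(-r : ℂ) + (-N - 2 * r)) - r) = N := by ring
  have e2 : (-(-N - r : ℂ) + (-N - 2 * r) - r) = -2 * r := by ring
  have e3 : (-(-(-N - r : ℂ) + (-N - 2 * r)) - r) = 0 := by ring
  have e4 : (-(-N - r : ℂ) - r) = N := by ring
  have e5 : (-r - r : ℂ) = -2 * r := by ring
  simp only [e0, e1, e2, e3, e4, sol_zero, sol'_zero, s1, s2] at w1 w2 w3
  set b := yW (qR r R') (-(-r : ℂ) + (-N - 2 * r) - r) with hb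
  set b' := vW (qR r R') (-(-r : ℂ) + (-N - 2 * r) - r) with hb'
  set a := yW (qR r R) (-2 * r) with ha
  set a' := vW (qR r R) (-2 * r) with ha'
  set c := sol (qL r R) (1 + robD (qL r R) N) (robD (qL r R) N) N with hc
  set D := robD (qL r R) N with hD
  set D' := robD (qL r R') N with hD'
  have hc0 : c ≠ 0 := fun h0 => by
    have h1 := (sol_isS (qL r R) (1 + D) D).eq_zero (x := N) h0 (by rw [s1, h0, neg_zero]) 0
    rw [sol_zero, sol'_zero] at h1
    simpa [h1.2] using h1.1
  have hcc : sol (qL r R') (1 + D') D' N = c := by linear_combination -w3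
  rw [hcc] at w1
  have hG : GG r N R R' = c * (a * -b' - a' * b) := by
    rw [GG, wG, wG, sG, sG, cG, ← hD, ← hD', ← hc, ← ha, ← ha']
    linear_combination -(a * D + a' * (1 + D)) * w1 + c * (a + a') * w2
  have hbb : ¬ (b = 0 ∧ b' = 0) := fun h =>
    yW_ne_zero (qR r R') (_root_.funext fun z => ((yW_isS (qR r R')).eq_zero h.1 h.2 z).1)
  have hlt : Tendsto (fun x : ℝ => yW (qR r R') (-x + (-N - 2 * r) - r)) atBot (𝓝 0) := by
    have h1 : Tendsto (fun x : ℝ => -x + (-N - 2 * r - r)) atBot atTop :=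
      tendsto_atTop_add_const_right atBot _ tendsto_neg_atBot_atTop
    refine (hR'.yW_tendsto.comp h1).congr fun x => ?_
    simp only [Function.comp_def]; push_cast; ring_nf
  have hYt : Tendsto (fun x : ℝ => yW (qR r R) (x - r)) atTop (𝓝 0) := by
    refine (hR.yW_tendsto.comp (tendsto_atTop_add_const_right atTop (-r) tendsto_id)).congr
      fun x => ?_
    simp [sub_eq_add_neg]
  rw [hG, mul_eq_zero, or_iff_right hc0]
  constructor
  · rintro ⟨y, v, hy, hne, ht, hbt⟩
    obtain ⟨κ, hκ1, hκ2⟩ := hR.eq_mul_yW (hy.to_right (r := r)) (by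
      have := ht.comp (tendsto_atTop_add_const_right atTop r tendsto_id)
      refine this.congr fun x => ?_
      simp)
    have hy' := hy.aff_neg (-N - 2 * r : ℂ)
    have hrefl' : aff (-1) (-N - 2 * r : ℂ) R = R' := Polynomial.funext fun z => by
      rw [aff_eval, hRR]; congr 1; ring
    rw [hrefl'] at hy'
    obtain ⟨κ', hκ1', hκ2'⟩ := hR'.eq_mul_yW (hy'.to_right (r := r)) (by
      have h1 : Tendsto (fun x : ℝ => -x + (-N - 3 * r)) atTop atBot :=
        tendsto_atBot_add_const_right atTop _ tendsto_neg_atTop_atBot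
      refine (hbt.comp h1).congr fun x => ?_
      simp only [Function.comp_def]; push_cast; ring_nf)
    have hκ : κ ≠ 0 := by
      rintro rfl
      apply hne; funext z
      simpa using hκ1 (z - r)
    have hκ' : κ' ≠ 0 := by
      rintro rfl
      apply hne; funext z
      have := hκ1' (-z - N - 2 * r - r)
      rw [zero_mul] at this
      rw [Pi.zero_apply, ← this]
      congr 1; ring
    have f1 := hκ1 (-2 * r)
    have f2 := hκ2 (-2 * r)
    have f3 := hκ1' (-(-r : ℂ) + (-N - 2 * r) - r)
    have f4 := hκ2' (-(-r : ℂ) + (-N - 2 * r) - r)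
    rw [show (-2 * r + r : ℂ) = -r by ring, ← ha] at f1
    rw [show (-2 * r + r : ℂ) = -r by ring, ← ha'] at f2
    rw [show (-(-(-r : ℂ) + (-N - 2 * r) - r + r) + (-N - 2 * r)) = -r by ring, ← hb] at f3
    rw [show (-(-(-r : ℂ) + (-N - 2 * r) - r + r) + (-N - 2 * r)) = -r by ring, ← hb'] at f4
    have : κ * κ' * (a * -b' - a' * b) = 0 := by
      linear_combination (κ' * b') * f1 + (κ' * b) * f2 + v (-r) * f3 + y (-r) * f4
    exact (mul_eq_zero.1 this).resolve_left (mul_ne_zero hκ hκ')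
  · intro hW
    obtain ⟨μ, h1, h2⟩ : ∃ μ : ℂ, a = μ * b ∧ a' = μ * -b' := by
      by_cases h0 : b = 0
      · have hb0 : b' ≠ 0 := fun h => hbb ⟨h0, h⟩
        refine ⟨-a' / b', ?_, by field_simp⟩
        rw [h0] at hW ⊢
        simpa [hb0] using hW
      · refine ⟨a / b, by field_simp, ?_⟩
        field_simp
        linear_combination -hW
    have key := hY.eq_of (hl.comb hl μ 0) (x := -r) (by
      simp only [e5]; rw [← ha, ← hb, h1]; ring) (by
      simp only [e5]; rw [← ha', ← hb', h2]; ring)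
    refine ⟨_, _, hY, fun h => yW_ne_zero (qR r R) ?_, hYt, ?_⟩
    · funext z
      have := congrFun h (z + r)
      simpa using this
    · have := hlt.const_mul μ
      rw [mul_zero] at this
      refine this.congr fun x => ?_
      simpa using ((key x).1).symm

theorem PTend.qL {ι : Type*} {l : Filter ι} {p : ι → ℂ[X]} {q : ℂ[X]} (h : PTend l p q) (r : ℝ) :
    PTend l (fun t => qL r (p t)) (qL r q) := h.aff _ _

theorem GG_tendsto {ι : Type*} {l : Filter ι} {R R' : ι → ℂ[X]} {P P' : ℂ[X]} {r : ℝ}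
    (hr : 0 ≤ r) (hP : PTend l R P) (hP' : PTend l R' P') (ha : AdmR r P) (ha' : AdmR r P')
    {N : ι → ℝ} (hN : Tendsto N l atTop)
    (hA : ∀ᶠ t in l, Adm (qR r (R t))) (hA' : ∀ᶠ t in l, Adm (qR r (R' t)))
    (hB : ∀ᶠ t in l, ∀ x ∈ Set.Icc 0 (N t), 1 ≤ ((qL r (R t)).eval (x : ℂ)).re)
    (hB' : ∀ᶠ t in l, ∀ x ∈ Set.Icc 0 (N t), 1 ≤ ((qL r (R' t)).eval (x : ℂ)).re) :
    Tendsto (fun t => GG r (N t) (R t) (R' t)) l (𝓝 (FF r P * FF r P')) := by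
  have key : ∀ {R : ι → ℂ[X]} {P : ℂ[X]}, PTend l R P → AdmR r P →
      (∀ᶠ t in l, Adm (qR r (R t))) →
      (∀ᶠ t in l, ∀ x ∈ Set.Icc 0 (N t), 1 ≤ ((qL r (R t)).eval (x : ℂ)).re) →
      Tendsto (fun t => wG r (N t) (R t)) l (𝓝 (FF r P)) ∧
      Tendsto (fun t => sG r (R t)) l (𝓝 (sG r P)) := by
    intro R P hP ha hA hB
    have hw := wD_tendsto (hP.qR r) (ha.right hr) hA
    have hy : Tendsto (fun t => yW (qR r (R t)) (-2 * r)) l (𝓝 (yW (qR r P) (-2 * r))) :=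
      sol_tendsto (hP.qR r) (hw.const_add 1) hw tendsto_const_nhds
    have hv : Tendsto (fun t => vW (qR r (R t)) (-2 * r)) l (𝓝 (vW (qR r P) (-2 * r))) :=
      sol'_tendsto (hP.qR r) (hw.const_add 1) hw tendsto_const_nhds
    have hD : Tendsto (fun t => robD (qL r (R t)) (N t)) l (𝓝 (wD (qL r P))) := by
      refine wD_tendsto_of_admD (hP.qL r) (ha.left hr) hN ?_ ?_
      · filter_upwards [hB] with t h x hx using zero_le_one.trans (h x hx)
      · filter_upwards [hB, hN.eventually_ge_atTop 0] with t h h0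
        exact admD_robD h0 fun x hx => zero_le_one.trans (h x hx)
    refine ⟨?_, hy.add hv⟩
    rw [FF, vW_zero, yW_zero]
    exact (hy.mul hD).add (hv.mul (hD.const_add 1))
  obtain ⟨h1, h2⟩ := key hP ha hA hB
  obtain ⟨h1', h2'⟩ := key hP' ha' hA' hB'
  have hc : Tendsto (fun t => cG r (N t) (R t) ^ 2) l (𝓝 0) := by
    refine squeeze_zero_norm' (a := fun t => (N t)⁻¹) ?_ hN.inv_tendsto_atTop
    filter_upwards [hB, hN.eventually_gt_atTop 0] with t h h0
    have h3 := robin_decay h0.le h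
    rw [norm_pow, ← normSq_eq_norm_sq, cG]
    rw [← one_div, le_div_iff₀ h0, mul_comm]
    exact h3
  have := (h1.mul h1').sub (hc.mul (h2.mul h2'))
  simpa only [zero_mul, sub_zero, GG] using this

theorem PHol.qR {Ω : Set ℂ} {p : ℂ → ℂ[X]} (h : PHol Ω p) (r : ℝ) :
    PHol Ω (fun w => qR r (p w)) := h.aff _ _

theorem PHol.qL {Ω : Set ℂ} {p : ℂ → ℂ[X]} (h : PHol Ω p) (r : ℝ) :
    PHol Ω (fun w => qL r (p w)) := h.aff _ _

theorem GG_hol {Ω : Set ℂ} (hΩ : IsOpen Ω) {R R' : ℂ → ℂ[X]} (h : PHol Ω R) (h' : PHol Ω R')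
    {r N : ℝ} (hN : 0 ≤ N) (hA : ∀ w ∈ Ω, Adm (qR r (R w))) (hA' : ∀ w ∈ Ω, Adm (qR r (R' w)))
    (hB : ∀ w ∈ Ω, ∀ x ∈ Set.Icc 0 N, 0 ≤ ((qL r (R w)).eval (x : ℂ)).re)
    (hB' : ∀ w ∈ Ω, ∀ x ∈ Set.Icc 0 N, 0 ≤ ((qL r (R' w)).eval (x : ℂ)).re) :
    DifferentiableOn ℂ (fun w => GG r N (R w) (R' w)) Ω := by
  have key : ∀ {R : ℂ → ℂ[X]}, PHol Ω R → (∀ w ∈ Ω, Adm (qR r (R w))) →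
      (∀ w ∈ Ω, ∀ x ∈ Set.Icc 0 N, 0 ≤ ((qL r (R w)).eval (x : ℂ)).re) →
      DifferentiableOn ℂ (fun w => wG r N (R w)) Ω ∧ DifferentiableOn ℂ (fun w => sG r (R w)) Ω ∧
      DifferentiableOn ℂ (fun w => cG r N (R w)) Ω := by
    intro R h hA hB
    have hw := wD_hol hΩ (h.qR r) hA
    have hy : DifferentiableOn ℂ (fun w => yW (qR r (R w)) (-2 * r)) Ω :=
      sol_hol hΩ (h.qR r) (hw.const_add 1) hw _
    have hv : DifferentiableOn ℂ (fun w => vW (qR r (R w)) (-2 * r)) Ω :=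
      sol'_hol hΩ (h.qR r) (hw.const_add 1) hw _
    have c0 : ∀ k : ℂ, DifferentiableOn ℂ (fun _ : ℂ => k) Ω := fun k =>
      differentiableOn_const k
    have hD : DifferentiableOn ℂ (fun w => robD (qL r (R w)) N) Ω :=
      (((sol_hol hΩ (h.qL r) (c0 1) (c0 0) N).add
        (sol'_hol hΩ (h.qL r) (c0 1) (c0 0) N)).neg).div
        ((sol_hol hΩ (h.qL r) (c0 1) (c0 1) N).add (sol'_hol hΩ (h.qL r) (c0 1) (c0 1) N))
        fun w hw => robin_ne hN (hB w hw)
    exact ⟨(hy.mul hD).add (hv.mul (hD.const_add 1)), hy.add hv,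
      sol_hol hΩ (h.qL r) (hD.const_add 1) hD N⟩
  obtain ⟨h1, h2, h3⟩ := key h hA hB
  obtain ⟨h1', h2', -⟩ := key h' hA' hB'
  exact (h1.mul h1').sub ((h3.pow 2).mul (h2.mul h2'))

end DoubleWell

section WellExpansion
open Polynomial

theorem PTend.C {ι : Type*} {l : Filter ι} {c : ι → ℂ} {c0 : ℂ} (h : Tendsto c l (𝓝 c0)) :
    PTend l (fun t => C (c t)) (C c0) := by
  refine ⟨⟨0, Eventually.of_forall fun t => by simp⟩, fun j => ?_⟩
  rcases j with _ | j
  · simpa using h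
  · simpa using tendsto_const_nhds

theorem PTend.const {ι : Type*} {l : Filter ι} (q : ℂ[X]) : PTend l (fun _ => q) q :=
  ⟨⟨q.natDegree, Eventually.of_forall fun _ => le_rfl⟩, fun _ => tendsto_const_nhds⟩

theorem PTend.add {ι : Type*} {l : Filter ι} {p p' : ι → ℂ[X]} {q q' : ℂ[X]} (h : PTend l p q)
    (h' : PTend l p' q') : PTend l (fun t => p t + p' t) (q + q') := by
  obtain ⟨⟨d, hd⟩, hc⟩ := h
  obtain ⟨⟨d', hd'⟩, hc'⟩ := h'
  refine ⟨⟨max d d', ?_⟩, fun j => ?_⟩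
  · filter_upwards [hd, hd'] with t h1 h2
    exact (natDegree_add_le _ _).trans (max_le_max h1 h2)
  · simpa using (hc j).add (hc' j)

theorem PTend.mul {ι : Type*} {l : Filter ι} {p p' : ι → ℂ[X]} {q q' : ℂ[X]} (h : PTend l p q)
    (h' : PTend l p' q') : PTend l (fun t => p t * p' t) (q * q') := by
  obtain ⟨⟨d, hd⟩, hc⟩ := h
  obtain ⟨⟨d', hd'⟩, hc'⟩ := h'
  refine ⟨⟨d + d', ?_⟩, fun j => ?_⟩
  · filter_upwards [hd, hd'] with t h1 h2
    exact natDegree_mul_le.trans (add_le_add h1 h2)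
  · simp only [coeff_mul]
    exact tendsto_finsetSum _ fun i _ => (hc i.1).mul (hc' i.2)

theorem PTend.pow {ι : Type*} {l : Filter ι} {p : ι → ℂ[X]} {q : ℂ[X]} (h : PTend l p q)
    (n : ℕ) : PTend l (fun t => p t ^ n) (q ^ n) := by
  induction n with
  | zero => simpa using PTend.const (l := l) (1 : ℂ[X])
  | succ n ih => simpa only [pow_succ] using ih.mul h

theorem PTend.sum {ι : Type*} {l : Filter ι} (n : ℕ) {p : ℕ → ι → ℂ[X]} {q : ℕ → ℂ[X]}
    (h : ∀ i, PTend l (p i) (q i)) :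
    PTend l (fun t => ∑ i ∈ Finset.range n, p i t) (∑ i ∈ Finset.range n, q i) := by
  induction n with
  | zero => simpa using PTend.const (l := l) (0 : ℂ[X])
  | succ n ih => simpa only [Finset.sum_range_succ] using ih.add (h n)

/-- The quotient of `w ^ (k + 1) - (k + 1) w + k` by `(w - 1) ^ 2`. -/
noncomputable def wq {F : Type*} [Field F] (k : ℕ) (w : F) : F :=
  ∑ j ∈ Finset.range k, ((k : F) - j) * w ^ j

theorem wq_identity {F : Type*} [Field F] (k : ℕ) (w : F) :
    (w - 1) ^ 2 * wq k w = w ^ (k + 1) - (k + 1) * w + k := by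
  induction k with
  | zero => simp [wq]
  | succ k ih =>
    have h : wq (k + 1) w = wq k w + ∑ j ∈ Finset.range (k + 1), w ^ j := by
      simp only [wq]
      rw [Finset.sum_range_succ, Finset.sum_range_succ (fun j => w ^ j), ← add_assoc,
        ← Finset.sum_add_distrib]
      congr 1
      · exact Finset.sum_congr rfl fun j _ => by push_cast; ring
      · push_cast; ring
    have hg := geom_sum_mul w (k + 1)
    rw [h, mul_add, ih]
    have : (w - 1) ^ 2 * ∑ j ∈ Finset.range (k + 1), w ^ j = (w - 1) * (w ^ (k + 1) - 1) := by
      rw [← hg]; ring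
    rw [this]; push_cast; ring

theorem wq_ofReal (k : ℕ) (w : ℝ) : wq k (w : ℂ) = ((wq k w : ℝ) : ℂ) := by
  simp [wq]

theorem one_le_wq {k : ℕ} (hk : 1 ≤ k) {w : ℝ} (hw : 0 ≤ w) : 1 ≤ wq k w := by
  have h0 : (0 : ℕ) ∈ Finset.range k := Finset.mem_range.2 hk
  have h := Finset.single_le_sum (f := fun j : ℕ => ((k : ℝ) - j) * w ^ j) (fun j hj => by
    have : (j : ℝ) ≤ k := by exact_mod_cast (Finset.mem_range.1 hj).le
    exact mul_nonneg (by linarith) (pow_nonneg hw _)) h0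
  have hk' : (1 : ℝ) ≤ k := by exact_mod_cast hk
  simp only [wq]
  refine le_trans ?_ h
  simpa using hk'

theorem wq_mono (k : ℕ) {w w' : ℝ} (hw : 0 ≤ w) (h : w ≤ w') : wq k w ≤ wq k w' := by
  refine Finset.sum_le_sum fun j hj => ?_
  have : (j : ℝ) ≤ k := by exact_mod_cast (Finset.mem_range.1 hj).le
  exact mul_le_mul_of_nonneg_left (pow_le_pow_left₀ hw h _) (by linarith)

/-- The double well potential, in coordinates centred and scaled at its right well. -/
noncomputable def Rw (k : ℕ) (ε a E : ℂ) : ℂ[X] :=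
  X ^ 2 * (C 2 + C ε * X) ^ 2 *
    (∑ j ∈ Finset.range k, C ((k : ℂ) - j) * (C 1 + C ε * X) ^ (2 * j)) +
    C a * (C 1 + C ε * X) + C (-E)

theorem Rw_eval (k : ℕ) (ε a E z : ℂ) : (Rw k ε a E).eval z =
    z ^ 2 * (2 + ε * z) ^ 2 * wq k ((1 + ε * z) ^ 2) + a * (1 + ε * z) - E := by
  simp [Rw, wq, eval_finsetSum, pow_mul, sub_eq_add_neg]

theorem Rw_tend {ι : Type*} {l : Filter ι} (k : ℕ) {ε a E : ι → ℂ} {ε0 a0 E0 : ℂ}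
    (hε : Tendsto ε l (𝓝 ε0)) (ha : Tendsto a l (𝓝 a0)) (hE : Tendsto E l (𝓝 E0)) :
    PTend l (fun t => Rw k (ε t) (a t) (E t)) (Rw k ε0 a0 E0) := by
  have h1 : ∀ c : ℂ, PTend l (fun t => C c + C (ε t) * X) (C c + C ε0 * X) := fun c =>
    (PTend.const (C c)).add ((PTend.C hε).mul (PTend.const X))
  exact ((((PTend.const (X ^ 2)).mul ((h1 2).pow 2)).mul (PTend.sum k fun j =>
    (PTend.const _).mul ((h1 1).pow (2 * j)))).add ((PTend.C ha).mul (h1 1))).add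
    (PTend.C hE.neg)

theorem Rw_line (k : ℕ) (ε a E τ : ℂ) : Rw k ε a (E + τ) = Rw k ε a E + C τ * C (-1) := by
  refine Polynomial.funext fun z => ?_
  simp only [Rw_eval, eval_add, eval_mul, eval_C]; ring

theorem Rw_hol (k : ℕ) (ε a : ℂ) (Ω : Set ℂ) : PHol Ω (fun w => Rw k ε a w) := by
  have h := PHol.line (Rw k ε a 0) (C (-1)) Ω
  simpa only [← Rw_line, zero_add] using h

/-- The harmonic oscillator with energy `e`. -/
noncomputable def HO (k : ℕ) (e : ℂ) : ℂ[X] := Rw k 0 0 e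

theorem HO_eval (k : ℕ) (e z : ℂ) : (HO k e).eval z = 4 * wq k 1 * z ^ 2 - e := by
  simp [HO, Rw_eval]; ring

theorem HO_eval_re (k : ℕ) (e : ℂ) (x : ℝ) :
    ((HO k e).eval (x : ℂ)).re = 4 * wq k (1 : ℝ) * x ^ 2 - e.re ∧
    ((HO k e).eval (x : ℂ)).im = - e.im := by
  have : (HO k e).eval (x : ℂ) = ((4 * wq k (1 : ℝ) * x ^ 2 : ℝ) : ℂ) - e := by
    rw [HO_eval]; push_cast; rw [← wq_ofReal]; simp
  rw [this]; simp only [sub_re, sub_im, ofReal_re, ofReal_im]; simp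

theorem Rw_zero (k : ℕ) (a E : ℂ) : Rw k 0 a E = HO k (E - a) := by
  refine Polynomial.funext fun z => ?_
  simp [HO, Rw_eval]; ring

theorem Rw_eval_real (k : ℕ) (ε : ℝ) (a E : ℂ) (x : ℝ) : (Rw k ε a E).eval (x : ℂ) =
    ((x ^ 2 * (2 + ε * x) ^ 2 * wq k ((1 + ε * x) ^ 2) : ℝ) : ℂ) + a * ((1 + ε * x : ℝ) : ℂ) - E
        := by
  rw [Rw_eval]; push_cast; rw [← wq_ofReal]; push_cast; rfl

theorem Rw_eval_re (k : ℕ) (ε : ℝ) (a E : ℂ) (x : ℝ) : ((Rw k ε a E).eval (x : ℂ)).re =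
    x ^ 2 * (2 + ε * x) ^ 2 * wq k ((1 + ε * x) ^ 2) + a.re * (1 + ε * x) - E.re := by
  rw [Rw_eval_real, sub_re, add_re, re_mul_ofReal, ofReal_re]

theorem Rw_reflect (k : ℕ) {ε : ℂ} (hε : ε ≠ 0) (a E z : ℂ) :
    (Rw k ε (-a) E).eval z = (Rw k ε a E).eval (-z - 2 / ε) := by
  have h1 : ε * (-z - 2 / ε) = -(ε * z) - 2 := by field_simp
  have h2 : (-z - 2 / ε) ^ 2 * (2 + ε * (-z - 2 / ε)) ^ 2 = z ^ 2 * (2 + ε * z) ^ 2 := by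
    rw [h1]
    have : (-z - 2 / ε) ^ 2 * (ε * z) ^ 2 = z ^ 2 * (ε * (-z - 2 / ε)) ^ 2 := by ring
    rw [show 2 + (-(ε * z) - 2) = -(ε * z) by ring, neg_sq, this, h1]; ring
  rw [Rw_eval, Rw_eval, h2, h1, show (1 + (-(ε * z) - 2)) ^ 2 = (1 + ε * z) ^ 2 by ring]
  ring

section ScalingBounds
variable {k : ℕ} {M ε : ℝ} {a E : ℂ}

theorem abs_re_lt {z : ℂ} (h : ‖z‖ < M) : -M ≤ z.re ∧ z.re ≤ M :=
  abs_le.1 ((abs_re_le_norm z).trans h.le)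

theorem Rw_adm (hk : 1 ≤ k) (hM : 0 < M) (hε : 0 < ε) (hε1 : ε ≤ 1)
    (ha : ‖a‖ < M) (hE : ‖E‖ < M) : Adm (qR (2 * M + 1) (Rw k ε a E)) := by
  intro x hx
  rw [qR_eval, ← ofReal_add, Rw_eval_re]
  obtain ⟨a1, a2⟩ := abs_re_lt ha
  obtain ⟨e1, e2⟩ := abs_re_lt hE
  set u := x + (2 * M + 1) with hu
  have hu1 : 2 * M + 1 ≤ u := by linarith
  have hu0 : 0 ≤ u := by linarith
  have hw := one_le_wq hk (sq_nonneg (1 + ε * u))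
  have hεu : 0 ≤ ε * u := by positivity
  have hεu' : ε * u ≤ u := by nlinarith
  have h4 : (4 : ℝ) ≤ (2 + ε * u) ^ 2 := by nlinarith
  have h5 : 4 * u ^ 2 ≤ u ^ 2 * (2 + ε * u) ^ 2 * wq k ((1 + ε * u) ^ 2) := by
    have : u ^ 2 * 4 * 1 ≤ u ^ 2 * (2 + ε * u) ^ 2 * wq k ((1 + ε * u) ^ 2) := by gcongr
    linarith
  have h6 : -M * (1 + u) ≤ a.re * (1 + ε * u) := by
    have : -M * (1 + ε * u) ≤ a.re * (1 + ε * u) := mul_le_mul_of_nonneg_right a1 (by linarith)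
    nlinarith
  nlinarith

theorem Rw_barrier (hk : 1 ≤ k) (hM : 0 < M) (hε : 0 < ε) (hε1 : ε * (2 * M + 1) ≤ 1)
    (ha : ‖a‖ < M) (hE : ‖E‖ < M) : ∀ x ∈ Set.Icc 0 (2 / ε - 2 * (2 * M + 1)),
      1 ≤ ((qL (2 * M + 1) (Rw k ε a E)).eval (x : ℂ)).re := by
  rintro x ⟨hx0, hx1⟩
  have e : -(x : ℂ) - ((2 * M + 1 : ℝ) : ℂ) = ((-(x + (2 * M + 1)) : ℝ) : ℂ) := by push_cast; ring
  rw [qL_eval, e, Rw_eval_re]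
  obtain ⟨a1, a2⟩ := abs_re_lt ha
  obtain ⟨e1, e2⟩ := abs_re_lt hE
  set u := x + (2 * M + 1) with hu
  have hu1 : 2 * M + 1 ≤ u := by linarith
  have hu2 : ε * (u + (2 * M + 1)) ≤ 2 := by
    have : u + (2 * M + 1) ≤ 2 / ε := by linarith
    rwa [le_div_iff₀ hε, mul_comm] at this
  have hw := one_le_wq hk (sq_nonneg (1 + ε * -u))
  have h3 : 2 * M + 1 ≤ u * (2 - ε * u) := by
    nlinarith [mul_nonneg (sub_nonneg.2 hu1) (sub_nonneg.2 hu2)]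
  have h4 : (2 * M + 1) ^ 2 ≤ (-u) ^ 2 * (2 + ε * -u) ^ 2 * wq k ((1 + ε * -u) ^ 2) := by
    have : (2 * M + 1) ^ 2 * 1 ≤ (u * (2 - ε * u)) ^ 2 * wq k ((1 + ε * -u) ^ 2) := by gcongr
    calc _ = (2 * M + 1) ^ 2 * 1 := by ring
      _ ≤ _ := this
      _ = _ := by ring
  have h5 : |1 + ε * -u| ≤ 1 := by
    have : 0 ≤ ε * u := by positivity
    rw [abs_le]; constructor <;> nlinarith
  have h6 : -M ≤ a.re * (1 + ε * -u) := by
    have : |a.re * (1 + ε * -u)| ≤ M * 1 := by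
      rw [abs_mul]; exact mul_le_mul (abs_le.2 ⟨a1, a2⟩) h5 (abs_nonneg _) hM.le
    linarith [(abs_le.1 this).1]
  nlinarith

theorem HO_admR (hk : 1 ≤ k) (hM : 0 < M) {e : ℂ} (he : ‖e‖ < 2 * M) :
    AdmR (2 * M + 1) (HO k e) := by
  intro x hx
  rw [(HO_eval_re k e x).1]
  obtain ⟨e1, e2⟩ := abs_re_lt he
  have hw := one_le_wq hk zero_le_one
  have : (2 * M + 1) ^ 2 ≤ x ^ 2 := by
    rw [← sq_abs x]; gcongr
  nlinarith

theorem HO_coer2 (hk : 1 ≤ k) (e : ℂ) : Coer2 (HO k e) := by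
  have hw := one_le_wq hk zero_le_one
  have key : Tendsto (fun x : ℝ => 4 * wq k (1 : ℝ) * x ^ 2 - e.re) atTop atTop := by
    exact tendsto_atTop_add_const_right _ _
      ((tendsto_pow_atTop two_ne_zero).const_mul_atTop (by linarith))
  constructor
  · exact key.congr fun x => ((HO_eval_re k e x).1).symm
  · refine key.congr fun x => ?_
    rw [aff_eval, show (-1 * (x : ℂ) + 0) = ((-x : ℝ) : ℂ) by push_cast; ring, (HO_eval_re k e _).1]
    ring

end ScalingBounds

end WellExpansion

section Scaling
open Polynomial

theorem tendsto_affine_atTop {s : ℝ} (hs : 0 < s) (r : ℝ) :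
    Tendsto (fun x : ℝ => s * x + r) atTop atTop :=
  tendsto_atTop_add_const_right _ _ (tendsto_id.const_mul_atTop hs)

theorem tendsto_affine_atBot {s : ℝ} (hs : 0 < s) (r : ℝ) :
    Tendsto (fun x : ℝ => s * x + r) atBot atBot :=
  tendsto_atBot_add_const_right _ _ (tendsto_id.const_mul_atBot hs)

theorem Bd.affine {q : ℂ[X]} (h : Bd q) {s : ℝ} (hs : 0 < s) (r : ℝ) :
    Bd (C ((s : ℂ) ^ 2) * aff s r q) := by
  obtain ⟨y, v, hy, hne, ht, hb⟩ := h
  refine ⟨_, _, hy.aff s r, ?_, ?_, ?_⟩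
  · intro h0
    apply hne
    have hs' : (s : ℂ) ≠ 0 := by exact_mod_cast hs.ne'
    funext z
    have := congrFun h0 ((z - r) / s)
    simpa [mul_div_cancel₀ _ hs'] using this
  · simpa [Function.comp_def] using ht.comp (tendsto_affine_atTop hs r)
  · simpa [Function.comp_def] using hb.comp (tendsto_affine_atBot hs r)

theorem NZ.affine {q : ℂ[X]} {n : ℕ} (h : NZ n q) {s : ℝ} (hs : 0 < s) (r : ℝ) :
    NZ n (C ((s : ℂ) ^ 2) * aff s r q) := by
  obtain ⟨y, v, hy, hne, ht, hZ⟩ := h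
  refine ⟨_, _, hy.aff s r, ?_, ?_, ?_⟩
  · intro h0
    apply hne
    have hs' : (s : ℂ) ≠ 0 := by exact_mod_cast hs.ne'
    funext z
    have := congrFun h0 ((z - r) / s)
    simpa [mul_div_cancel₀ _ hs'] using this
  · simpa [Function.comp_def] using ht.comp (tendsto_affine_atTop hs r)
  · rintro ⟨f, hf, h0⟩
    refine hZ ⟨fun i => s * f i + r, fun i j hij => ?_, fun i => ?_⟩
    · have := mul_lt_mul_of_pos_left (hf hij) hs
      simpa using this
    · have := h0 i
      push_cast
      exact this

theorem Coer.affine {q : ℂ[X]} (h : Coer q) {s : ℝ} (hs : 0 < s) (r : ℝ) :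
    Coer (C ((s : ℂ) ^ 2) * aff s r q) := by
  refine ((h.comp (tendsto_affine_atTop hs r)).const_mul_atTop (by positivity : 0 < s ^ 2)).congr
    fun x => ?_
  rw [eval_mul, eval_C, aff_eval, ← ofReal_pow, re_ofReal_mul]
  simp

theorem Coer2.affine {q : ℂ[X]} (h : Coer2 q) {s : ℝ} (hs : 0 < s) (r : ℝ) :
    Coer2 (C ((s : ℂ) ^ 2) * aff s r q) := by
  refine ⟨h.1.affine hs r, ?_⟩
  have h2 := Coer.affine h.2 hs (-r)
  convert h2 using 1
  refine Polynomial.funext fun z => ?_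
  simp only [aff_eval, eval_mul, eval_C]
  congr 2
  push_cast; ring

/-- The scaling factor relating the double well to a monic potential of degree `2 k + 2`. -/
noncomputable def mu (k : ℕ) (ε : ℝ) : ℝ := ε ^ ((4 : ℝ) / (2 * k + 4))

theorem mu_pos (k : ℕ) {ε : ℝ} (hε : 0 < ε) : 0 < mu k ε := Real.rpow_pos_of_pos hε _

theorem mu_pow (k : ℕ) {ε : ℝ} (hε : 0 < ε) : mu k ε ^ (2 * k + 4) = ε ^ 4 := by
  rw [mu, ← Real.rpow_natCast, ← Real.rpow_mul hε.le, ← Real.rpow_natCast]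
  congr 1
  push_cast
  field_simp

/-- The coefficients of the rescaled double well, tilted by `a`, as a monic potential. -/
noncomputable def Pa (k n : ℕ) (ε : ℝ) (a : ℂ) : Fin n → ℂ := fun i =>
  if (i : ℕ) = 0 then (mu k ε : ℂ) ^ 3 / ε ^ 2 * a
  else if (i : ℕ) = 1 then -((k : ℂ) + 1) * (mu k ε : ℂ) ^ 4 / ε ^ 4 else 0

/-- The eigenvalue of the monic potential `Pa` corresponding to the energy `E`. -/
noncomputable def Pe (k : ℕ) (ε : ℝ) (E : ℂ) : ℂ :=
  (mu k ε : ℂ) ^ 2 / ε ^ 2 * (E - k / ε ^ 2)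

theorem Pa_real (k n : ℕ) (ε a : ℝ) (i : Fin n) : (Pa k n ε (a : ℂ) i).im = 0 := by
  unfold Pa
  split_ifs <;> norm_cast

theorem sum_first_two {n : ℕ} (hn : 2 ≤ n) (a b z : ℂ) :
    ∑ i : Fin n, (if (i : ℕ) = 0 then a else if (i : ℕ) = 1 then b else 0) * z ^ ((i : ℕ) + 1) =
      a * z + b * z ^ 2 := by
  obtain ⟨n, rfl⟩ := Nat.exists_eq_add_of_le' hn
  rw [Fin.sum_univ_succ, Fin.sum_univ_succ]
  simp

theorem PolP_eq_aff {k : ℕ} (hk : 1 ≤ k) {ε : ℝ} (hε : 0 < ε) (a E : ℂ) :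
    PolP (2 * k + 2) (Pa k _ ε a, Pe k ε E) =
      C (((mu k ε / ε : ℝ) : ℂ) ^ 2) * aff (mu k ε / ε : ℝ) (-1 / ε : ℝ) (Rw k ε a E) := by
  have hε' : (ε : ℂ) ≠ 0 := by exact_mod_cast hε.ne'
  refine Polynomial.funext fun z => ?_
  rw [PolP_eval, eval_mul, eval_C, aff_eval, Rw_eval]
  have h1 : 1 + (ε : ℂ) * (((mu k ε / ε : ℝ) : ℂ) * z + ((-1 / ε : ℝ) : ℂ)) = mu k ε * z := by
    push_cast; field_simp; ring
  have hw := wq_identity k (((mu k ε : ℂ) * z) ^ 2)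
  have hmu : (mu k ε : ℂ) ^ (2 * k + 4) = ε ^ 4 := by exact_mod_cast mu_pow k hε
  have h2 : (ε : ℂ) ^ 2 * ((((mu k ε / ε : ℝ) : ℂ) * z + ((-1 / ε : ℝ) : ℂ)) ^ 2 *
      (2 + (ε : ℂ) * (((mu k ε / ε : ℝ) : ℂ) * z + ((-1 / ε : ℝ) : ℂ))) ^ 2) =
      (((mu k ε : ℂ) * z) ^ 2 - 1) ^ 2 := by
    rw [← h1]; ring
  set u := ((mu k ε / ε : ℝ) : ℂ) * z + ((-1 / ε : ℝ) : ℂ) with hu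
  have h3 : u ^ 2 * (2 + (ε : ℂ) * u) ^ 2 * wq k (((mu k ε : ℂ) * z) ^ 2) =
      ((((mu k ε : ℂ) * z) ^ 2) ^ (k + 1) - (k + 1) * ((mu k ε : ℂ) * z) ^ 2 + k) / ε ^ 2 := by
    rw [← hw, eq_div_iff (pow_ne_zero 2 hε'), ← h2]; ring
  rw [h1, h3, Pol]
  simp only [Pa]
  rw [sum_first_two (by omega)]
  have h4 : (mu k ε : ℂ) ^ 2 * (((mu k ε : ℂ) * z) ^ 2) ^ (k + 1) = ε ^ 4 * z ^ (2 * k + 2) := by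
    rw [← hmu]; ring
  have h5 : z ^ (2 * k + 2) = (mu k ε : ℂ) ^ 2 * (((mu k ε : ℂ) * z) ^ 2) ^ (k + 1) / ε ^ 4 := by
    rw [h4]; field_simp
  rw [h5, Pe]
  push_cast
  field_simp
  ring

theorem Rw_eq_aff {k : ℕ} (hk : 1 ≤ k) {ε : ℝ} (hε : 0 < ε) (a E : ℂ) :
    Rw k ε a E = C (((ε / mu k ε : ℝ) : ℂ) ^ 2) * aff (ε / mu k ε : ℝ) (1 / mu k ε : ℝ)
      (PolP (2 * k + 2) (Pa k _ ε a, Pe k ε E)) := by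
  have hε' : (ε : ℂ) ≠ 0 := by exact_mod_cast hε.ne'
  have hm' : (mu k ε : ℂ) ≠ 0 := by exact_mod_cast (mu_pos k hε).ne'
  refine Polynomial.funext fun z => ?_
  rw [PolP_eq_aff hk hε, eval_mul, eval_C, aff_eval, eval_mul, eval_C, aff_eval]
  have h1 : ((mu k ε / ε : ℝ) : ℂ) * (((ε / mu k ε : ℝ) : ℂ) * z + ((1 / mu k ε : ℝ) : ℂ)) +
      ((-1 / ε : ℝ) : ℂ) = z := by
    push_cast; field_simp; ring
  rw [h1]
  push_cast; field_simp

theorem mem_Sg_iff_Rw {k : ℕ} (hk : 1 ≤ k) {ε : ℝ} (hε : 0 < ε) (a E : ℂ) :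
    (Pa k _ ε a, Pe k ε E) ∈ Sg (2 * k + 2) ↔ Bd (Rw k ε a E) := by
  constructor
  · intro h
    rw [Rw_eq_aff hk hε]
    exact Bd.affine h (div_pos hε (mu_pos k hε)) _
  · intro h
    change Bd _
    rw [PolP_eq_aff hk hε]
    exact h.affine (div_pos (mu_pos k hε) hε) _

theorem Rw_coer2 {k : ℕ} (hk : 1 ≤ k) {ε : ℝ} (hε : 0 < ε) (a E : ℂ) : Coer2 (Rw k ε a E) := by
  rw [Rw_eq_aff hk hε]
  exact (PolP_coer (by omega) ⟨k + 1, by omega⟩ _).affine (div_pos hε (mu_pos k hε)) _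

theorem Pe_surj (k : ℕ) {ε : ℝ} (hε : 0 < ε) (lam : ℂ) (hl : lam.im = 0) :
    ∃ E : ℝ, Pe k ε E = lam := by
  have hε' : (ε : ℂ) ≠ 0 := by exact_mod_cast hε.ne'
  have hm' : (mu k ε : ℂ) ≠ 0 := by exact_mod_cast (mu_pos k hε).ne'
  have hl' : ((lam.re : ℝ) : ℂ) = lam := by apply Complex.ext <;> simp [hl]
  refine ⟨lam.re * ε ^ 2 / mu k ε ^ 2 + k / ε ^ 2, ?_⟩
  rw [Pe]; push_cast; rw [hl']; field_simp; ring

theorem Rw_lower {k : ℕ} (hk : 1 ≤ k) {ε : ℝ} (hε : 0 < ε) (hε1 : ε ≤ 1) {a E : ℝ} (ha : |a| ≤ 1)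
    (hb : Bd (Rw k ε a E)) : -2 ≤ E := by
  by_contra! hE
  obtain ⟨Y, V, h⟩ := hb.exists_EF (Rw_coer2 hk hε _ _)
  refine h.not_re_pos fun x => ?_
  rw [Rw_eval_re, ofReal_re, ofReal_re]
  obtain ⟨a1, a2⟩ := abs_le.1 ha
  set ζ := 1 + ε * x with hζ
  have hw := one_le_wq hk (sq_nonneg ζ)
  have h1 : (ζ ^ 2 - 1) ^ 2 ≤ x ^ 2 * (2 + ε * x) ^ 2 := by
    have e : (ζ ^ 2 - 1) ^ 2 = ε ^ 2 * (x ^ 2 * (2 + ε * x) ^ 2) := by rw [hζ]; ring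
    rw [e]
    exact mul_le_of_le_one_left (by positivity) (by nlinarith)
  have h2 : (ζ ^ 2 - 1) ^ 2 ≤ x ^ 2 * (2 + ε * x) ^ 2 * wq k (ζ ^ 2) :=
    h1.trans (le_mul_of_one_le_right (by positivity) hw)
  have h3 : -|ζ| ≤ a * ζ := by
    have : |a * ζ| ≤ 1 * |ζ| := by rw [abs_mul]; gcongr
    linarith [neg_abs_le (a * ζ)]
  have h4 : |ζ| ≤ (1 + ζ ^ 2) / 2 := by nlinarith [sq_abs ζ, sq_nonneg (|ζ| - 1)]
  nlinarith [sq_nonneg (ζ ^ 2 - 5 / 4)]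

theorem Rw_upper {k : ℕ} (hk : 1 ≤ k) (n : ℕ) : ∃ B : ℝ, ∀ ε : ℝ, 0 < ε → ε ≤ 1 →
    ∀ a E : ℝ, |a| ≤ 1 → NZ n (Rw k ε a E) → E ≤ B := by
  set K : ℝ := 4 * (n + 1) with hK
  have hK0 : 0 ≤ K := by positivity
  refine ⟨1 + (K ^ 2 * (2 + K) ^ 2 * wq k ((1 + K) ^ 2) + (1 + K)), fun ε hε hε1 a E ha hn => ?_⟩
  obtain ⟨x, ⟨hx0, hx1⟩, hx⟩ := hn.exists_gt (Rw_coer2 hk hε _ _) (fun x => by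
    rw [Rw_eval_real, sub_im, add_im, im_mul_ofReal, ofReal_im, ofReal_im, ofReal_im]; ring) 0
  rw [zero_add] at hx1
  rw [Rw_eval_re, ofReal_re, ofReal_re] at hx
  have hεx0 : 0 ≤ ε * x := by positivity
  have hεx : ε * x ≤ K := by nlinarith
  have h1 : wq k ((1 + ε * x) ^ 2) ≤ wq k ((1 + K) ^ 2) := wq_mono k (sq_nonneg _) (by gcongr)
  have h0 : 0 ≤ wq k ((1 + ε * x) ^ 2) := zero_le_one.trans (one_le_wq hk (sq_nonneg _))
  have h2 : x ^ 2 * (2 + ε * x) ^ 2 * wq k ((1 + ε * x) ^ 2) ≤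
      K ^ 2 * (2 + K) ^ 2 * wq k ((1 + K) ^ 2) := by gcongr
  have h3 : a * (1 + ε * x) ≤ 1 + K := by
    have : a * (1 + ε * x) ≤ 1 * (1 + ε * x) :=
      mul_le_mul_of_nonneg_right (abs_le.1 ha).2 (by linarith)
    linarith
  linarith

theorem exists_E_bound {k : ℕ} (hk : 1 ≤ k) (n : ℕ) : ∃ B : ℝ, ∀ ε : ℝ, 0 < ε → ε ≤ 1 →
    ∀ a : ℝ, |a| ≤ 1 → ∀ lam : ℂ, (Pa k _ ε a, lam) ∈ Sg (2 * k + 2) →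
      NZ n (PolP (2 * k + 2) (Pa k _ ε a, lam)) →
      ∃ E : ℝ, lam = Pe k ε E ∧ |E| ≤ B := by
  obtain ⟨B, hB⟩ := Rw_upper hk n
  refine ⟨max 2 B, fun ε hε hε1 a ha lam hS hn => ?_⟩
  obtain ⟨hl, -⟩ := realPoly_of_real (d := 2 * k + 2) (by omega) ⟨k + 1, by omega⟩ hS
    fun i => Pa_real k _ ε a i
  obtain ⟨E, rfl⟩ := Pe_surj k hε lam hl
  refine ⟨E, rfl, abs_le.2 ⟨?_, ?_⟩⟩
  · have := Rw_lower hk hε hε1 ha ((mem_Sg_iff_Rw hk hε _ _).1 hS)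
    linarith [le_max_left 2 B]
  · refine le_trans (hB ε hε hε1 a E ha ?_) (le_max_right _ _)
    rw [Rw_eq_aff hk hε]
    exact hn.affine (div_pos hε (mu_pos k hε)) _

end Scaling

section LimitSpectrum
open Polynomial

/-- The spectrum of the harmonic oscillator. -/
def ZH (k : ℕ) : Set ℂ := {e | Bd (HO k e)}

theorem ZH_im {k : ℕ} (hk : 1 ≤ k) {e : ℂ} (he : e ∈ ZH k) : e.im = 0 := by
  obtain ⟨Y, V, h⟩ := Bd.exists_EF (HO_coer2 hk e) he
  have := h.im_eq_zero fun x => (HO_eval_re k e x).2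
  simpa using this

theorem ZH_nonempty {k : ℕ} (hk : 1 ≤ k) : (ZH k).Nonempty := by
  have hw := one_le_wq hk zero_le_one
  obtain ⟨ω, hω, hω2⟩ : ∃ ω : ℝ, 0 < ω ∧ ω ^ 2 = 4 * wq k (1 : ℝ) :=
    ⟨√(4 * wq k (1 : ℝ)), Real.sqrt_pos.2 (by linarith), Real.sq_sqrt (by linarith)⟩
  have hω3 : (ω : ℂ) ^ 2 = 4 * wq k (1 : ℂ) := by
    have := wq_ofReal k 1
    rw [ofReal_one] at this
    rw [this]; exact_mod_cast hω2
  have hlim : Tendsto (fun x : ℝ => Real.exp (-(ω / 2) * x ^ 2)) atTop (𝓝 0) := by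
    refine Real.tendsto_exp_atBot.comp ?_
    exact (tendsto_pow_atTop two_ne_zero).const_mul_atTop_of_neg (by linarith)
  have hnorm : ∀ x : ℝ, ‖Complex.exp (-(ω / 2) * (x : ℂ) ^ 2)‖ = Real.exp (-(ω / 2) * x ^ 2) := by
    intro x
    rw [Complex.norm_exp]
    congr 1
    have : (-(ω / 2) * (x : ℂ) ^ 2) = ((-(ω / 2) * x ^ 2 : ℝ) : ℂ) := by push_cast; ring
    rw [this, ofReal_re]
  refine ⟨(ω : ℂ), fun z => Complex.exp (-(ω / 2) * z ^ 2),
    fun z => -ω * z * Complex.exp (-(ω / 2) * z ^ 2), ?_, ?_, ?_, ?_⟩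
  · intro z
    have h1 : HasDerivAt (fun z : ℂ => Complex.exp (-(ω / 2) * z ^ 2))
        (-ω * z * Complex.exp (-(ω / 2) * z ^ 2)) z :=
      (((hasDerivAt_pow 2 z).const_mul (-((ω : ℂ) / 2))).cexp).congr_deriv (by push_cast; ring)
    refine ⟨h1, ((((hasDerivAt_id z).const_mul (-(ω : ℂ))).mul h1)).congr_deriv ?_⟩
    rw [HO_eval, ← hω3]; simp only [id]; ring
  · intro h
    exact Complex.exp_ne_zero _ (congrFun h 0)
  · refine tendsto_zero_iff_norm_tendsto_zero.2 (hlim.congr fun x => (hnorm x).symm)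
  · refine tendsto_zero_iff_norm_tendsto_zero.2 ((hlim.comp tendsto_neg_atBot_atTop).congr
      fun x => ?_)
    rw [hnorm]; simp

theorem HO_line (k : ℕ) (e τ : ℂ) : HO k (e + τ) = HO k e + C τ * C (-1) := Rw_line k 0 0 e τ

theorem FF_HO {k : ℕ} (hk : 1 ≤ k) {M : ℝ} (hM : 0 < M) :
    DifferentiableOn ℂ (fun e => FF (2 * M + 1) (HO k e)) (Metric.ball 0 (2 * M)) ∧
    (∀ e ∈ Metric.ball (0 : ℂ) (2 * M), FF (2 * M + 1) (HO k e) = 0 ↔ e ∈ ZH k) ∧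
    ∀ e ∈ Metric.ball (0 : ℂ) (2 * M), FF (2 * M + 1) (HO k e) = 0 →
      deriv (fun e => FF (2 * M + 1) (HO k e)) e ≠ 0 := by
  have hr : 0 ≤ 2 * M + 1 := by linarith
  have hA : ∀ e ∈ Metric.ball (0 : ℂ) (2 * M), AdmR (2 * M + 1) (HO k e) := fun e he =>
    HO_admR hk hM (mem_ball_zero_iff.1 he)
  refine ⟨FF_hol Metric.isOpen_ball (Rw_hol k 0 0 _) hr hA, fun e he => ?_, fun e he h0 => ?_⟩
  · exact (Bd_iff hr (hA e he)).symm
  · obtain ⟨κ, hκ, Y, V, hS, hne, h1, h2, h3⟩ := FF_deriv hr h0 (hA e he) (HO_coer2 hk e)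
    obtain ⟨ρ, hρ, hball⟩ := Metric.isOpen_iff.1 Metric.isOpen_ball e he
    have hE : EF (HO k e) Y V := ⟨hS, hne, h1, h2⟩
    have hmem : ∀ τ ∈ Metric.ball (0 : ℂ) ρ, e + τ ∈ Metric.ball (0 : ℂ) (2 * M) := fun τ hτ =>
      hball (by simpa [dist_eq_norm] using hτ)
    have hd := h3 (C (-1)) ρ hρ (fun τ hτ => by rw [← HO_line]; exact hA _ (hmem τ hτ))
      (fun τ hτ => by rw [← HO_line]; exact HO_coer2 hk _)
    simp only [← HO_line, eval_C] at hd
    have hd' : HasDerivAt (fun e => FF (2 * M + 1) (HO k e))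
        (κ * ∫ x : ℝ, -1 * (Y x * Y x)) e := by
      have hd0 : HasDerivAt (fun τ => FF (2 * M + 1) (HO k (e + τ)))
          (κ * ∫ x : ℝ, -1 * (Y x * Y x)) (e - e) := by rwa [sub_self]
      simpa using hd0.comp_sub_const e e
    rw [hd'.deriv]
    refine mul_ne_zero hκ ?_
    rw [MeasureTheory.integral_const_mul]
    refine mul_ne_zero (by norm_num) (hE.integral_sq_ne_zero fun x => ?_)
    rw [(HO_eval_re k e x).2, ZH_im hk hE.bd, neg_zero]

theorem exists_splitting {k : ℕ} (hk : 1 ≤ k) {M : ℝ} (hM : 0 < M) :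
    ∃ (G : ℝ → ℂ → ℂ → ℂ) (c : ℂ → ℂ),
      (∀ᶠ ε : ℝ in 𝓝[>] 0, ∀ a E : ℂ, ‖a‖ < M → ‖E‖ < M →
        ((Pa k _ ε a, Pe k ε E) ∈ Sg (2 * k + 2) ↔ G ε a E = 0)) ∧
      (∀ᶠ ε : ℝ in 𝓝[>] 0, ∀ a : ℂ, ‖a‖ < M → DifferentiableOn ℂ (G ε a) (Metric.ball 0 M)) ∧
      (∀ a E : ℂ, ‖a‖ < M → ‖E‖ < M →
        Tendsto (fun p : (ℝ × ℂ) × ℂ => G p.1.1 p.1.2 p.2) ((𝓝[>] 0 ×ˢ 𝓝 a) ×ˢ 𝓝 E)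
          (𝓝 (c (E - a) * c (E + a)))) ∧
      DifferentiableOn ℂ c (Metric.ball 0 (2 * M)) ∧
      (∀ e ∈ Metric.ball (0 : ℂ) (2 * M), c e = 0 ↔ e ∈ ZH k) ∧
      ∀ e ∈ Metric.ball (0 : ℂ) (2 * M), c e = 0 → deriv c e ≠ 0 := by
  obtain ⟨f1, f2, f3⟩ := FF_HO hk hM
  have hr : 0 ≤ 2 * M + 1 := by linarith
  have hsmall : ∀ᶠ ε : ℝ in 𝓝[>] 0, 0 < ε ∧ ε ≤ 1 ∧ ε * (2 * M + 1) ≤ 1 := by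
    have h1 : ∀ᶠ ε : ℝ in 𝓝[>] 0, ε < (2 * M + 1)⁻¹ :=
      nhdsWithin_le_nhds (gt_mem_nhds (by positivity))
    filter_upwards [h1, self_mem_nhdsWithin] with ε h1 h2
    have h3 : ε * (2 * M + 1) ≤ 1 := by
      rw [← le_div_iff₀ (by linarith), one_div]; exact h1.le
    have h2 : 0 < ε := h2
    exact ⟨h2, by nlinarith, h3⟩
  have hN0 : ∀ ε : ℝ, 0 < ε → ε * (2 * M + 1) ≤ 1 → 0 ≤ 2 / ε - 2 * (2 * M + 1) := by
    intro ε h1 h2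
    rw [sub_nonneg, le_div_iff₀ h1]; linarith
  refine ⟨fun ε a E => GG (2 * M + 1) (2 / ε - 2 * (2 * M + 1)) (Rw k ε a E) (Rw k ε (-a) E),
    fun e => FF (2 * M + 1) (HO k e), ?_, ?_, ?_, f1, f2, f3⟩
  · filter_upwards [hsmall] with ε ⟨h1, h2, h3⟩ a E ha hE
    rw [mem_Sg_iff_Rw hk h1]
    refine GG_iff (hN0 ε h1 h3) (fun z => ?_) (Rw_adm hk hM h1 h2 ha hE)
      (Rw_adm hk hM h1 h2 (by rwa [norm_neg]) hE)
      (fun x hx => zero_le_one.trans (Rw_barrier hk hM h1 h3 ha hE x hx))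
    rw [Rw_reflect k (by exact_mod_cast h1.ne')]
    congr 1
    push_cast; ring
  · filter_upwards [hsmall] with ε ⟨h1, h2, h3⟩ a ha
    have hb : ∀ w ∈ Metric.ball (0 : ℂ) M, ‖w‖ < M := fun w hw => mem_ball_zero_iff.1 hw
    have ha' : ‖-a‖ < M := by rwa [norm_neg]
    exact GG_hol Metric.isOpen_ball (Rw_hol k ε a _) (Rw_hol k ε (-a) _) (hN0 ε h1 h3)
      (fun w hw => Rw_adm hk hM h1 h2 ha (hb w hw)) (fun w hw => Rw_adm hk hM h1 h2 ha' (hb w hw))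
      (fun w hw x hx => zero_le_one.trans (Rw_barrier hk hM h1 h3 ha (hb w hw) x hx))
      (fun w hw x hx => zero_le_one.trans (Rw_barrier hk hM h1 h3 ha' (hb w hw) x hx))
  · intro a E ha hE
    set l : Filter ((ℝ × ℂ) × ℂ) := (𝓝[>] 0 ×ˢ 𝓝 a) ×ˢ 𝓝 E with hl
    have tε : Tendsto (fun p : (ℝ × ℂ) × ℂ => p.1.1) l (𝓝[>] 0) := tendsto_fst.comp tendsto_fst
    have ta : Tendsto (fun p : (ℝ × ℂ) × ℂ => p.1.2) l (𝓝 a) := tendsto_snd.comp tendsto_fst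
    have tE : Tendsto (fun p : (ℝ × ℂ) × ℂ => p.2) l (𝓝 E) := tendsto_snd
    have tε' : Tendsto (fun p : (ℝ × ℂ) × ℂ => (p.1.1 : ℂ)) l (𝓝 0) := by
      have := (continuous_ofReal.tendsto 0).comp (tε.mono_right nhdsWithin_le_nhds)
      simpa [Function.comp_def] using this
    have hn : ∀ z : ℂ, ‖z‖ < M → ∀ᶠ w in 𝓝 z, ‖w‖ < M := fun z hz =>
      continuous_norm.continuousAt.eventually (gt_mem_nhds hz)
    have hev : ∀ᶠ p : (ℝ × ℂ) × ℂ in l, (0 < p.1.1 ∧ p.1.1 ≤ 1 ∧ p.1.1 * (2 * M + 1) ≤ 1) ∧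
        ‖p.1.2‖ < M ∧ ‖p.2‖ < M :=
      (tε.eventually hsmall).and ((ta.eventually (hn a ha)).and (tE.eventually (hn E hE)))
    have hP := Rw_tend k tε' ta tE
    have hP' := Rw_tend k tε' ta.neg tE
    rw [Rw_zero] at hP hP'
    rw [sub_neg_eq_add] at hP'
    refine GG_tendsto hr hP hP' (HO_admR hk hM ?_) (HO_admR hk hM ?_) ?_ ?_ ?_ ?_ ?_
    · linarith [norm_sub_le E a]
    · linarith [norm_add_le E a]
    · refine tendsto_atTop_add_const_right _ _ ?_
      simp only [div_eq_mul_inv]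
      exact (tendsto_inv_nhdsGT_zero.comp tε).const_mul_atTop two_pos
    · filter_upwards [hev] with p ⟨⟨h1, h2, h3⟩, h4, h5⟩
      exact Rw_adm hk hM h1 h2 h4 h5
    · filter_upwards [hev] with p ⟨⟨h1, h2, h3⟩, h4, h5⟩
      exact Rw_adm hk hM h1 h2 (by rwa [norm_neg]) h5
    · filter_upwards [hev] with p ⟨⟨h1, h2, h3⟩, h4, h5⟩
      exact Rw_barrier hk hM h1 h3 h4 h5
    · filter_upwards [hev] with p ⟨⟨h1, h2, h3⟩, h4, h5⟩
      exact Rw_barrier hk hM h1 h3 (by rwa [norm_neg]) h5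

theorem ZH_isClosed {k : ℕ} (hk : 1 ≤ k) : IsClosed (ZH k) := by
  rw [← isOpen_compl_iff, isOpen_iff_mem_nhds]
  intro e he
  have hM : 0 < ‖e‖ + 1 := by positivity
  obtain ⟨f1, f2, -⟩ := FF_HO hk hM
  have heb : e ∈ Metric.ball (0 : ℂ) (2 * (‖e‖ + 1)) := by
    rw [mem_ball_zero_iff]; linarith [norm_nonneg e]
  have hb := Metric.isOpen_ball.mem_nhds heb
  have hc := (f1.continuousOn.continuousAt hb).eventually_ne (fun h => he ((f2 e heb).1 h))
  filter_upwards [hc, hb] with z h1 h2 h3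
  exact h1 ((f2 z h2).2 h3)

theorem ZH_isolated {k : ℕ} (hk : 1 ≤ k) (e : ℂ) : ∀ᶠ z in 𝓝[≠] e, z ∉ ZH k := by
  by_cases he : e ∈ ZH k
  · have hM : 0 < ‖e‖ + 1 := by positivity
    obtain ⟨f1, f2, f3⟩ := FF_HO hk hM
    have heb : e ∈ Metric.ball (0 : ℂ) (2 * (‖e‖ + 1)) := by
      rw [mem_ball_zero_iff]; linarith [norm_nonneg e]
    have hb := Metric.isOpen_ball.mem_nhds heb
    have h0 := (f2 e heb).2 he
    have := (f1.differentiableAt hb).hasDerivAt.eventually_ne (c := 0) (f3 e heb h0)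
    filter_upwards [this, nhdsWithin_le_nhds hb] with z h1 h2 h3
    exact h1 ((f2 z h2).2 h3)
  · exact nhdsWithin_le_nhds ((ZH_isClosed hk).isOpen_compl.mem_nhds he)

theorem ZH_countable {k : ℕ} (hk : 1 ≤ k) : (ZH k).Countable := by
  obtain ⟨t, -, htc, hts⟩ := TopologicalSpace.countable_cover_nhdsWithin (s := ZH k)
    (f := fun x => {x}) fun x hx => by
      have := ZH_isolated hk x
      rw [eventually_nhdsWithin_iff] at this
      rw [mem_nhdsWithin_iff_eventually]
      filter_upwards [this] with z h1 h2
      by_contra h3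
      exact h1 h3 h2
  exact htc.mono (by simpa using hts)

/-- No eigenvalues where both limit oscillators have none. -/
theorem no_eigenvalue {k : ℕ} (hk : 1 ≤ k) {K : Set ℂ} (hK : IsCompact K) {a : ℂ}
    (h : ∀ E ∈ K, E - a ∉ ZH k ∧ E + a ∉ ZH k) :
    ∀ᶠ p : ℝ × ℂ in 𝓝[>] 0 ×ˢ 𝓝 a, ∀ E ∈ K, (Pa k _ p.1 p.2, Pe k p.1 E) ∉ Sg (2 * k + 2) := by
  obtain ⟨B, hB⟩ := hK.isBounded.exists_norm_le
  have hM : 0 < max B ‖a‖ + 1 := by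
    have := (norm_nonneg a).trans (le_max_right B ‖a‖); linarith
  set M := max B ‖a‖ + 1 with hMdef
  have ha : ‖a‖ < M := by linarith [le_max_right B ‖a‖]
  have hE : ∀ E ∈ K, ‖E‖ < M := fun E h => by linarith [le_max_left B ‖a‖, hB E h]
  obtain ⟨G, c, g1, g2, g3, c1, c2, c3⟩ := exists_splitting hk hM
  have hT : CTend (𝓝[>] 0 ×ˢ 𝓝 a) (fun (p : ℝ × ℂ) E => G p.1 p.2 E)
      (fun E => c (E - a) * c (E + a)) (Metric.ball 0 M) := fun E hE =>
    g3 a E ha (mem_ball_zero_iff.1 hE)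
  have h1 := hT.eventually_ne hK (fun E h => mem_ball_zero_iff.2 (hE E h)) (fun E h' => by
    have h2 := hE E h'
    refine mul_ne_zero (fun h0 => (h E h').1 ((c2 _ ?_).1 h0))
      (fun h0 => (h E h').2 ((c2 _ ?_).1 h0))
    · rw [mem_ball_zero_iff]; linarith [norm_sub_le E a]
    · rw [mem_ball_zero_iff]; linarith [norm_add_le E a])
  have hna : ∀ᶠ w in 𝓝 a, ‖w‖ < M := continuous_norm.continuousAt.eventually (gt_mem_nhds ha)
  filter_upwards [h1, tendsto_fst.eventually g1, tendsto_snd.eventually hna] with p h1 h2 h3 E h4 h5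
  exact h1 E h4 ((h2 _ _ h3 (hE E h4)).1 h5)

/-- Near a simple point of the limit spectrum there is exactly one eigenvalue. -/
theorem branch_unique {k : ℕ} (hk : 1 ≤ k) {e σ a : ℂ} (hσ : σ = 1 ∨ σ = -1) (he : e ∈ ZH k)
    (ha : e + 2 * σ * a ∉ ZH k) :
    (∃ r > 0, ∀ᶠ p : ℝ × ℂ in 𝓝[>] 0 ×ˢ 𝓝 a, ∀ E ∈ Metric.ball (e + σ * a) r,
      ∀ E' ∈ Metric.ball (e + σ * a) r, (Pa k _ p.1 p.2, Pe k p.1 E) ∈ Sg (2 * k + 2) →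
        (Pa k _ p.1 p.2, Pe k p.1 E') ∈ Sg (2 * k + 2) → E = E') ∧
    ∀ ρ > 0, ∀ᶠ p : ℝ × ℂ in 𝓝[>] 0 ×ˢ 𝓝 a, ∃ E ∈ Metric.ball (e + σ * a) ρ,
      (Pa k _ p.1 p.2, Pe k p.1 E) ∈ Sg (2 * k + 2) := by
  have hM : 0 < ‖e‖ + ‖a‖ + 1 := by positivity
  set M := ‖e‖ + ‖a‖ + 1 with hMdef
  set E0 := e + σ * a with hE0
  have hnσ : ‖σ * a‖ = ‖a‖ := by rcases hσ with rfl | rfl <;> simp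
  have haM : ‖a‖ < M := by linarith [norm_nonneg e]
  have hEM : ‖E0‖ < M := by linarith [norm_add_le e (σ * a)]
  obtain ⟨G, c, g1, g2, g3, c1, c2, c3⟩ := exists_splitting hk hM
  set f0 : ℂ → ℂ := fun E => c (E - a) * c (E + a) with hf0
  have hT : CTend (𝓝[>] 0 ×ˢ 𝓝 a) (fun (p : ℝ × ℂ) E => G p.1 p.2 E) f0 (Metric.ball 0 M) :=
    fun E hE => g3 a E haM (mem_ball_zero_iff.1 hE)
  have hna : ∀ᶠ w in 𝓝 a, ‖w‖ < M := continuous_norm.continuousAt.eventually (gt_mem_nhds haM)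
  have hmem : ∀ E ∈ Metric.ball (0 : ℂ) M, E - a ∈ Metric.ball (0 : ℂ) (2 * M) ∧
      E + a ∈ Metric.ball (0 : ℂ) (2 * M) := by
    intro E hE
    simp only [mem_ball_zero_iff] at hE ⊢
    exact ⟨by linarith [norm_sub_le E a], by linarith [norm_add_le E a]⟩
  have hE0m : E0 ∈ Metric.ball (0 : ℂ) M := mem_ball_zero_iff.2 hEM
  have hcd : ∀ e ∈ Metric.ball (0 : ℂ) (2 * M), HasDerivAt c (deriv c e) e := fun e he =>
    (c1.differentiableAt (Metric.isOpen_ball.mem_nhds he)).hasDerivAt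
  have hfd : ∀ E ∈ Metric.ball (0 : ℂ) M, HasDerivAt f0
      (deriv c (E - a) * c (E + a) + c (E - a) * deriv c (E + a)) E := by
    intro E hE
    exact ((hcd _ (hmem E hE).1).comp_sub_const E a).mul ((hcd _ (hmem E hE).2).comp_add_const E a)
  have hf0d : DifferentiableOn ℂ f0 (Metric.ball 0 M) := fun E hE =>
    (hfd E hE).differentiableAt.differentiableWithinAt
  have hGd : ∀ᶠ p : ℝ × ℂ in 𝓝[>] 0 ×ˢ 𝓝 a, DifferentiableOn ℂ (G p.1 p.2) (Metric.ball 0 M) := by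
    filter_upwards [tendsto_fst.eventually g2, tendsto_snd.eventually hna] with p h1 h2
    exact h1 _ h2
  have hder : f0 E0 = 0 ∧ deriv f0 E0 ≠ 0 := by
    obtain ⟨m1, m2⟩ := hmem E0 hE0m
    rw [(hfd E0 hE0m).deriv]
    rcases hσ with rfl | rfl
    · have e1 : E0 - a = e := by rw [hE0]; ring
      have e2 : E0 + a = e + 2 * 1 * a := by rw [hE0]; ring
      have z1 : c (E0 - a) = 0 := (c2 _ m1).2 (by rwa [e1])
      have z2 : c (E0 + a) ≠ 0 := fun h => ha (by rw [← e2]; exact (c2 _ m2).1 h)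
      refine ⟨by simp [hf0, z1], ?_⟩
      rw [z1, zero_mul, add_zero]
      exact mul_ne_zero (c3 _ m1 z1) z2
    · have e1 : E0 + a = e := by rw [hE0]; ring
      have e2 : E0 - a = e + 2 * -1 * a := by rw [hE0]; ring
      have z1 : c (E0 + a) = 0 := (c2 _ m2).2 (by rwa [e1])
      have z2 : c (E0 - a) ≠ 0 := fun h => ha (by rw [← e2]; exact (c2 _ m1).1 h)
      refine ⟨by simp [hf0, z1], ?_⟩
      rw [z1, mul_zero, zero_add]
      exact mul_ne_zero z2 (c3 _ m2 z1)
  have hiff : ∀ᶠ p : ℝ × ℂ in 𝓝[>] 0 ×ˢ 𝓝 a, ∀ E ∈ Metric.ball (0 : ℂ) M,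
      ((Pa k _ p.1 p.2, Pe k p.1 E) ∈ Sg (2 * k + 2) ↔ G p.1 p.2 E = 0) := by
    filter_upwards [tendsto_fst.eventually g1, tendsto_snd.eventually hna] with p h1 h2 E hE
    exact h1 _ _ h2 (mem_ball_zero_iff.1 hE)
  constructor
  · obtain ⟨r, hr, hrs, hinj⟩ := hT.exists_injOn Metric.isOpen_ball hf0d hGd hE0m hder.2
    refine ⟨r, hr, ?_⟩
    filter_upwards [hinj, hiff] with p h1 h2 E hE E' hE' hs hs'
    exact h1 hE hE' (((h2 E (hrs hE)).1 hs).trans ((h2 E' (hrs hE')).1 hs').symm)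
  · intro ρ hρ
    obtain ⟨δ, hδ, hδs⟩ := Metric.isOpen_iff.1 Metric.isOpen_ball E0 hE0m
    have := hT.exists_zero Metric.isOpen_ball hf0d hGd hE0m hder.1
      (not_eventually_zero_of_deriv_ne hder.2) (lt_min hρ hδ)
    filter_upwards [this, hiff] with p ⟨E, hE, h1⟩ h2
    refine ⟨E, Metric.ball_subset_ball (min_le_left _ _) hE, (h2 E (hδs ?_)).2 h1⟩
    exact Metric.ball_subset_ball (min_le_right _ _) hE

end LimitSpectrum

section Labels
open Polynomial

theorem Pa_continuous (k n : ℕ) (ε : ℝ) : Continuous (Pa k n ε) := by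
  refine continuous_pi fun i => ?_
  unfold Pa
  split_ifs <;> fun_prop

theorem Pe_continuous (k : ℕ) (ε : ℝ) : Continuous (Pe k ε) := by
  unfold Pe; fun_prop

theorem Pe_sub (k : ℕ) (ε : ℝ) (E E' : ℂ) :
    Pe k ε E - Pe k ε E' = (mu k ε : ℂ) ^ 2 / (ε : ℂ) ^ 2 * (E - E') := by
  unfold Pe; ring

theorem Pe_scale_ne (k : ℕ) {ε : ℝ} (hε : 0 < ε) : (mu k ε : ℂ) ^ 2 / (ε : ℂ) ^ 2 ≠ 0 := by
  have h1 : (mu k ε : ℂ) ≠ 0 := by exact_mod_cast (mu_pos k hε).ne'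
  have h2 : (ε : ℂ) ≠ 0 := by exact_mod_cast hε.ne'
  positivity

theorem Pe_injective (k : ℕ) {ε : ℝ} (hε : 0 < ε) : Function.Injective (Pe k ε) := by
  intro E E' h
  have h1 := Pe_sub k ε E E'
  rw [h, sub_self] at h1
  exact sub_eq_zero.mp ((mul_eq_zero.mp h1.symm).resolve_left (Pe_scale_ne k hε))

variable {k : ℕ} {A : Set ((Fin (2 * k + 2 - 1) → ℂ) × ℂ)}

theorem real_energy (hk : 1 ≤ k) {ε : ℝ} (hε : 0 < ε) {a : ℝ} {E : ℂ}
    (h : (Pa k _ ε a, Pe k ε E) ∈ Sg (2 * k + 2)) : ∃ x : ℝ, E = x := by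
  have h1 := (realPoly_of_real (d := 2 * k + 2) (by omega) ⟨k + 1, by omega⟩ h
    (fun i => Pa_real k _ ε a i)).1
  obtain ⟨x, hx⟩ := Pe_surj k hε _ h1
  exact ⟨x, Pe_injective k hε hx.symm⟩

theorem LC.persist_energy (hA : LC (2 * k + 2) A) {ε : ℝ} (hε : 0 < ε) {a E : ℂ}
    (h : (Pa k _ ε a, Pe k ε E) ∈ Sg (2 * k + 2) ∩ A) {ρ : ℝ} (hρ : 0 < ρ) :
    ∀ᶠ a' in 𝓝 a, ∃ E' ∈ Metric.ball E ρ, (Pa k _ ε a', Pe k ε E') ∈ Sg (2 * k + 2) ∩ A := by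
  set c : ℂ := (mu k ε : ℂ) ^ 2 / (ε : ℂ) ^ 2 with hc
  have hc0 : c ≠ 0 := Pe_scale_ne k hε
  have hcn : 0 < ‖c‖ := norm_pos_iff.mpr hc0
  have h1 := LC.persist (by omega) ⟨k + 1, by omega⟩ hA h (mul_pos hcn hρ)
  filter_upwards [(Pa_continuous k _ ε).continuousAt.eventually h1] with a' ha'
  obtain ⟨lam, hlam, hm⟩ := ha'
  have h2 : Pe k ε (E + (lam - Pe k ε E) / c) = lam := by
    have := Pe_sub k ε (E + (lam - Pe k ε E) / c) E
    rw [← hc, add_sub_cancel_left, mul_div_cancel₀ _ hc0] at this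
    exact sub_left_injective this
  refine ⟨E + (lam - Pe k ε E) / c, ?_, by rwa [h2]⟩
  rw [Metric.mem_ball, dist_eq_norm] at hlam ⊢
  rw [add_sub_cancel_left, norm_div, div_lt_iff₀ hcn, mul_comm]
  exact hlam

/-- Along the ultrafilter `u` of parameters `ε`, arbitrarily close to the energy `E` there are
eigenvalues lying in `A`. -/
def Lab (u : Ultrafilter ℝ) (A : Set ((Fin (2 * k + 2 - 1) → ℂ) × ℂ)) (a E : ℂ) : Prop :=
  ∀ ρ > 0, ∀ᶠ ε in (u : Filter ℝ), ∃ E' ∈ Metric.ball E ρ,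
    (Pa k _ ε a, Pe k ε E') ∈ Sg (2 * k + 2) ∩ A

variable {u : Ultrafilter ℝ}

theorem eventually_fix {l : Filter ℝ} {a : ℂ} {P : ℝ × ℂ → Prop}
    (h : ∀ᶠ p in l ×ˢ 𝓝 a, P p) : ∀ᶠ ε in l, P (ε, a) :=
  h.curry.mono fun _ h => h.self_of_nhds

theorem Lab.or (hk : 1 ≤ k) (hu : (u : Filter ℝ) ≤ 𝓝[>] 0) {e σ a : ℂ} (hσ : σ = 1 ∨ σ = -1)
    (he : e ∈ ZH k) (ha : e + 2 * σ * a ∉ ZH k) :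
    Lab u A a (e + σ * a) ∨ Lab u Aᶜ a (e + σ * a) := by
  by_contra! hcon
  obtain ⟨h1, h2⟩ := hcon
  unfold Lab at h1 h2
  push Not at h1 h2
  obtain ⟨ρ1, hρ1, h1⟩ := h1
  obtain ⟨ρ2, hρ2, h2⟩ := h2
  have h3 := hu (eventually_fix ((branch_unique hk hσ he ha).2 (min ρ1 ρ2)
    (lt_min hρ1 hρ2)))
  obtain ⟨ε, ⟨E, hE, hS⟩, h4, h5⟩ := ((show ∀ᶠ ε in (u : Filter ℝ), _ from h3).and
    (h1.and h2)).exists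
  by_cases hA : (Pa k _ ε a, Pe k ε E) ∈ A
  · exact h4 E (Metric.ball_subset_ball (min_le_left _ _) hE) ⟨hS, hA⟩
  · exact h5 E (Metric.ball_subset_ball (min_le_right _ _) hE) ⟨hS, hA⟩

theorem Lab.locally (hk : 1 ≤ k) (hu : (u : Filter ℝ) ≤ 𝓝[>] 0) (hA : LC (2 * k + 2) A)
    {e σ a : ℂ} (hσ : σ = 1 ∨ σ = -1) (he : e ∈ ZH k) (ha : e + 2 * σ * a ∉ ZH k) :
    ∃ V ∈ 𝓝 a, ∀ b ∈ V, ∀ c ∈ V, e + 2 * σ * c ∉ ZH k →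
      Lab u A b (e + σ * b) → Lab u A c (e + σ * c) := by
  have hσn : ‖σ‖ = 1 := by rcases hσ with rfl | rfl <;> simp
  obtain ⟨⟨r, hr, hU⟩, hE⟩ := branch_unique hk hσ he ha
  obtain ⟨S, hS, T, hT, hST⟩ := eventually_prod_iff.mp (hU.and (hE r hr))
  obtain ⟨η, hη, hηT⟩ := Metric.eventually_nhds_iff_ball.mp hT
  set δ := min η (r / 2) with hδ
  have hδ0 : 0 < δ := lt_min hη (by positivity)
  refine ⟨Metric.ball a δ, Metric.ball_mem_nhds _ hδ0, fun b hb c hc hcg hL => ?_⟩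
  have near : ∀ z ∈ Metric.ball a δ, Metric.ball (e + σ * z) (r / 2) ⊆ Metric.ball (e + σ * a) r
      := by
    intro z hz
    refine Metric.ball_subset_ball' ?_
    have : dist (e + σ * z) (e + σ * a) < r / 2 := by
      rw [dist_eq_norm, show e + σ * z - (e + σ * a) = σ * (z - a) by ring, norm_mul, hσn, one_mul,
        ← dist_eq_norm]
      exact lt_of_lt_of_le hz (min_le_right _ _)
    linarith
  rcases Lab.or (A := A) hk hu hσ he hcg with h | h
  · exact h
  exfalso
  have hpos : ∀ᶠ ε in (u : Filter ℝ), 0 < ε := hu self_mem_nhdsWithin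
  obtain ⟨ε, hε, hεS, ⟨Eb, hEb, hb1⟩, ⟨Ec, hEc, hc1⟩⟩ :=
    (hpos.and ((show ∀ᶠ ε in (u : Filter ℝ), S ε from hu hS).and
      ((hL (r / 2) (by positivity)).and (h (r / 2) (by positivity))))).exists
  let TT : Set ((Fin (2 * k + 2 - 1) → ℂ) × ℂ) → Set ℂ := fun A =>
    {z | ∃ E ∈ Metric.ball (e + σ * a) r, (Pa k _ ε z, Pe k ε E) ∈ Sg (2 * k + 2) ∩ A}
  have hopen : ∀ A : Set ((Fin (2 * k + 2 - 1) → ℂ) × ℂ), LC (2 * k + 2) A → IsOpen (TT A) := by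
    intro A hA
    rw [isOpen_iff_mem_nhds]
    rintro z ⟨E, hE, hm⟩
    obtain ⟨ρ, hρ, hρs⟩ := Metric.isOpen_ball.mem_nhds hE |> Metric.mem_nhds_iff.mp
    filter_upwards [hA.persist_energy hε hm hρ] with z' hz'
    obtain ⟨E', hE', hm'⟩ := hz'
    exact ⟨E', hρs hE', hm'⟩
  have hpre : IsPreconnected (Metric.ball a δ) := (convex_ball a δ).isPreconnected
  obtain ⟨z, hz, ⟨E1, hE1, h1⟩, ⟨E2, hE2, h2⟩⟩ := hpre (TT A) (TT Aᶜ) (hopen A hA) (hopen _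
      hA.compl)
    (fun z hz => by
      have hzT : T z := hηT z (Metric.ball_subset_ball (min_le_left _ _) hz)
      obtain ⟨E, hE, hm⟩ := (hST hεS hzT).2
      by_cases hmA : (Pa k _ ε z, Pe k ε E) ∈ A
      · exact Or.inl ⟨E, hE, hm, hmA⟩
      · exact Or.inr ⟨E, hE, hm, hmA⟩)
    ⟨b, hb, Eb, near b hb hEb, hb1⟩ ⟨c, hc, Ec, near c hc hEc, hc1⟩
  have hzT : T z := hηT z (Metric.ball_subset_ball (min_le_left _ _) hz)
  have := (hST hεS hzT).1 E1 hE1 E2 hE2 h1.1 h2.1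
  subst this
  exact h2.2 h1.2

theorem generic_preconnected (hk : 1 ≤ k) {σ : ℂ} (hσ : σ = 1 ∨ σ = -1) (e : ℂ) :
    IsPreconnected {a : ℂ | e + 2 * σ * a ∉ ZH k} := by
  have hinj : Function.Injective (fun a : ℂ => e + 2 * σ * a) := by
    intro a b h
    rcases hσ with rfl | rfl <;> simpa using h
  have h1 : ((fun a : ℂ => e + 2 * σ * a) ⁻¹' ZH k).Countable := (ZH_countable hk).preimage hinj
  exact (h1.isPathConnected_compl_of_one_lt_rank
    (rank_real_complex ▸ Nat.one_lt_ofNat)).isConnected.isPreconnected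

theorem Lab.const (hk : 1 ≤ k) (hu : (u : Filter ℝ) ≤ 𝓝[>] 0) (hA : LC (2 * k + 2) A)
    {e σ a b : ℂ} (hσ : σ = 1 ∨ σ = -1) (he : e ∈ ZH k) (ha : e + 2 * σ * a ∉ ZH k)
    (hb : e + 2 * σ * b ∉ ZH k) (h : Lab u A a (e + σ * a)) : Lab u A b (e + σ * b) := by
  have := (generic_preconnected hk hσ e).induction₂'
    (fun x y => Lab u A x (e + σ * x) → Lab u A y (e + σ * y)) (fun x hx => by
      obtain ⟨V, hV, hVV⟩ := Lab.locally hk hu hA hσ he hx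
      filter_upwards [mem_nhdsWithin_of_mem_nhds hV, self_mem_nhdsWithin] with y hy hyg
      exact ⟨hVV x (mem_of_mem_nhds hV) y hy hyg, hVV y hy x (mem_of_mem_nhds hV) hx⟩)
    (fun x y z _ _ _ h1 h2 h => h2 (h1 h)) ha hb
  exact this h

end Labels

section Crossing
open Polynomial

variable {k : ℕ} {A : Set ((Fin (2 * k + 2 - 1) → ℂ) × ℂ)} {u : Ultrafilter ℝ}

theorem Lab.unique (hk : 1 ≤ k) (hu : (u : Filter ℝ) ≤ 𝓝[>] 0) {e σ a : ℂ}
    (hσ : σ = 1 ∨ σ = -1) (he : e ∈ ZH k) (ha : e + 2 * σ * a ∉ ZH k)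
    (h : Lab u A a (e + σ * a)) : ∃ ρ0 > 0, ∀ ρ, 0 < ρ → ρ ≤ ρ0 → ∀ᶠ ε in (u : Filter ℝ),
      (∃ E ∈ Metric.ball (e + σ * a) ρ, (Pa k _ ε a, Pe k ε E) ∈ Sg (2 * k + 2) ∩ A) ∧
      ∀ E ∈ Metric.ball (e + σ * a) ρ, (Pa k _ ε a, Pe k ε E) ∈ Sg (2 * k + 2) →
        (Pa k _ ε a, Pe k ε E) ∈ A := by
  obtain ⟨⟨r, hr, hU⟩, -⟩ := branch_unique hk hσ he ha
  refine ⟨r, hr, fun ρ hρ hρr => ?_⟩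
  filter_upwards [h ρ hρ, hu (eventually_fix hU)] with ε h1 h2
  refine ⟨h1, fun E hE hS => ?_⟩
  obtain ⟨E', hE', hm⟩ := h1
  rw [h2 E (Metric.ball_subset_ball hρr hE) E' (Metric.ball_subset_ball hρr hE') hS hm.1]
  exact hm.2

theorem crossing_end (hk : 1 ≤ k) (hu : (u : Filter ℝ) ≤ 𝓝[>] 0)
    {e e' t c : ℂ} {r : ℝ} (hr : 0 < r) (hc : e + e' = 2 * c) (ht : ‖2 * t - (e' - e)‖ = 2 * r)
    (he : e ∈ ZH k) (he' : e' ∈ ZH k)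
    (hi : ∀ z ∈ Metric.ball e (4 * r), z ∈ ZH k → z = e)
    (hi' : ∀ z ∈ Metric.ball e' (4 * r), z ∈ ZH k → z = e')
    (hR : ∀ a, e + 2 * 1 * a ∉ ZH k → Lab u A a (e + 1 * a))
    (hL : ∀ a, e' + 2 * (-1) * a ∉ ZH k → Lab u Aᶜ a (e' + (-1) * a)) :
    ∀ᶠ ε in (u : Filter ℝ),
      (∃ E ∈ Metric.ball (e + t) r, (Pa k _ ε t, Pe k ε E) ∈ Sg (2 * k + 2) ∩ A) ∧
      (∃ E ∈ Metric.ball (e' - t) r, (Pa k _ ε t, Pe k ε E) ∈ Sg (2 * k + 2) ∩ Aᶜ) ∧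
      ∀ E ∈ Metric.closedBall c (2 * r),
        ((Pa k _ ε t, Pe k ε E) ∈ Sg (2 * k + 2) ∩ A → E ∈ Metric.ball (e + t) r) ∧
        ((Pa k _ ε t, Pe k ε E) ∈ Sg (2 * k + 2) ∩ Aᶜ → E ∈ Metric.ball (e' - t) r) := by
  have g1 : e + 2 * 1 * t ∉ ZH k := by
    intro h
    have h1 := hi' _ (by
      rw [Metric.mem_ball, dist_eq_norm, show e + 2 * 1 * t - e' = 2 * t - (e' - e) by ring, ht]
      linarith) h
    rw [show 2 * t - (e' - e) = 0 by linear_combination h1, norm_zero] at ht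
    linarith
  have g2 : e' + 2 * (-1) * t ∉ ZH k := by
    intro h
    have h1 := hi _ (by
      rw [Metric.mem_ball, dist_eq_norm, show e' + 2 * (-1) * t - e = -(2 * t - (e' - e)) by ring,
        norm_neg, ht]
      linarith) h
    rw [show 2 * t - (e' - e) = 0 by linear_combination -h1, norm_zero] at ht
    linarith
  obtain ⟨ρ1, hρ1, h1⟩ := Lab.unique hk hu (Or.inl rfl) he g1 (hR t g1)
  obtain ⟨ρ2, hρ2, h2⟩ := Lab.unique hk hu (Or.inr rfl) he' g2 (hL t g2)
  rw [one_mul] at h1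
  rw [neg_one_mul, ← sub_eq_add_neg] at h2
  set ρ := min r (min ρ1 ρ2)
  have hρ : 0 < ρ := lt_min hr (lt_min hρ1 hρ2)
  have hρr : ρ ≤ r := min_le_left _ _
  specialize h1 ρ hρ ((min_le_right _ _).trans (min_le_left _ _))
  specialize h2 ρ hρ ((min_le_right _ _).trans (min_le_right _ _))
  have hth : ‖t - (e' - e) / 2‖ = r := by
    have : ‖(2 : ℂ) * (t - (e' - e) / 2)‖ = 2 * r := by rw [← ht]; congr 1; ring
    rw [norm_mul, Complex.norm_ofNat] at this
    linarith
  have h3 := no_eigenvalue hk (a := t) (K := (Metric.closedBall c (2 * r) \ Metric.ball (e + t) ρ) \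
    Metric.ball (e' - t) ρ)
    (((isCompact_closedBall _ _).diff Metric.isOpen_ball).diff Metric.isOpen_ball) (by
      rintro E ⟨⟨hE, hE1⟩, hE2⟩
      rw [Metric.mem_closedBall, dist_eq_norm] at hE
      constructor
      · intro h
        have h4 := hi _ (by
          rw [Metric.mem_ball, dist_eq_norm,
            show E - t - e = (E - c) - (t - (e' - e) / 2) by linear_combination -hc / 2]
          have := norm_sub_le (E - c) (t - (e' - e) / 2)
          linarith) h
        rw [show E = e + t by linear_combination h4] at hE1
        exact hE1 (Metric.mem_ball_self hρ)
      · intro h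
        have h4 := hi' _ (by
          rw [Metric.mem_ball, dist_eq_norm,
            show E + t - e' = (E - c) + (t - (e' - e) / 2) by linear_combination -hc / 2]
          have := norm_add_le (E - c) (t - (e' - e) / 2)
          linarith) h
        rw [show E = e' - t by linear_combination h4] at hE2
        exact hE2 (Metric.mem_ball_self hρ))
  filter_upwards [h1, h2, hu (eventually_fix h3)] with ε h1 h2 h3
  obtain ⟨⟨E1, hE1, hm1⟩, h1⟩ := h1
  obtain ⟨⟨E2, hE2, hm2⟩, h2⟩ := h2
  refine ⟨⟨E1, Metric.ball_subset_ball hρr hE1, hm1⟩, ⟨E2, Metric.ball_subset_ball hρr hE2, hm2⟩,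
    fun E hE => ⟨fun h => ?_, fun h => ?_⟩⟩
  · by_contra hcon
    by_cases hb : E ∈ Metric.ball (e' - t) ρ
    · exact h2 E hb h.1 h.2
    · exact h3 E ⟨⟨hE, fun hb => hcon (Metric.ball_subset_ball hρr hb)⟩, hb⟩ h.1
  · by_contra hcon
    by_cases hb : E ∈ Metric.ball (e + t) ρ
    · exact h.2 (h1 E hb h.1)
    · exact h3 E ⟨⟨hE, hb⟩, fun hb => hcon (Metric.ball_subset_ball hρr hb)⟩ h.1

theorem ordered_persist (hk : 1 ≤ k) (hA : LC (2 * k + 2) A) {ε : ℝ} (hε : 0 < ε) {c r t₀ t₁ : ℝ}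
    (hle : t₀ ≤ t₁)
    (hno : ∀ t ∈ Set.Icc t₀ t₁, ∀ E : ℝ, |E - c| = r →
      (Pa k _ ε t, Pe k ε E) ∉ Sg (2 * k + 2))
    (h0 : ∃ E₁ E₂ : ℝ, |E₁ - c| ≤ r ∧ |E₂ - c| ≤ r ∧ E₁ ≤ E₂ ∧
      (Pa k _ ε t₀, Pe k ε E₁) ∈ Sg (2 * k + 2) ∩ A ∧
      (Pa k _ ε t₀, Pe k ε E₂) ∈ Sg (2 * k + 2) ∩ Aᶜ) :
    ∃ E₁ E₂ : ℝ, |E₁ - c| ≤ r ∧ |E₂ - c| ≤ r ∧ E₁ ≤ E₂ ∧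
      (Pa k _ ε t₁, Pe k ε E₁) ∈ Sg (2 * k + 2) ∩ A ∧
      (Pa k _ ε t₁, Pe k ε E₂) ∈ Sg (2 * k + 2) ∩ Aᶜ := by
  set T : Set ℝ := {t | ∃ E₁ E₂ : ℝ, |E₁ - c| ≤ r ∧ |E₂ - c| ≤ r ∧ E₁ ≤ E₂ ∧
      (Pa k _ ε t, Pe k ε E₁) ∈ Sg (2 * k + 2) ∩ A ∧
      (Pa k _ ε t, Pe k ε E₂) ∈ Sg (2 * k + 2) ∩ Aᶜ} with hT
  have hd2 : 2 ≤ 2 * k + 2 := by omega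
  have hev : Even (2 * k + 2) := ⟨k + 1, by omega⟩
  have hcont : ∀ g : ℝ × ℝ × ℝ → ℝ, Continuous g →
      Continuous fun q : ℝ × ℝ × ℝ => (Pa k (2 * k + 2 - 1) ε (q.1 : ℂ), Pe k ε (g q : ℂ)) := by
    intro g hg
    exact ((Pa_continuous k _ ε).comp (continuous_ofReal.comp continuous_fst)).prodMk
      ((Pe_continuous k ε).comp (continuous_ofReal.comp hg))
  have hclosed : IsClosed (T ∩ Set.Icc t₀ t₁) := by
    have hK : IsCompact ((Set.Icc t₀ t₁ ×ˢ Set.Icc (c - r) (c + r) ×ˢ Set.Icc (c - r) (c + r)) ∩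
        {q : ℝ × ℝ × ℝ | q.2.1 ≤ q.2.2 ∧
          (Pa k (2 * k + 2 - 1) ε (q.1 : ℂ), Pe k ε (q.2.1 : ℂ)) ∈ Sg (2 * k + 2) ∩ A ∧
          (Pa k (2 * k + 2 - 1) ε (q.1 : ℂ), Pe k ε (q.2.2 : ℂ)) ∈ Sg (2 * k + 2) ∩ Aᶜ}) := by
      refine (isCompact_Icc.prod (isCompact_Icc.prod isCompact_Icc)).inter_right ?_
      refine (isClosed_le (continuous_fst.comp continuous_snd)
        (continuous_snd.comp continuous_snd)).inter (IsClosed.inter ?_ ?_)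
      · exact (hA.closed hd2 hev).preimage (hcont (fun q => q.2.1) (by fun_prop))
      · exact (hA.compl.closed hd2 hev).preimage (hcont (fun q => q.2.2) (by fun_prop))
    have himg := (hK.image continuous_fst).isClosed
    convert himg using 1
    ext t
    constructor
    · rintro ⟨⟨E₁, E₂, b1, b2, h⟩, ht⟩
      rw [abs_le] at b1 b2
      exact ⟨(t, E₁, E₂), ⟨⟨ht, ⟨by linarith, by linarith⟩, ⟨by linarith, by linarith⟩⟩, h⟩, rfl⟩
    · rintro ⟨⟨t, E₁, E₂⟩, ⟨⟨ht, b1, b2⟩, h⟩, rfl⟩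
      exact ⟨⟨E₁, E₂, abs_le.2 ⟨by linarith [b1.1], by linarith [b1.2]⟩,
        abs_le.2 ⟨by linarith [b2.1], by linarith [b2.2]⟩, h⟩, ht⟩
  have hsub : Set.Icc t₀ t₁ ⊆ T := by
    refine hclosed.Icc_subset_of_forall_mem_nhdsWithin h0 ?_
    rintro t ⟨⟨E₁, E₂, b1, b2, h12, m1, m2⟩, ht⟩
    have htI : t ∈ Set.Icc t₀ t₁ := Set.Ico_subset_Icc_self ht
    have hlt : E₁ < E₂ := lt_of_le_of_ne h12 fun h => m2.2 (h ▸ m1.2)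
    have b1' : |E₁ - c| < r := lt_of_le_of_ne b1 fun h => hno t htI E₁ h m1.1
    have b2' : |E₂ - c| < r := lt_of_le_of_ne b2 fun h => hno t htI E₂ h m2.1
    obtain ⟨ρ, hρ, hρ1, hρ2, hρ3⟩ : ∃ ρ > 0, ρ ≤ r - |E₁ - c| ∧ ρ ≤ r - |E₂ - c| ∧
        ρ ≤ (E₂ - E₁) / 2 :=
      ⟨min (r - |E₁ - c|) (min (r - |E₂ - c|) ((E₂ - E₁) / 2)),
        lt_min (by linarith) (lt_min (by linarith) (by linarith)), min_le_left _ _,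
        (min_le_right _ _).trans (min_le_left _ _), (min_le_right _ _).trans (min_le_right _ _)⟩
    refine mem_nhdsWithin_of_mem_nhds ?_
    have c0 : Tendsto (fun t : ℝ => (t : ℂ)) (𝓝 t) (𝓝 (t : ℂ)) := continuous_ofReal.tendsto t
    filter_upwards [c0.eventually (hA.persist_energy hε m1 hρ),
      c0.eventually (hA.compl.persist_energy hε m2 hρ)] with s h1 h2
    obtain ⟨F1, hF1, n1⟩ := h1
    obtain ⟨F2, hF2, n2⟩ := h2
    obtain ⟨F1, rfl⟩ := real_energy hk hε n1.1
    obtain ⟨F2, rfl⟩ := real_energy hk hε n2.1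
    rw [Metric.mem_ball, Complex.dist_of_im_eq (by simp), ofReal_re, ofReal_re, Real.dist_eq]
      at hF1 hF2
    refine ⟨F1, F2, ?_, ?_, ?_, n1, n2⟩
    · linarith [abs_sub_le F1 E₁ c]
    · linarith [abs_sub_le F2 E₂ c]
    · linarith [(abs_lt.mp hF1).2, (abs_lt.mp hF2).1]
  exact hsub ⟨hle, le_rfl⟩

theorem crossing (hk : 1 ≤ k) (hu : (u : Filter ℝ) ≤ 𝓝[>] 0) (hA : LC (2 * k + 2) A)
    {e e' a a' : ℂ} (he : e ∈ ZH k) (he' : e' ∈ ZH k)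
    (ha : e + 2 * 1 * a ∉ ZH k) (ha' : e' + 2 * (-1) * a' ∉ ZH k)
    (h : Lab u A a (e + 1 * a)) (h' : Lab u Aᶜ a' (e' + (-1) * a')) : False := by
  have hR : ∀ a, e + 2 * 1 * a ∉ ZH k → Lab u A a (e + 1 * a) := fun b hb =>
    Lab.const hk hu hA (Or.inl rfl) he ha hb h
  have hL : ∀ a, e' + 2 * (-1) * a ∉ ZH k → Lab u Aᶜ a (e' + (-1) * a) := fun b hb =>
    Lab.const hk hu hA.compl (Or.inr rfl) he' ha' hb h'
  clear h h' ha ha' a a'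
  obtain ⟨x, rfl⟩ : ∃ x : ℝ, (x : ℂ) = e := ⟨e.re, Complex.ext rfl (ZH_im hk he).symm⟩
  obtain ⟨x', rfl⟩ : ∃ x : ℝ, (x : ℂ) = e' := ⟨e'.re, Complex.ext rfl (ZH_im hk he').symm⟩
  have hiso : ∀ e : ℂ, ∃ δ > 0, ∀ z ∈ Metric.ball e δ, z ∈ ZH k → z = e := by
    intro e
    obtain ⟨δ, hδ, h⟩ := Metric.eventually_nhds_iff_ball.mp
      (eventually_nhdsWithin_iff.mp (ZH_isolated hk e))
    exact ⟨δ, hδ, fun z hz hzZ => by_contra fun hne => h z hz hne hzZ⟩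
  obtain ⟨δ, hδ, hi⟩ := hiso x
  obtain ⟨δ', hδ', hi'⟩ := hiso x'
  obtain ⟨r, hr, hr1, hr2⟩ : ∃ r > 0, 4 * r ≤ δ ∧ 4 * r ≤ δ' :=
    ⟨min δ δ' / 4, by have := lt_min hδ hδ'; linarith, by linarith [min_le_left δ δ'],
      by linarith [min_le_right δ δ']⟩
  replace hi : ∀ z ∈ Metric.ball (x : ℂ) (4 * r), z ∈ ZH k → z = x := fun z hz =>
    hi z (Metric.ball_subset_ball hr1 hz)
  replace hi' : ∀ z ∈ Metric.ball (x' : ℂ) (4 * r), z ∈ ZH k → z = x' := fun z hz =>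
    hi' z (Metric.ball_subset_ball hr2 hz)
  set c : ℝ := (x + x') / 2 with hc
  set t : ℝ := (x' - x) / 2 with ht
  have hend : ∀ s : ℝ, |s| = r → ∀ᶠ ε in (u : Filter ℝ), _ := fun s hs =>
    crossing_end hk hu (e := x) (e' := x') (t := ((t + s : ℝ) : ℂ)) (c := (c : ℝ)) hr
      (by rw [hc]; push_cast; ring)
      (by rw [show (2 : ℂ) * ((t + s : ℝ) : ℂ) - (x' - x) = ((2 * s : ℝ) : ℂ) by
            rw [ht]; push_cast; ring]
          rw [norm_real, Real.norm_eq_abs, abs_mul, hs]; norm_num)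
      he he' hi hi' hR hL
  have hno : ∀ᶠ ε in (u : Filter ℝ), ∀ z ∈ (fun s : ℝ => (s : ℂ)) '' Set.Icc (t - r) (t + r),
      ∀ E ∈ Metric.sphere (c : ℂ) (2 * r), (Pa k _ ε z, Pe k ε E) ∉ Sg (2 * k + 2) := by
    refine hu (IsCompact.eventually_forall_prod (isCompact_Icc.image continuous_ofReal) ?_)
    rintro _ ⟨s, hs, rfl⟩
    refine no_eigenvalue hk (isCompact_sphere _ _) fun E hE => ?_
    rw [mem_sphere_iff_norm] at hE
    have hs' : ‖(s : ℂ) - t‖ ≤ r := by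
      rw [← ofReal_sub, norm_real, Real.norm_eq_abs, abs_le]
      exact ⟨by linarith [hs.1], by linarith [hs.2]⟩
    have hct : (x : ℂ) = c - t := by rw [hc, ht]; push_cast; ring
    have hct' : (x' : ℂ) = c + t := by rw [hc, ht]; push_cast; ring
    constructor
    · intro hz
      have h4 := hi _ (by
        rw [Metric.mem_ball, dist_eq_norm, hct, show E - s - (c - t) = (E - c) - (s - t) by ring]
        linarith [norm_sub_le (E - c) ((s : ℂ) - t)]) hz
      rw [show E - c = s - t by linear_combination h4 + hct] at hE
      linarith
    · intro hz
      have h4 := hi' _ (by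
        rw [Metric.mem_ball, dist_eq_norm, hct', show E + s - (c + t) = (E - c) + (s - t) by ring]
        linarith [norm_add_le (E - c) ((s : ℂ) - t)]) hz
      rw [show E - c = -(s - t) by linear_combination h4 + hct', norm_neg] at hE
      linarith
  have hpos : ∀ᶠ ε in (u : Filter ℝ), 0 < ε := hu self_mem_nhdsWithin
  obtain ⟨ε, hε, hno, hl, hr'⟩ := (hpos.and (hno.and ((hend (-r) (by rw [abs_neg, abs_of_pos
      hr])).and
    (hend r (abs_of_pos hr))))).exists
  obtain ⟨⟨E₁, hE₁, m1⟩, ⟨E₂, hE₂, m2⟩, -⟩ := hl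
  obtain ⟨-, -, hr'⟩ := hr'
  obtain ⟨E₁, rfl⟩ := real_energy hk hε m1.1
  obtain ⟨E₂, rfl⟩ := real_energy hk hε m2.1
  rw [Metric.mem_ball, ← ofReal_add, Complex.dist_of_im_eq (by simp), ofReal_re, ofReal_re,
    Real.dist_eq, abs_lt] at hE₁
  rw [Metric.mem_ball, ← ofReal_sub, Complex.dist_of_im_eq (by simp), ofReal_re, ofReal_re,
    Real.dist_eq, abs_lt] at hE₂
  have hxc : x = c - t := by rw [hc, ht]; ring
  have hxc' : x' = c + t := by rw [hc, ht]; ring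
  obtain ⟨F₁, F₂, b1, b2, h12, n1, n2⟩ := ordered_persist hk hA hε (c := c) (r := 2 * r)
    (t₀ := t + -r) (t₁ := t + r) (by linarith)
    (fun s hs E hE => hno s ⟨s, ⟨by linarith [hs.1], hs.2⟩, rfl⟩ E (by
      rw [mem_sphere_iff_norm, ← ofReal_sub, norm_real, Real.norm_eq_abs, hE]))
    ⟨E₁, E₂, by rw [abs_le]; constructor <;> linarith, by rw [abs_le]; constructor <;> linarith,
      by linarith, m1, m2⟩
  have hb : ∀ F : ℝ, |F - c| ≤ 2 * r → (F : ℂ) ∈ Metric.closedBall (c : ℂ) (2 * r) := by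
    intro F hF
    rwa [mem_closedBall_iff_norm, ← ofReal_sub, norm_real, Real.norm_eq_abs]
  have k1 := (hr' F₁ (hb F₁ b1)).1 n1
  have k2 := (hr' F₂ (hb F₂ b2)).2 n2
  rw [Metric.mem_ball, ← ofReal_add, Complex.dist_of_im_eq (by simp), ofReal_re, ofReal_re,
    Real.dist_eq, abs_lt] at k1
  rw [Metric.mem_ball, ← ofReal_sub, Complex.dist_of_im_eq (by simp), ofReal_re, ofReal_re,
    Real.dist_eq, abs_lt] at k2
  linarith

theorem Lab.same (hk : 1 ≤ k) (hu : (u : Filter ℝ) ≤ 𝓝[>] 0) (hA : LC (2 * k + 2) A)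
    {e e' σ σ' a a' : ℂ} (hσ : σ = 1 ∨ σ = -1) (hσ' : σ' = 1 ∨ σ' = -1)
    (he : e ∈ ZH k) (he' : e' ∈ ZH k)
    (ha : e + 2 * σ * a ∉ ZH k) (ha' : e' + 2 * σ' * a' ∉ ZH k)
    (h : Lab u A a (e + σ * a)) (h' : Lab u Aᶜ a' (e' + σ' * a')) : False := by
  have hA' : Lab u Aᶜᶜ = Lab u A := by rw [compl_compl]
  obtain ⟨b, hb⟩ : ∃ b, e + 2 * b ∉ ZH k := by
    obtain ⟨z, hz⟩ := ((ZH_isolated hk 0).exists)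
    exact ⟨(z - e) / 2, by rwa [show e + 2 * ((z - e) / 2) = z by ring]⟩
  rcases hσ with rfl | rfl <;> rcases hσ' with rfl | rfl
  · have hb' : e + 2 * (-1) * (-b) ∉ ZH k := by rwa [show e + 2 * (-1) * (-b) = e + 2 * b by ring]
    rcases Lab.or (A := A) hk hu (Or.inr rfl) he hb' with h1 | h1
    · exact crossing hk hu hA.compl he' he ha' hb' h' (by rwa [hA'])
    · exact crossing hk hu hA he he ha hb' h h1
  · exact crossing hk hu hA he he' ha ha' h h'
  · exact crossing hk hu hA.compl he' he ha' ha h' (by rwa [hA'])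
  · have hb' : e + 2 * 1 * b ∉ ZH k := by rwa [mul_one]
    rcases Lab.or (A := A) hk hu (Or.inl rfl) he hb' with h1 | h1
    · exact crossing hk hu hA he he' hb' ha' h1 h'
    · exact crossing hk hu hA.compl he he hb' ha h1 (by rwa [hA'])

end Crossing

section Connectedness
open Polynomial

variable {k : ℕ} {A : Set ((Fin (2 * k + 2 - 1) → ℂ) × ℂ)} {u : Ultrafilter ℝ}

theorem exists_Lab (hk : 1 ≤ k) (hu : (u : Filter ℝ) ≤ 𝓝[>] 0) (hA : LC (2 * k + 2) A)
    {p : (Fin (2 * k + 2 - 1) → ℂ) × ℂ} (hp : p ∈ Sg (2 * k + 2) ∩ A) {a : ℝ} (ha : |a| ≤ 1) :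
    ∃ e σ : ℂ, (σ = 1 ∨ σ = -1) ∧ e ∈ ZH k ∧ Lab u A a (e + σ * a) := by
  have hd2 : 2 ≤ 2 * k + 2 := by omega
  have hev : Even (2 * k + 2) := ⟨k + 1, by omega⟩
  obtain ⟨q, hq, hqr⟩ := exists_real_point hd2 hev hA hp
  obtain ⟨n, hn⟩ := Bd.exists_NZ (q := PolP (2 * k + 2) q)
    hq.1 (PolP_coer hd2 hev q)
  obtain ⟨B, hB⟩ := exists_E_bound hk n
  have hE : ∀ ε : ℝ, ∃ E : ℝ, 0 < ε → ε ≤ 1 → |E| ≤ B ∧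
      (Pa k _ ε a, Pe k ε E) ∈ Sg (2 * k + 2) ∩ A := by
    intro ε
    by_cases h : 0 < ε ∧ ε ≤ 1
    · obtain ⟨lam, hS, hnz⟩ := hA.homotopy hd2 hev hq hqr hn
        (β := Pa k _ ε a) (fun i => Pa_real k _ ε a i)
      obtain ⟨E, rfl, hEB⟩ := hB ε h.1 h.2 a ha lam hS.1 hnz
      exact ⟨E, fun _ _ => ⟨hEB, hS⟩⟩
    · exact ⟨0, fun h1 h2 => absurd ⟨h1, h2⟩ h⟩
  choose E hE using hE
  have hpos : ∀ᶠ ε in (u : Filter ℝ), |E ε| ≤ B ∧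
      (Pa k _ ε a, Pe k ε (E ε)) ∈ Sg (2 * k + 2) ∩ A := by
    filter_upwards [hu (Ioc_mem_nhdsGT one_pos)] with ε hε using hE ε hε.1 hε.2
  obtain ⟨E', -, hE'⟩ := (isCompact_Icc (a := -B) (b := B)).ultrafilter_le_nhds (u.map E) (by
    rw [le_principal_iff]
    exact hpos.mono fun ε h => abs_le.1 h.1)
  have ht : Tendsto (fun ε => (E ε : ℂ)) u (𝓝 (E' : ℂ)) :=
    (continuous_ofReal.tendsto E').comp (show Tendsto E u (𝓝 E') from hE')
  have hL : Lab u A a E' := by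
    intro ρ hρ
    filter_upwards [hpos, ht.eventually (Metric.ball_mem_nhds _ hρ)] with ε h1 h2
    exact ⟨E ε, h2, h1.2⟩
  have hZ : (E' : ℂ) - a ∈ ZH k ∨ (E' : ℂ) + a ∈ ZH k := by
    by_contra! hcon
    have hc : IsOpen (ZH k)ᶜ := (ZH_isClosed hk).isOpen_compl
    have h1 : ∀ᶠ z : ℂ in 𝓝 (E' : ℂ), z - a ∈ (ZH k)ᶜ ∧ z + a ∈ (ZH k)ᶜ :=
      ((continuous_id.sub continuous_const : Continuous fun z : ℂ => z -
          a).continuousAt.eventually (hc.mem_nhds hcon.1)).and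
        ((continuous_add_const (a : ℂ)).continuousAt.eventually (hc.mem_nhds hcon.2))
    obtain ⟨δ, hδ, h1⟩ := Metric.nhds_basis_closedBall.eventually_iff.mp h1
    have h2 := no_eigenvalue hk (isCompact_closedBall (E' : ℂ) δ) (a := a) h1
    have h3 : ∀ᶠ ε in (u : Filter ℝ), _ := hu (eventually_fix h2)
    obtain ⟨ε, ⟨E, hE, hm⟩, h4⟩ := ((hL δ hδ).and h3).exists
    exact h4 E (Metric.ball_subset_closedBall hE) hm.1
  rcases hZ with h | h
  · exact ⟨_, 1, Or.inl rfl, h, by rwa [one_mul, sub_add_cancel]⟩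
  · exact ⟨_, -1, Or.inr rfl, h, by rwa [neg_one_mul, add_neg_cancel_right]⟩

theorem exists_generic (hk : 1 ≤ k) : ∃ a : ℝ, |a| ≤ 1 ∧
    ∀ e ∈ ZH k, ∀ σ : ℂ, (σ = 1 ∨ σ = -1) → e + 2 * σ * a ∉ ZH k := by
  have hc : (Set.image2 (fun z w : ℂ => (w.re - z.re) / 2) (ZH k) (ZH k)).Countable :=
    (ZH_countable hk).image2 (ZH_countable hk) _
  obtain ⟨a, ha, ha0, ha1⟩ := (hc.dense_compl ℝ).exists_between one_pos
  refine ⟨a, abs_le.2 ⟨by linarith, ha1.le⟩, fun e he σ hσ h => ha ?_⟩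
  rcases hσ with rfl | rfl
  · exact ⟨e, he, _, h, by simp⟩
  · exact ⟨_, h, e, he, by simp⟩

theorem Sg_isPathConnected (hk : 1 ≤ k) : IsPathConnected (Sg (2 * k + 2)) := by
  have hd2 : 2 ≤ 2 * k + 2 := by omega
  have hev : Even (2 * k + 2) := ⟨k + 1, by omega⟩
  obtain ⟨a, ha, hgen⟩ := exists_generic hk
  obtain ⟨e, he⟩ := ZH_nonempty hk
  have h1 := eventually_fix ((branch_unique hk (Or.inl rfl) he (hgen e he 1 (Or.inl rfl))).2 1
    one_pos)
  obtain ⟨ε, E, -, hp⟩ := h1.exists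
  refine ⟨_, hp, fun {q} hq => ?_⟩
  set p := (Pa k (2 * k + 2 - 1) ε a, Pe k ε E)
  by_contra hcon
  have hu : (Ultrafilter.of (𝓝[>] (0 : ℝ)) : Filter ℝ) ≤ 𝓝[>] 0 := Ultrafilter.of_le _
  have hA := LC_joined hd2 hev p
  obtain ⟨e₁, σ₁, hσ₁, he₁, hL₁⟩ := exists_Lab hk hu hA ⟨hp, JoinedIn.refl hp⟩ ha
  obtain ⟨e₂, σ₂, hσ₂, he₂, hL₂⟩ := exists_Lab hk hu hA.compl ⟨hq, hcon⟩ ha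
  exact Lab.same hk hu hA hσ₁ hσ₂ he₁ he₂ (hgen e₁ he₁ σ₁ hσ₁) (hgen e₂ he₂ σ₂ hσ₂) hL₁ hL₂

end Connectedness

theorem stmt3 (d : ℕ) (hd : 4 ≤ d) (hev : Even d) :
    IsPathConnected {p : (Fin (d - 1) → ℂ) × ℂ |
      ∃ y : ℂ → ℂ, y ≠ 0 ∧ IsSol d p.1 p.2 y ∧
        Tendsto (fun x : ℝ => y (x : ℂ)) atTop (𝓝 0) ∧
        Tendsto (fun x : ℝ => y (x : ℂ)) atBot (𝓝 0)} := by
  obtain ⟨m, rfl⟩ := hev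
  obtain ⟨k, rfl⟩ : ∃ k, m = k + 1 := ⟨m - 1, by omega⟩
  obtain rfl | h := Nat.eq_zero_or_pos k
  · omega
  rw [← Sg_eq, show k + 1 + (k + 1) = 2 * k + 2 by ring]
  exact Sg_isPathConnected h
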